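/- arXiv:1608.05438 — 10 statements merged into one kernel-verified Lean document; each statement's English description precedes it below -/
import Mathlib

section
/- Every differentiable solution F : [0,∞) → ℝ^I of the discrete C₁₂ system satisfies conservation of energy: Σ_{k=1}^I k·F_k(t) = Σ_{k=1}^I k·F_k(0) for all t ≥ 0; equivalently, Σ_{k=1}^I k·(dF_k/dt)(t) = 0 for all t ≥ 0. -/
/-- The right-hand side of the discrete `C₁₂` system for `k₁ ∈ {1,…,I}`. -/
noncomputable def C12 (I : ℕ) (K : ℕ → ℕ → ℕ → ℝ) (F : ℕ → ℝ) (k₁ : ℕ) : ℝ :=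
  (∑ k₂ ∈ Finset.Icc 1 I, ∑ k₃ ∈ Finset.Icc 1 I,
    if k₂ + k₃ = k₁ then
      K k₁ k₂ k₃ * ((F k₁ + 1) * F k₂ * F k₃ - F k₁ * (F k₂ + 1) * (F k₃ + 1))
    else 0)
  - 2 * (∑ k₂ ∈ Finset.Icc 1 I, ∑ k₃ ∈ Finset.Icc 1 I,
    if k₁ + k₃ = k₂ then
      K k₂ k₁ k₃ * ((F k₂ + 1) * F k₁ * F k₃ - F k₂ * (F k₁ + 1) * (F k₃ + 1))
    else 0)

theorem C12_sum_zero (I : ℕ) (K : ℕ → ℕ → ℕ → ℝ)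
    (hK : ∀ a b c, K a b c = K a c b) (F : ℕ → ℝ) :
    ∑ k ∈ Finset.Icc 1 I, (k : ℝ) * C12 I K F k = 0 := by
  obtain ⟨T, hT⟩ : ∃ T : ℕ → ℕ → ℕ → ℝ, T = fun a b c => if b + c = a then
      K a b c * ((F a + 1) * F b * F c - F a * (F b + 1) * (F c + 1)) else 0 := ⟨_, rfl⟩
  have hC : ∀ k, C12 I K F k = (∑ b ∈ Finset.Icc 1 I, ∑ c ∈ Finset.Icc 1 I, T k b c)
      - 2 * (∑ b ∈ Finset.Icc 1 I, ∑ c ∈ Finset.Icc 1 I, T b k c) := by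
    intro k
    rw [hT]; rfl
  have hsymm : ∀ a b c, T a b c = T a c b := by
    intro a b c
    simp only [hT, add_comm c b, hK a c b]
    split_ifs <;> ring
  have hmul : ∀ a b c : ℕ, (a : ℝ) * T a b c = b * T a b c + c * T a b c := by
    intro a b c
    simp only [hT]
    split_ifs with h
    · rw [← h]; push_cast; ring
    · simp
  have h1 : ∑ a ∈ Finset.Icc 1 I, ∑ b ∈ Finset.Icc 1 I, ∑ c ∈ Finset.Icc 1 I, (a : ℝ) * T b a c
      = ∑ a ∈ Finset.Icc 1 I, ∑ b ∈ Finset.Icc 1 I, ∑ c ∈ Finset.Icc 1 I, (b : ℝ) * T a b c :=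
    Finset.sum_comm
  have h2 : ∑ a ∈ Finset.Icc 1 I, ∑ b ∈ Finset.Icc 1 I, ∑ c ∈ Finset.Icc 1 I, (c : ℝ) * T a b c
      = ∑ a ∈ Finset.Icc 1 I, ∑ b ∈ Finset.Icc 1 I, ∑ c ∈ Finset.Icc 1 I, (b : ℝ) * T a b c := by
    refine Finset.sum_congr rfl fun a _ => ?_
    rw [Finset.sum_comm]
    refine Finset.sum_congr rfl fun b _ => Finset.sum_congr rfl fun c _ => ?_
    rw [hsymm]
  have h3 : ∑ k ∈ Finset.Icc 1 I, (k : ℝ) * C12 I K F k =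
      ∑ a ∈ Finset.Icc 1 I, ∑ b ∈ Finset.Icc 1 I, ∑ c ∈ Finset.Icc 1 I, (a : ℝ) * T a b c
      - 2 * ∑ a ∈ Finset.Icc 1 I, ∑ b ∈ Finset.Icc 1 I, ∑ c ∈ Finset.Icc 1 I,
        (a : ℝ) * T b a c := by
    rw [Finset.mul_sum, ← Finset.sum_sub_distrib]
    refine Finset.sum_congr rfl fun a _ => ?_
    rw [hC]
    simp only [← Finset.mul_sum]
    ring
  rw [h3, h1]
  simp only [hmul, Finset.sum_add_distrib]
  rw [h2]
  ring

/-- Conservation of energy for the discrete `C₁₂` system. -/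
theorem C12_energy_conservation (I : ℕ) (hI : 2 ≤ I) (K : ℕ → ℕ → ℕ → ℝ)
    (hKpos : ∀ a b c, 0 < K a b c)
    (hKsymm : ∀ a b c, K a b c = K b a c ∧ K a b c = K a c b)
    (F : ℝ → ℕ → ℝ)
    (hF : ∀ t ∈ Set.Ici (0 : ℝ), ∀ k₁ ∈ Finset.Icc 1 I,
      HasDerivWithinAt (fun s => F s k₁) (C12 I K (F t) k₁) (Set.Ici 0) t) :
    (∀ t ∈ Set.Ici (0 : ℝ),
      ∑ k ∈ Finset.Icc 1 I, (k : ℝ) * F t k = ∑ k ∈ Finset.Icc 1 I, (k : ℝ) * F 0 k) ∧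
    (∀ t ∈ Set.Ici (0 : ℝ),
      HasDerivWithinAt (fun s => ∑ k ∈ Finset.Icc 1 I, (k : ℝ) * F s k) 0 (Set.Ici 0) t) := by
  have hd : ∀ t ∈ Set.Ici (0 : ℝ),
      HasDerivWithinAt (fun s => ∑ k ∈ Finset.Icc 1 I, (k : ℝ) * F s k) 0 (Set.Ici 0) t := by
    intro t ht
    have h := HasDerivWithinAt.fun_sum (u := Finset.Icc 1 I)
      fun k hk => (hF t ht k hk).const_mul (k : ℝ)
    rw [C12_sum_zero I K (fun a b c => (hKsymm a b c).2) (F t)] at h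
    exact h
  refine ⟨fun t ht => ?_, hd⟩
  have ht0 : (0 : ℝ) ≤ t := ht
  refine constant_of_has_deriv_right_zero (a := 0) (b := t)
    (f := fun s => ∑ k ∈ Finset.Icc 1 I, (k : ℝ) * F s k) ?_ ?_ t ⟨ht0, le_rfl⟩
  · intro x hx
    exact ((hd x hx.1).continuousWithinAt).mono fun y hy => hy.1
  · intro x hx
    exact (hd x hx.1).mono fun y hy => le_trans hx.1 hy
end

section
/- Let f : [0,∞) → ℝ^{ℒ_R} be a solution of the discrete quantum Boltzmann equation for C₁₂ on ℒ_R with f_p(0) > 0 for all p ∈ ℒ_R ∖ {0} and f₀(0) = 0. Then there exists an equilibrium state f* = (f*_p)_{p∈ℒ_R} such that: (i) for every nonzero P₀ ∈ ℤ³ whose coordinates have greatest common divisor 1 and with P₀ ∈ ℒ_R, there exists a constant ρ(P₀) > 0 such that f*_{kP₀} = 1/(e^{k·ρ(P₀)} − 1) for every positive integer k with kP₀ ∈ ℒ_R; and (ii) there exist constants C₁, C₂ > 0 such that max_{p∈ℒ_R} |f_p(t) − f*_p| ≤ C₁ e^{−C₂ t} for all t ≥ 0. -/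
/-- Euclidean norm of an integer vector in `ℤ³`. -/
noncomputable def znorm (p : Fin 3 → ℤ) : ℝ :=
  Real.sqrt (∑ i, ((p i : ℝ)) ^ 2)

open Classical in
/-- The right-hand side of the discrete quantum Boltzmann equation for `C₁₂`
on the lattice `ℒ_R = {p ∈ ℤ³ : |p| < R}`, at the point `p₁`. -/
noncomputable def C12lat (R : ℝ) (K : (Fin 3 → ℤ) → (Fin 3 → ℤ) → (Fin 3 → ℤ) → ℝ)
    (f : (Fin 3 → ℤ) → ℝ) (p₁ : Fin 3 → ℤ) : ℝ :=
  (∑ᶠ p₂ : Fin 3 → ℤ, ∑ᶠ p₃ : Fin 3 → ℤ,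
    if znorm p₂ < R ∧ znorm p₃ < R ∧ p₁ = p₂ + p₃ ∧ znorm p₁ = znorm p₂ + znorm p₃ then
      K p₁ p₂ p₃ * ((f p₁ + 1) * f p₂ * f p₃ - f p₁ * (f p₂ + 1) * (f p₃ + 1))
    else 0)
  - 2 * (∑ᶠ p₂ : Fin 3 → ℤ, ∑ᶠ p₃ : Fin 3 → ℤ,
    if znorm p₂ < R ∧ znorm p₃ < R ∧ p₂ = p₁ + p₃ ∧ znorm p₂ = znorm p₁ + znorm p₃ then
      K p₂ p₁ p₃ * ((f p₂ + 1) * f p₁ * f p₃ - f p₂ * (f p₁ + 1) * (f p₃ + 1))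
    else 0)



lemma hd_mono (u u' : ℝ → ℝ) (C a b : ℝ) (ha : 0 ≤ a) (hab : a ≤ b)
    (hu : ∀ t, 0 ≤ t → HasDerivWithinAt u (u' t) (Set.Ici 0) t)
    (h : ∀ t ∈ Set.Icc a b, 0 ≤ u' t + C * u t) :
    u a * Real.exp (C * a) ≤ u b * Real.exp (C * b) := by
  have hm : MonotoneOn (fun t => u t * Real.exp (C * t)) (Set.Icc a b) := by
    apply monotoneOn_of_hasDerivWithinAt_nonneg (convex_Icc a b)
      (f' := fun t => (u' t + C * u t) * Real.exp (C * t))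
    · apply ContinuousOn.mul
      · intro t ht
        exact ((hu t (ha.trans ht.1)).continuousWithinAt).mono
          (fun x hx => ha.trans hx.1)
      · fun_prop
    · intro t ht
      rw [interior_Icc] at ht
      have h1 : HasDerivAt u (u' t) t :=
        (hu t (ha.trans ht.1.le)).hasDerivAt (Ici_mem_nhds (lt_of_le_of_lt ha ht.1))
      have h2 : HasDerivAt (fun t => Real.exp (C * t)) (Real.exp (C * t) * (C * 1)) t :=
        ((hasDerivAt_id t).const_mul C).exp
      have h3 := (h1.mul h2).hasDerivWithinAt (s := interior (Set.Icc a b))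
      exact h3.congr_deriv (by ring)
    · intro t ht
      exact mul_nonneg (h t (interior_subset ht)) (Real.exp_pos _).le
  exact hm (Set.left_mem_Icc.2 hab) (Set.right_mem_Icc.2 hab) hab

lemma hd_lower (u u' : ℝ → ℝ) (C a : ℝ) (hC : 0 < C)
    (hu : ∀ t, 0 ≤ t → HasDerivWithinAt u (u' t) (Set.Ici 0) t)
    (h : ∀ t, 0 ≤ t → a ≤ u' t + C * u t) (t : ℝ) (ht : 0 ≤ t) :
    min (u 0) (a / C) ≤ u t := by
  have := hd_mono (fun t => u t - a / C) u' C 0 t le_rfl ht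
    (fun t ht => (hu t ht).sub_const _) (by
      intro s hs
      have := h s hs.1
      have e : C * (u s - a / C) = C * u s - a := by field_simp
      rw [e]; linarith)
  simp only [mul_zero, Real.exp_zero, mul_one] at this
  by_contra hlt
  push Not at hlt
  have h1 := lt_of_lt_of_le hlt (min_le_left _ _)
  have h2 := lt_of_lt_of_le hlt (min_le_right _ _)
  have h3 : 1 ≤ Real.exp (C * t) := Real.one_le_exp (by positivity)
  nlinarith

lemma ex_rho (N : ℕ) (hN : 1 ≤ N) (E : ℝ) (hE : 0 < E) :
    ∃ ρ > (0:ℝ), ∑ k ∈ Finset.Icc 1 N, (k:ℝ) * (1 / (Real.exp (k * ρ) - 1)) = E := by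
  have hpos : ∀ k ∈ Finset.Icc 1 N, ∀ ρ : ℝ, 0 < ρ → 0 < Real.exp (k * ρ) - 1 := by
    intro k hk ρ hρ
    have : (1:ℝ) ≤ k := by exact_mod_cast (Finset.mem_Icc.1 hk).1
    have := Real.add_one_lt_exp (x := k * ρ) (by positivity)
    nlinarith
  set a := Real.log (1 + 1 / E) with ha
  have ha0 : 0 < a := Real.log_pos (by have : 0 < 1 / E := by positivity
                                       linarith)
  have hN' : (1:ℝ) ≤ N := by exact_mod_cast hN
  set b := (N:ℝ) / E with hb
  have hb0 : 0 < b := by positivity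
  set G : ℝ → ℝ := fun ρ => ∑ k ∈ Finset.Icc 1 N, (k:ℝ) * (1 / (Real.exp (k * ρ) - 1)) with hG
  have h1 : E ≤ G a := by
    have := Finset.single_le_sum (f := fun k : ℕ => (k:ℝ) * (1 / (Real.exp (k * a) - 1)))
      (s := Finset.Icc 1 N) (fun k hk => by
        have := hpos k hk a ha0
        positivity) (Finset.mem_Icc.2 ⟨le_rfl, hN⟩)
    refine le_trans (le_of_eq ?_) this
    simp only [Nat.cast_one, one_mul]
    rw [ha, Real.exp_log (by positivity)]
    field_simp
    ring
  have h2 : G b ≤ E := by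
    have : ∀ k ∈ Finset.Icc 1 N, (k:ℝ) * (1 / (Real.exp (k * b) - 1)) ≤ 1 / b := by
      intro k hk
      have h0 := hpos k hk b hb0
      have := Real.add_one_le_exp (k * b)
      rw [mul_one_div, div_le_div_iff₀ h0 hb0]
      linarith
    refine (Finset.sum_le_sum this).trans (le_of_eq ?_)
    simp [hb]
    field_simp
  have hab : 0 < min a b := lt_min ha0 hb0
  have hc : ContinuousOn G (Set.uIcc a b) := by
    apply continuousOn_finsetSum
    intro k hk
    apply ContinuousOn.mul continuousOn_const
    apply ContinuousOn.div continuousOn_const (by fun_prop)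
    intro x hx
    exact (hpos k hk x (lt_of_lt_of_le hab hx.1)).ne'
  have := intermediate_value_uIcc hc (Set.mem_uIcc.2 (Or.inr ⟨h2, h1⟩))
  obtain ⟨ρ, hρ, he⟩ := this
  exact ⟨ρ, lt_of_lt_of_le hab hρ.1, he⟩

/-- derivative of entropy density -/
noncomputable def ell (g : ℝ) : ℝ := Real.log g - Real.log (1 + g)

/-- relative entropy density -/
noncomputable def Vd (s g : ℝ) : ℝ :=
  g * Real.log g - (1 + g) * Real.log (1 + g) - (s * Real.log s - (1 + s) * Real.log (1 + s))
    - ell s * (g - s)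

lemma Vd_deriv (s g : ℝ) (hg : 0 < g) : HasDerivAt (Vd s) (ell g - ell s) g := by
  have h1 : HasDerivAt (fun x : ℝ => x * Real.log x) (1 * Real.log g + g * (1 / g)) g :=
    (hasDerivAt_id g).mul ((hasDerivAt_id g).log hg.ne')
  have h0 : HasDerivAt (fun x : ℝ => 1 + x) 1 g := (hasDerivAt_id g).const_add 1
  have h2 : HasDerivAt (fun x : ℝ => (1 + x) * Real.log (1 + x))
      (1 * Real.log (1 + g) + (1 + g) * (1 / (1 + g))) g :=
    h0.mul (h0.log (by positivity))
  have h3 : HasDerivAt (fun x : ℝ => ell s * (x - s)) (ell s * 1) g :=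
    ((hasDerivAt_id g).sub_const s).const_mul _
  have := ((h1.sub h2).sub_const (s * Real.log s - (1 + s) * Real.log (1 + s))).sub h3
  refine this.congr_deriv ?_
  unfold ell
  field_simp
  ring

lemma ell_sub_le (g s : ℝ) (hg : 0 < g) (hs : 0 < s) :
    ell g - ell s ≤ (g - s) / (s * (1 + g)) := by
  have h := Real.log_le_sub_one_of_pos (x := g * (1 + s) / (s * (1 + g))) (by positivity)
  rw [Real.log_div (by positivity) (by positivity), Real.log_mul (by positivity) (by positivity),
    Real.log_mul (by positivity) (by positivity)] at h
  have e : g * (1 + s) / (s * (1 + g)) - 1 = (g - s) / (s * (1 + g)) := by field_simp; ring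
  unfold ell
  linarith

lemma ell_bounds1 (ε M g s : ℝ) (hε : 0 < ε) (hg : ε ≤ g) (hs : ε ≤ s) (hg' : g ≤ M) (hs' : s ≤ M) (h : s ≤ g) :
    1 / (M * (1 + M)) * (g - s) ≤ (ell g - ell s)  ∧
    (ell g - ell s) ≤ 1 / ε * (g - s) := by
  have g0 : 0 < g := by linarith
  have s0 : 0 < s := by linarith
  have h1 := ell_sub_le g s g0 s0
  have h2 := ell_sub_le s g s0 g0
  have d : 0 ≤ g - s := by linarith
  constructor
  · have : 1 / (M * (1 + M)) * (g - s) ≤ 1 / (g * (1 + s)) * (g - s) := by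
      have M0 : 0 ≤ M := by linarith
      gcongr
    have e : (s - g) / (g * (1 + s)) = - (1 / (g * (1 + s)) * (g - s)) := by field_simp; ring
    linarith
  · have : 1 / (s * (1 + g)) * (g - s) ≤ 1 / ε * (g - s) := by
      gcongr
      nlinarith
    have e : (g - s) / (s * (1 + g)) = 1 / (s * (1 + g)) * (g - s) := by field_simp
    linarith

lemma ell_bounds (ε M g s : ℝ) (hε : 0 < ε) (hg : ε ≤ g) (hs : ε ≤ s) (hg' : g ≤ M) (hs' : s ≤ M) :
    1 / (M * (1 + M)) * (g - s) ^ 2 ≤ (ell g - ell s) * (g - s) ∧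
    (ell g - ell s) * (g - s) ≤ 1 / ε * (g - s) ^ 2 := by
  rcases le_total s g with h | h
  · obtain ⟨a, b⟩ := ell_bounds1 ε M g s hε hg hs hg' hs' h
    constructor <;> nlinarith
  · obtain ⟨a, b⟩ := ell_bounds1 ε M s g hε hs hg hs' hg' h
    constructor <;> nlinarith

lemma min_lemma (F F' : ℝ → ℝ) (s g : ℝ)
    (hF : ∀ y ∈ Set.uIcc s g, HasDerivAt F (F' y) y)
    (h : ∀ y ∈ Set.uIcc s g, 0 ≤ F' y * (y - s)) : F s ≤ F g := by
  rcases lt_trichotomy s g with hlt | rfl | hlt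
  · rw [Set.uIcc_of_le hlt.le] at *
    obtain ⟨c, hc, he⟩ := exists_hasDerivAt_eq_slope F F' hlt
      (fun y hy => (hF y hy).continuousAt.continuousWithinAt)
      (fun y hy => hF y (Set.Ioo_subset_Icc_self hy))
    have h1 := h c (Set.Ioo_subset_Icc_self hc)
    have : 0 ≤ F' c := nonneg_of_mul_nonneg_left h1 (by linarith [hc.1])
    rw [eq_div_iff (by linarith)] at he
    nlinarith
  · exact le_rfl
  · rw [Set.uIcc_of_ge hlt.le] at *
    obtain ⟨c, hc, he⟩ := exists_hasDerivAt_eq_slope F F' hlt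
      (fun y hy => (hF y hy).continuousAt.continuousWithinAt)
      (fun y hy => hF y (Set.Ioo_subset_Icc_self hy))
    have h1 := h c (Set.Ioo_subset_Icc_self hc)
    have : F' c ≤ 0 := by
      by_contra h2
      push Not at h2
      nlinarith [hc.2]
    rw [eq_div_iff (by linarith)] at he
    nlinarith

lemma Vd_bounds (ε M g s : ℝ) (hε : 0 < ε) (hg : ε ≤ g) (hs : ε ≤ s) (hg' : g ≤ M) (hs' : s ≤ M) :
    1 / (M * (1 + M)) / 2 * (g - s) ^ 2 ≤ Vd s g ∧ Vd s g ≤ 1 / ε / 2 * (g - s) ^ 2 := by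
  have hV : Vd s s = 0 := by unfold Vd; ring
  have hb : ∀ y ∈ Set.uIcc s g, ε ≤ y ∧ y ≤ M := fun y hy =>
    ⟨(le_min hs hg).trans hy.1, hy.2.trans (max_le hs' hg')⟩
  have hq : ∀ c y : ℝ, HasDerivAt (fun y => c / 2 * (y - s) ^ 2) (c * (y - s)) y := by
    intro c y
    have := (((hasDerivAt_id y).sub_const s).pow 2).const_mul (c / 2)
    refine this.congr_deriv ?_
    simp
    ring
  constructor
  · have := min_lemma (fun y => Vd s y - 1 / (M * (1 + M)) / 2 * (y - s) ^ 2)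
      (fun y => (ell y - ell s) - 1 / (M * (1 + M)) * (y - s)) s g
      (fun y hy => (Vd_deriv s y (hε.trans_le (hb y hy).1)).sub (hq _ y))
      (fun y hy => by
        have := (ell_bounds ε M y s hε (hb y hy).1 hs (hb y hy).2 hs').1
        nlinarith)
    simp only [hV] at this
    nlinarith
  · have := min_lemma (fun y => 1 / ε / 2 * (y - s) ^ 2 - Vd s y)
      (fun y => 1 / ε * (y - s) - (ell y - ell s)) s g
      (fun y hy => (hq _ y).sub (Vd_deriv s y (hε.trans_le (hb y hy).1)))
      (fun y hy => by
        have := (ell_bounds ε M y s hε (hb y hy).1 hs (hb y hy).2 hs').2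
        nlinarith)
    simp only [hV] at this
    nlinarith

lemma log_diss (A D m : ℝ) (hm : 0 < m) (hA : m ≤ A) (hD : m ≤ D) :
    m * (Real.log A - Real.log D) ^ 2 ≤ (A - D) * (Real.log A - Real.log D) := by
  have A0 : 0 < A := by linarith
  have D0 : 0 < D := by linarith
  have key : ∀ A D : ℝ, m ≤ A → m ≤ D → D ≤ A →
      m * (Real.log A - Real.log D) ^ 2 ≤ (A - D) * (Real.log A - Real.log D) := by
    intro A D hA hD h
    have A0 : 0 < A := by linarith
    have D0 : 0 < D := by linarith
    have h1 := Real.log_le_sub_one_of_pos (x := A / D) (by positivity)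
    rw [Real.log_div (by positivity) (by positivity)] at h1
    have h2 : 0 ≤ Real.log A - Real.log D := by
      linarith [Real.log_le_log D0 h]
    have h3 : m * (Real.log A - Real.log D) ≤ A - D := by
      calc _ ≤ D * (Real.log A - Real.log D) := by gcongr
        _ ≤ D * (A / D - 1) := by gcongr
        _ = A - D := by field_simp
    nlinarith
  rcases le_total D A with h | h
  · exact key A D hA hD h
  · have := key D A hD hA h
    nlinarith


/-- collision bracket -/
noncomputable def Qc (g : ℕ → ℝ) (i j : ℕ) : ℝ :=
  (g (i + j) + 1) * g i * g j - g (i + j) * (g i + 1) * (g j + 1)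

/-- reduced collision operator on a ray -/
noncomputable def rhs (N : ℕ) (B : ℕ → ℕ → ℝ) (g : ℕ → ℝ) (k : ℕ) : ℝ :=
  (∑ i ∈ Finset.Icc 1 N, ∑ j ∈ Finset.Icc 1 N, if i + j = k then B i j * Qc g i j else 0)
  - 2 * ∑ j ∈ Finset.Icc 1 N, B k j * Qc g k j

lemma rhs_weak (N : ℕ) (B : ℕ → ℕ → ℝ) (hBs : ∀ i j, B i j = B j i)
    (hB0 : ∀ i j, N < i + j → B i j = 0) (g φ : ℕ → ℝ) :
    ∑ k ∈ Finset.Icc 1 N, φ k * rhs N B g k =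
      ∑ i ∈ Finset.Icc 1 N, ∑ j ∈ Finset.Icc 1 N,
        B i j * Qc g i j * (φ (i + j) - φ i - φ j) := by
  have hQ : ∀ i j, Qc g i j = Qc g j i := by
    intro i j; unfold Qc; rw [add_comm j i]; ring
  have h1 : ∑ k ∈ Finset.Icc 1 N, φ k *
      (∑ i ∈ Finset.Icc 1 N, ∑ j ∈ Finset.Icc 1 N, if i + j = k then B i j * Qc g i j else 0)
      = ∑ i ∈ Finset.Icc 1 N, ∑ j ∈ Finset.Icc 1 N, B i j * Qc g i j * φ (i + j) := by
    simp_rw [Finset.mul_sum]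
    rw [Finset.sum_comm]
    refine Finset.sum_congr rfl fun i hi => ?_
    rw [Finset.sum_comm]
    refine Finset.sum_congr rfl fun j hj => ?_
    rw [Finset.mem_Icc] at hi hj
    by_cases h : i + j ≤ N
    · rw [Finset.sum_eq_single (i + j)]
      · simp; ring
      · intro b _ hb
        rw [if_neg (Ne.symm hb), mul_zero]
      · intro hn
        exact absurd (Finset.mem_Icc.2 ⟨by omega, h⟩) hn
    · rw [hB0 i j (by omega)]
      simp
  have h2 : ∑ i ∈ Finset.Icc 1 N, ∑ j ∈ Finset.Icc 1 N, B i j * Qc g i j * φ j =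
      ∑ i ∈ Finset.Icc 1 N, ∑ j ∈ Finset.Icc 1 N, B i j * Qc g i j * φ i := by
    rw [Finset.sum_comm]
    refine Finset.sum_congr rfl fun i _ => Finset.sum_congr rfl fun j _ => ?_
    rw [hBs, hQ]
  have h3 : ∑ k ∈ Finset.Icc 1 N, φ k * (2 * ∑ j ∈ Finset.Icc 1 N, B k j * Qc g k j) =
     2 * ∑ i ∈ Finset.Icc 1 N, ∑ j ∈ Finset.Icc 1 N, B i j * Qc g i j * φ i := by
    simp_rw [Finset.mul_sum]
    refine Finset.sum_congr rfl fun i _ => Finset.sum_congr rfl fun j _ => ?_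
    ring
  unfold rhs
  simp_rw [mul_sub, Finset.sum_sub_distrib]
  rw [h1, h3, h2]
  ring

lemma rhs_lower (N : ℕ) (B : ℕ → ℕ → ℝ) (hBn : ∀ i j, 0 ≤ B i j)
    (hB0 : ∀ i j, N < i + j → B i j = 0) (M : ℝ) (hM : 0 ≤ M) (g : ℕ → ℝ)
    (hg : ∀ k ∈ Finset.Icc 1 N, 0 ≤ g k) (hgM : ∀ k ∈ Finset.Icc 1 N, g k ≤ M)
    (k : ℕ) (hk : k ∈ Finset.Icc 1 N) :
    (∑ i ∈ Finset.Icc 1 N, ∑ j ∈ Finset.Icc 1 N, if i + j = k then B i j * (g i * g j) else 0)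
    + 2 * ∑ j ∈ Finset.Icc 1 N, B k j * g (k + j) ≤
    rhs N B g k + ((∑ i ∈ Finset.Icc 1 N, ∑ j ∈ Finset.Icc 1 N, B i j) * (4 * M + 1)) * g k := by
  have gk0 := hg k hk
  have h1 : (∑ i ∈ Finset.Icc 1 N, ∑ j ∈ Finset.Icc 1 N,
        if i + j = k then B i j * (g i * g j) else 0) ≤
      (∑ i ∈ Finset.Icc 1 N, ∑ j ∈ Finset.Icc 1 N, if i + j = k then B i j * Qc g i j else 0)
      + (∑ i ∈ Finset.Icc 1 N, ∑ j ∈ Finset.Icc 1 N, B i j) * ((2 * M + 1) * g k) := by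
    rw [Finset.sum_mul, ← Finset.sum_add_distrib]
    refine Finset.sum_le_sum fun i hi => ?_
    rw [Finset.sum_mul, ← Finset.sum_add_distrib]
    refine Finset.sum_le_sum fun j hj => ?_
    have hb := hBn i j
    split_ifs with h
    · have : g i * g j ≤ Qc g i j + (2 * M + 1) * g k := by
        unfold Qc
        rw [h]
        nlinarith [hgM i hi, hgM j hj, mul_nonneg gk0 (sub_nonneg.2 (hgM i hi)),
          mul_nonneg gk0 (sub_nonneg.2 (hgM j hj))]
      nlinarith [mul_le_mul_of_nonneg_left this hb]
    · positivity
  have h2 : ∑ j ∈ Finset.Icc 1 N, B k j * g (k + j) ≤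
      - (∑ j ∈ Finset.Icc 1 N, B k j * Qc g k j) + (∑ j ∈ Finset.Icc 1 N, B k j) * (M * g k) := by
    rw [Finset.sum_mul, ← Finset.sum_neg_distrib, ← Finset.sum_add_distrib]
    refine Finset.sum_le_sum fun j hj => ?_
    have hb := hBn k j
    by_cases h : k + j ≤ N
    · have hkj : k + j ∈ Finset.Icc 1 N := by
        rw [Finset.mem_Icc] at *; omega
      have : g (k + j) ≤ - Qc g k j + M * g k := by
        unfold Qc
        nlinarith [hg _ hkj, mul_nonneg (hg _ hkj) gk0, mul_nonneg (hg _ hkj) (hg j hj),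
          mul_nonneg gk0 (sub_nonneg.2 (hgM j hj))]
      nlinarith [mul_le_mul_of_nonneg_left this hb]
    · rw [hB0 k j (by omega)]; simp
  have h3 : ∑ j ∈ Finset.Icc 1 N, B k j ≤ ∑ i ∈ Finset.Icc 1 N, ∑ j ∈ Finset.Icc 1 N, B i j :=
    Finset.single_le_sum (f := fun i => ∑ j ∈ Finset.Icc 1 N, B i j)
      (fun i _ => Finset.sum_nonneg fun j _ => hBn i j) hk
  have h4 := mul_le_mul_of_nonneg_right h3 (mul_nonneg hM gk0)
  unfold rhs
  nlinarith

section ODE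
variable (N : ℕ) (B : ℕ → ℕ → ℝ) (hBs : ∀ i j, B i j = B j i) (hBn : ∀ i j, 0 ≤ B i j)
    (hB0 : ∀ i j, N < i + j → B i j = 0)
    (g : ℝ → ℕ → ℝ)
    (hsol : ∀ t, 0 ≤ t → ∀ k ∈ Finset.Icc 1 N,
      HasDerivWithinAt (fun s => g s k) (rhs N B (g t) k) (Set.Ici 0) t)
    (hinit : ∀ k ∈ Finset.Icc 1 N, 0 < g 0 k)

include hBs hB0 hsol in
lemma ode_energy (t : ℝ) (ht : 0 ≤ t) :
    ∑ k ∈ Finset.Icc 1 N, (k:ℝ) * g t k = ∑ k ∈ Finset.Icc 1 N, (k:ℝ) * g 0 k := by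
  have hd : ∀ s, 0 ≤ s → HasDerivWithinAt (fun s => ∑ k ∈ Finset.Icc 1 N, (k:ℝ) * g s k) 0
      (Set.Ici 0) s := by
    intro s hs
    have := HasDerivWithinAt.fun_sum (u := Finset.Icc 1 N)
      (fun k hk => (hsol s hs k hk).const_mul (k:ℝ))
    refine this.congr_deriv ?_
    rw [rhs_weak N B hBs hB0 (g s) (fun k => (k:ℝ))]
    refine Finset.sum_eq_zero fun i _ => Finset.sum_eq_zero fun j _ => ?_
    push_cast; ring
  have h1 := hd_mono _ (fun _ => 0) 0 0 t le_rfl ht hd (by simp)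
  have h2 := hd_mono _ (fun _ => -0) 0 0 t le_rfl ht (fun s hs => (hd s hs).neg) (by simp)
  simp at h1 h2
  linarith

include hBs hB0 hsol hinit hBn in
lemma ode_pos (t : ℝ) (ht : 0 ≤ t) : ∀ k ∈ Finset.Icc 1 N, 0 < g t k := by
  set E := ∑ k ∈ Finset.Icc 1 N, (k:ℝ) * g 0 k with hE
  have hE0 : 0 ≤ E := Finset.sum_nonneg fun k hk => mul_nonneg (by positivity) (hinit k hk).le
  set C := (∑ i ∈ Finset.Icc 1 N, ∑ j ∈ Finset.Icc 1 N, B i j) * (4 * E + 1) with hC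
  have hcont : ∀ s, 0 ≤ s → ∀ k ∈ Finset.Icc 1 N,
      ContinuousWithinAt (fun s => g s k) (Set.Ici 0) s :=
    fun s hs k hk => (hsol s hs k hk).continuousWithinAt
  set S : Set ℝ := {s | ∀ k ∈ Finset.Icc 1 N, g 0 k ≤ g s k * Real.exp (C * s)} with hS
  have hcl : IsClosed (S ∩ Set.Icc 0 t) := by
    have : S ∩ Set.Icc 0 t = Set.Icc 0 t ∩ ⋂ k ∈ Finset.Icc 1 N,
        (Set.Icc 0 t ∩ (fun s => g s k * Real.exp (C * s)) ⁻¹' (Set.Ici (g 0 k))) := by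
      ext s
      simp only [hS, Set.mem_inter_iff, Set.mem_ofPred_eq, Set.mem_iInter, Set.mem_preimage,
        Set.mem_Ici]
      constructor
      · rintro ⟨a, b⟩
        exact ⟨b, fun k hk => ⟨b, a k hk⟩⟩
      · rintro ⟨a, b⟩
        exact ⟨fun k hk => (b k hk).2, a⟩
    rw [this]
    refine isClosed_Icc.inter (isClosed_biInter fun k hk => ?_)
    refine ContinuousOn.preimage_isClosed_of_isClosed ?_ isClosed_Icc isClosed_Ici
    apply ContinuousOn.mul
    · intro s hs
      exact (hcont s hs.1 k hk).mono (fun x hx => hx.1)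
    · fun_prop
  have h0 : (0:ℝ) ∈ S := by
    intro k hk; simp
  have hpos : ∀ s ∈ S, ∀ k ∈ Finset.Icc 1 N, 0 < g s k := by
    intro s hs k hk
    have := lt_of_lt_of_le (hinit k hk) (hs k hk)
    exact pos_of_mul_pos_left this (Real.exp_pos _).le
  have hsub := hcl.Icc_subset_of_forall_mem_nhdsWithin h0 (by
    rintro x ⟨hx, hx0⟩
    have hev : ∀ᶠ s in nhdsWithin x (Set.Ici x), ∀ k ∈ Finset.Icc 1 N, 0 < g s k := by
      rw [Filter.eventually_all_finset]
      intro k hk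
      exact ((hcont x hx0.1 k hk).mono (fun y hy => hx0.1.trans hy)).eventually
        (lt_mem_nhds (hpos x hx k hk))
    obtain ⟨u, hu, husub⟩ := mem_nhdsGE_iff_exists_Icc_subset.1 hev
    refine Filter.mem_of_superset (Ioc_mem_nhdsGT hu) ?_
    intro s hs k hk
    have := hd_mono (fun s => g s k) (fun s => rhs N B (g s) k) C x s hx0.1 hs.1.le
      (fun r hr => hsol r hr k hk) (by
        intro r hr
        have hr0 : 0 ≤ r := hx0.1.trans hr.1
        have hp : ∀ k ∈ Finset.Icc 1 N, 0 < g r k := husub ⟨hr.1, hr.2.trans hs.2⟩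
        have hen := ode_energy N B hBs hB0 g hsol r hr0
        have hM : ∀ k ∈ Finset.Icc 1 N, g r k ≤ E := by
          intro k hk
          rw [hE, ← hen]
          have := Finset.single_le_sum (f := fun k : ℕ => (k:ℝ) * g r k)
            (fun k hk => mul_nonneg (by positivity) (hp k hk).le) hk
          have h1 : (1:ℝ) ≤ k := by exact_mod_cast (Finset.mem_Icc.1 hk).1
          nlinarith [hp k hk]
        have hl := rhs_lower N B hBn hB0 E hE0 (g r) (fun k hk => (hp k hk).le) hM k hk
        refine le_trans ?_ hl
        refine add_nonneg (Finset.sum_nonneg fun i hi => Finset.sum_nonneg fun j hj => ?_)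
          (mul_nonneg zero_le_two (Finset.sum_nonneg fun j hj => ?_))
        · split_ifs
          · exact mul_nonneg (hBn i j) (mul_nonneg (hp i hi).le (hp j hj).le)
          · exact le_rfl
        · by_cases h : k + j ≤ N
          · exact mul_nonneg (hBn k j) (hp _ (by rw [Finset.mem_Icc] at *; omega)).le
          · rw [hB0 k j (by omega)]; simp)
    exact (hx k hk).trans this)
  exact hpos t (hsub (Set.right_mem_Icc.2 ht))

include hBs hB0 hsol hinit hBn in
lemma ode_le (t : ℝ) (ht : 0 ≤ t) : ∀ k ∈ Finset.Icc 1 N,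
    g t k ≤ ∑ k ∈ Finset.Icc 1 N, (k:ℝ) * g 0 k := by
  intro k hk
  have hp := ode_pos N B hBs hBn hB0 g hsol hinit t ht
  rw [← ode_energy N B hBs hB0 g hsol t ht]
  have := Finset.single_le_sum (f := fun k : ℕ => (k:ℝ) * g t k)
    (fun k hk => mul_nonneg (by positivity) (hp k hk).le) hk
  have h1 : (1:ℝ) ≤ k := by exact_mod_cast (Finset.mem_Icc.1 hk).1
  nlinarith [hp k hk]

include hBs hB0 hsol hinit hBn in
lemma ode_lower (hN : 1 ≤ N) (β : ℝ) (hβ : 0 < β)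
    (hBβ : ∀ i ∈ Finset.Icc 1 N, ∀ j ∈ Finset.Icc 1 N, i + j ≤ N → β ≤ B i j) :
    ∀ k, 1 ≤ k → k ≤ N → ∃ ε > (0:ℝ), ∀ t, 0 ≤ t → ε ≤ g t k := by
  set E := ∑ k ∈ Finset.Icc 1 N, (k:ℝ) * g 0 k with hE
  have h1m : 1 ∈ Finset.Icc 1 N := Finset.mem_Icc.2 ⟨le_rfl, hN⟩
  have hE0 : 0 < E := Finset.sum_pos (fun k hk => mul_pos
    (by exact_mod_cast (Finset.mem_Icc.1 hk).1) (hinit k hk)) ⟨1, h1m⟩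
  set C := (∑ i ∈ Finset.Icc 1 N, ∑ j ∈ Finset.Icc 1 N, B i j) * (4 * E + 1) with hC
  have hC0 : 0 ≤ C := mul_nonneg (Finset.sum_nonneg fun i hi => Finset.sum_nonneg fun j hj => hBn i j)
    (by positivity)
  have hp := ode_pos N B hBs hBn hB0 g hsol hinit
  have hM := ode_le N B hBs hBn hB0 g hsol hinit
  have hl := fun t ht => rhs_lower N B hBn hB0 E hE0.le (g t) (fun k hk => (hp t ht k hk).le)
    (hM t ht)
  have hN0 : (1:ℝ) ≤ N := by exact_mod_cast hN
  have nn1 : ∀ t, 0 ≤ t → ∀ k, ∀ i ∈ Finset.Icc 1 N, ∀ j ∈ Finset.Icc 1 N,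
      0 ≤ if i + j = k then B i j * (g t i * g t j) else 0 := by
    intro t ht k i hi j hj
    split_ifs
    · exact mul_nonneg (hBn i j) (mul_nonneg (hp t ht i hi).le (hp t ht j hj).le)
    · exact le_rfl
  have nn2 : ∀ t, 0 ≤ t → ∀ k ∈ Finset.Icc 1 N, ∀ j ∈ Finset.Icc 1 N, 0 ≤ B k j * g t (k + j) := by
    intro t ht k hk j hj
    by_cases h : k + j ≤ N
    · exact mul_nonneg (hBn k j) (hp t ht _ (by rw [Finset.mem_Icc] at *; omega)).le
    · rw [hB0 k j (by omega)]; simp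
  have key1 : ∃ ε₁ > (0:ℝ), ∀ t, 0 ≤ t → ε₁ ≤ g t 1 := by
    have key : ∀ t, 0 ≤ t → 2 * (β * E / N ^ 2) ≤
        rhs N B (g t) 1 + (C + 2 * β) * g t 1 := by
      intro t ht
      have h := hl t ht 1 h1m
      rw [← hC] at h
      have h0 : 0 ≤ ∑ i ∈ Finset.Icc 1 N, ∑ j ∈ Finset.Icc 1 N,
          if i + j = 1 then B i j * (g t i * g t j) else 0 :=
        Finset.sum_nonneg fun i hi => Finset.sum_nonneg fun j hj => nn1 t ht 1 i hi j hj
      set S := ∑ j ∈ Finset.Icc 1 N, B 1 j * g t (1 + j) with hS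
      have hS0 : 0 ≤ S := Finset.sum_nonneg fun j hj => nn2 t ht 1 h1m j hj
      have hm : ∀ m ∈ Finset.Icc 1 N, β * ((m:ℝ) * g t m) ≤ N * S + β * g t 1 := by
        intro m hm
        have hm' := Finset.mem_Icc.1 hm
        by_cases h1 : m = 1
        · subst h1; simp; positivity
        · have hj : m - 1 ∈ Finset.Icc 1 N := Finset.mem_Icc.2 ⟨by omega, by omega⟩
          have h2 := Finset.single_le_sum (f := fun j => B 1 j * g t (1 + j))
            (fun j hj => nn2 t ht 1 h1m j hj) hj
          rw [show 1 + (m - 1) = m by omega] at h2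
          have h3 := hBβ 1 h1m (m - 1) hj (by omega)
          have h4 := hp t ht m hm
          have h5 : β * g t m ≤ S := (mul_le_mul_of_nonneg_right h3 h4.le).trans h2
          have h6 : (m:ℝ) ≤ N := by exact_mod_cast hm'.2
          have h7 : (m:ℝ) * (β * g t m) ≤ N * S := by gcongr
          nlinarith [hp t ht 1 h1m]
      have hs := Finset.sum_le_sum hm
      rw [← Finset.mul_sum, ode_energy N B hBs hB0 g hsol t ht, ← hE] at hs
      simp only [Finset.sum_const, Nat.card_Icc, nsmul_eq_mul, Nat.add_sub_cancel] at hs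
      have h8 : β * E / N ^ 2 ≤ S + β * g t 1 := by
        rw [div_le_iff₀ (by positivity)]
        have : 0 ≤ β * g t 1 := mul_nonneg hβ.le (hp t ht 1 h1m).le
        have h9 : (N:ℝ) * (β * g t 1) ≤ N ^ 2 * (β * g t 1) := by
          gcongr
          nlinarith
        nlinarith
      nlinarith
    refine ⟨min (g 0 1) (2 * (β * E / N ^ 2) / (C + 2 * β)),
      lt_min (hinit 1 h1m) (by positivity), fun t ht => ?_⟩
    exact hd_lower (fun s => g s 1) (fun s => rhs N B (g s) 1) _ _ (by positivity)
      (fun s hs => hsol s hs 1 h1m) key t ht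
  obtain ⟨ε₁, hε₁, hb₁⟩ := key1
  intro k hk
  induction k, hk using Nat.le_induction with
  | base => exact fun _ => ⟨ε₁, hε₁, hb₁⟩
  | succ k hk ih =>
    intro hkN
    obtain ⟨ε, hε, hb⟩ := ih (by omega)
    have hkm : k ∈ Finset.Icc 1 N := Finset.mem_Icc.2 ⟨hk, by omega⟩
    have hkm1 : k + 1 ∈ Finset.Icc 1 N := Finset.mem_Icc.2 ⟨by omega, hkN⟩
    have key : ∀ t, 0 ≤ t → β * (ε * ε₁) ≤ rhs N B (g t) (k + 1) + (C + 1) * g t (k + 1) := by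
      intro t ht
      have h := hl t ht (k + 1) hkm1
      rw [← hC] at h
      have h2 : 0 ≤ ∑ j ∈ Finset.Icc 1 N, B (k + 1) j * g t (k + 1 + j) :=
        Finset.sum_nonneg fun j hj => nn2 t ht _ hkm1 j hj
      have h3 : B k 1 * (g t k * g t 1) ≤ ∑ i ∈ Finset.Icc 1 N, ∑ j ∈ Finset.Icc 1 N,
          if i + j = k + 1 then B i j * (g t i * g t j) else 0 := by
        have a := Finset.single_le_sum (f := fun i => ∑ j ∈ Finset.Icc 1 N,
          if i + j = k + 1 then B i j * (g t i * g t j) else 0)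
          (fun i hi => Finset.sum_nonneg fun j hj => nn1 t ht (k + 1) i hi j hj) hkm
        have b := Finset.single_le_sum (f := fun j =>
          if k + j = k + 1 then B k j * (g t k * g t j) else 0)
          (fun j hj => nn1 t ht (k + 1) k hkm j hj) h1m
        simp only [if_true] at a b
        exact b.trans a
      have h4 : β * (ε * ε₁) ≤ B k 1 * (g t k * g t 1) := by
        have := hb t ht
        have := hb₁ t ht
        have := hBβ k hkm 1 h1m hkN
        have := hBn k 1
        have := hp t ht k hkm
        gcongr
      nlinarith [hp t ht (k + 1) hkm1]
    refine ⟨min (g 0 (k + 1)) (β * (ε * ε₁) / (C + 1)),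
      lt_min (hinit _ hkm1) (by positivity), fun t ht => ?_⟩
    exact hd_lower (fun s => g s (k + 1)) (fun s => rhs N B (g s) (k + 1)) _ _ (by positivity)
      (fun s hs => hsol s hs _ hkm1) key t ht

end ODE


lemma finset_min {ι : Type*} (s : Finset ι) (e : ι → ℝ) (h : ∀ k ∈ s, 0 < e k) :
    ∃ ε > (0:ℝ), ∀ k ∈ s, ε ≤ e k := by
  classical
  induction s using Finset.induction_on with
  | empty => exact ⟨1, one_pos, by simp⟩
  | insert a s ha ih =>
    obtain ⟨ε, hε, hb⟩ := ih fun k hk => h k (Finset.mem_insert_of_mem hk)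
    refine ⟨min ε (e a), lt_min hε (h a (Finset.mem_insert_self _ _)), fun k hk => ?_⟩
    rcases Finset.mem_insert.1 hk with rfl | hk
    · exact min_le_right _ _
    · exact (min_le_left _ _).trans (hb k hk)

lemma diss_term (ε : ℝ) (hε : 0 < ε) (g : ℕ → ℝ) (i j : ℕ) (hi : ε ≤ g i) (hj : ε ≤ g j)
    (hk : ε ≤ g (i + j)) :
    ε ^ 3 * (ell (g i) + ell (g j) - ell (g (i + j))) ^ 2 ≤
      Qc g i j * (ell (g i) + ell (g j) - ell (g (i + j))) := by
  have i0 : 0 < g i := by linarith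
  have j0 : 0 < g j := by linarith
  have k0 : 0 < g (i + j) := by linarith
  have h := log_diss ((g (i + j) + 1) * g i * g j) (g (i + j) * (g i + 1) * (g j + 1)) (ε ^ 3)
    (by positivity)
    (by rw [show ε ^ 3 = ε * ε * ε by ring]; gcongr; linarith)
    (by rw [show ε ^ 3 = ε * ε * ε by ring]; gcongr <;> linarith)
  rw [Real.log_mul (by positivity) (by positivity), Real.log_mul (by positivity) (by positivity),
    Real.log_mul (by positivity) (by positivity), Real.log_mul (by positivity) (by positivity)] at h
  have e : ell (g i) + ell (g j) - ell (g (i + j)) =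
     Real.log (g (i + j) + 1) + Real.log (g i) + Real.log (g j) -
      (Real.log (g (i + j)) + Real.log (g i + 1) + Real.log (g j + 1)) := by
    unfold ell
    rw [add_comm 1 (g i), add_comm 1 (g j), add_comm 1 (g (i + j))]; ring
  rw [e]
  exact h

lemma static_ineq (N : ℕ) (hN : 1 ≤ N) (B : ℕ → ℕ → ℝ) (hBn : ∀ i j, 0 ≤ B i j)
    (hB0 : ∀ i j, N < i + j → B i j = 0) (β : ℝ) (hβ : 0 < β)
    (hBβ : ∀ i ∈ Finset.Icc 1 N, ∀ j ∈ Finset.Icc 1 N, i + j ≤ N → β ≤ B i j)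
    (ε M ρ : ℝ) (hε : 0 < ε) (g s : ℕ → ℝ)
    (hg : ∀ k ∈ Finset.Icc 1 N, ε ≤ g k) (hg' : ∀ k ∈ Finset.Icc 1 N, g k ≤ M)
    (hs : ∀ k ∈ Finset.Icc 1 N, ε ≤ s k) (hs' : ∀ k ∈ Finset.Icc 1 N, s k ≤ M)
    (hρ : ∀ k ∈ Finset.Icc 1 N, ell (s k) = - (k * ρ))
    (hE : ∑ k ∈ Finset.Icc 1 N, (k:ℝ) * (g k - s k) = 0) :
    ∑ k ∈ Finset.Icc 1 N, (g k - s k) ^ 2 ≤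
      (N ^ 3 / ((1 / (M * (1 + M))) ^ 2 * (ε ^ 3 * β))) *
      ∑ i ∈ Finset.Icc 1 N, ∑ j ∈ Finset.Icc 1 N,
        B i j * Qc g i j * (ell (g i) + ell (g j) - ell (g (i + j))) := by
  set D := ∑ i ∈ Finset.Icc 1 N, ∑ j ∈ Finset.Icc 1 N,
        B i j * Qc g i j * (ell (g i) + ell (g j) - ell (g (i + j))) with hD
  have h1m : 1 ∈ Finset.Icc 1 N := Finset.mem_Icc.2 ⟨le_rfl, hN⟩
  have hM : 0 < M := by linarith [hg 1 h1m, hg' 1 h1m]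
  have hnn : ∀ i ∈ Finset.Icc 1 N, ∀ j ∈ Finset.Icc 1 N,
      B i j * (ε ^ 3 * (ell (g i) + ell (g j) - ell (g (i + j))) ^ 2) ≤
      B i j * Qc g i j * (ell (g i) + ell (g j) - ell (g (i + j))) := by
    intro i hi j hj
    by_cases h : i + j ≤ N
    · rw [mul_assoc (B i j)]
      exact mul_le_mul_of_nonneg_left (diss_term ε hε g i j (hg i hi) (hg j hj)
        (hg _ (by rw [Finset.mem_Icc] at *; omega))) (hBn i j)
    · rw [hB0 i j (by omega)]; simp
  have hnn0 : ∀ i ∈ Finset.Icc 1 N, ∀ j ∈ Finset.Icc 1 N,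
      0 ≤ B i j * Qc g i j * (ell (g i) + ell (g j) - ell (g (i + j))) := fun i hi j hj =>
    le_trans (mul_nonneg (hBn i j) (by positivity)) (hnn i hi j hj)
  have hD0 : 0 ≤ D := Finset.sum_nonneg fun i hi => Finset.sum_nonneg fun j hj => hnn0 i hi j hj
  set δ := Real.sqrt (D / (ε ^ 3 * β)) with hδ
  have hδ2 : δ ^ 2 = D / (ε ^ 3 * β) := Real.sq_sqrt (by positivity)
  have hδ0 : 0 ≤ δ := Real.sqrt_nonneg _
  have hd : ∀ j ∈ Finset.Icc 1 N, j + 1 ≤ N →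
      |ell (g j) + ell (g 1) - ell (g (j + 1))| ≤ δ := by
    intro j hj hjN
    apply Real.abs_le_sqrt
    rw [le_div_iff₀ (by positivity)]
    have a := Finset.single_le_sum (f := fun i => ∑ j ∈ Finset.Icc 1 N,
      B i j * Qc g i j * (ell (g i) + ell (g j) - ell (g (i + j))))
      (fun i hi => Finset.sum_nonneg fun j hj => hnn0 i hi j hj) hj
    have b := Finset.single_le_sum (f := fun k =>
      B j k * Qc g j k * (ell (g j) + ell (g k) - ell (g (j + k))))
      (fun k hk => hnn0 j hj k hk) h1m
    refine le_trans ?_ (b.trans a)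
    refine le_trans ?_ (hnn j hj 1 h1m)
    have := hBβ j hj 1 h1m hjN
    calc _ = β * (ε ^ 3 * (ell (g j) + ell (g 1) - ell (g (j + 1))) ^ 2) := by ring
      _ ≤ _ := by gcongr
  set w : ℕ → ℝ := fun k => ell (g k) + k * ρ with hw
  have hwk : ∀ k, 1 ≤ k → k ≤ N → |w k - k * w 1| ≤ (k - 1) * δ := by
    intro k hk
    induction k, hk using Nat.le_induction with
    | base => intro _; simp
    | succ k hk ih =>
      intro hkN
      have h1 := ih (by omega)
      have h2 := hd k (Finset.mem_Icc.2 ⟨hk, by omega⟩) hkN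
      have e : w (k + 1) - ((k + 1 : ℕ) : ℝ) * w 1 = (w k - k * w 1) -
        (ell (g k) + ell (g 1) - ell (g (k + 1))) := by
        simp only [hw]; push_cast; ring
      rw [e]
      push_cast
      have := abs_sub (w k - k * w 1) (ell (g k) + ell (g 1) - ell (g (k + 1)))
      nlinarith
  set c := 1 / (M * (1 + M)) with hc
  have hc0 : 0 < c := by positivity
  have hterm : ∀ k ∈ Finset.Icc 1 N, c / 2 * (g k - s k) ^ 2 ≤
      (k:ℝ) * (g k - s k) * w 1 + N ^ 2 * δ ^ 2 / (2 * c) := by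
    intro k hk
    have hk' := Finset.mem_Icc.1 hk
    have h1 := (ell_bounds ε M (g k) (s k) hε (hg k hk) (hs k hk) (hg' k hk) (hs' k hk)).1
    rw [hρ k hk, ← hc] at h1
    have e : ell (g k) - -(k * ρ) = w k := by simp only [hw]; ring
    rw [e] at h1
    have h2 := hwk k hk'.1 hk'.2
    have h3 : |w k - k * w 1| ≤ N * δ := by
      refine h2.trans ?_
      have : (k:ℝ) ≤ N := by exact_mod_cast hk'.2
      gcongr
      linarith
    have h4 : (w k - k * w 1) ^ 2 ≤ N ^ 2 * δ ^ 2 := by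
      rw [← mul_pow]
      exact sq_le_sq' (by linarith [neg_abs_le (w k - k * w 1)]) ((le_abs_self _).trans h3)
    have h5 : (w k - k * w 1) * (g k - s k) ≤ c / 2 * (g k - s k) ^ 2 +
        (w k - k * w 1) ^ 2 / (2 * c) := by
      have : 0 ≤ (c * (g k - s k) - (w k - k * w 1)) ^ 2 / (2 * c) := by positivity
      have e2 : (c * (g k - s k) - (w k - k * w 1)) ^ 2 / (2 * c) =
        c / 2 * (g k - s k) ^ 2 + (w k - k * w 1) ^ 2 / (2 * c) - (w k - k * w 1) * (g k - s k) := by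
        field_simp; ring
      linarith
    have h6 : (w k - k * w 1) ^ 2 / (2 * c) ≤ N ^ 2 * δ ^ 2 / (2 * c) := by gcongr
    nlinarith
  have hsum := Finset.sum_le_sum hterm
  rw [← Finset.mul_sum, Finset.sum_add_distrib, ← Finset.sum_mul, hE, hδ2] at hsum
  simp only [Finset.sum_const, Nat.card_Icc, nsmul_eq_mul, Nat.add_sub_cancel, zero_mul,
    zero_add] at hsum
  have : ∑ k ∈ Finset.Icc 1 N, (g k - s k) ^ 2 =
      (2 / c) * (c / 2 * ∑ k ∈ Finset.Icc 1 N, (g k - s k) ^ 2) := by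
    field_simp
  rw [this]
  refine (mul_le_mul_of_nonneg_left hsum (by positivity)).trans (le_of_eq ?_)
  field_simp

theorem ode_conv (N : ℕ) (hN : 1 ≤ N) (B : ℕ → ℕ → ℝ) (hBs : ∀ i j, B i j = B j i)
    (hBn : ∀ i j, 0 ≤ B i j)
    (hB0 : ∀ i j, N < i + j → B i j = 0)
    (hBp : ∀ i ∈ Finset.Icc 1 N, ∀ j ∈ Finset.Icc 1 N, i + j ≤ N → 0 < B i j)
    (g : ℝ → ℕ → ℝ)
    (hsol : ∀ t, 0 ≤ t → ∀ k ∈ Finset.Icc 1 N,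
      HasDerivWithinAt (fun s => g s k) (rhs N B (g t) k) (Set.Ici 0) t)
    (hinit : ∀ k ∈ Finset.Icc 1 N, 0 < g 0 k) :
    ∃ ρ > (0:ℝ), ∃ C₁ > (0:ℝ), ∃ C₂ > (0:ℝ), ∀ t, 0 ≤ t → ∀ k ∈ Finset.Icc 1 N,
      |g t k - 1 / (Real.exp (k * ρ) - 1)| ≤ C₁ * Real.exp (-C₂ * t) := by
  obtain ⟨β, hβ, hBβ'⟩ := finset_min
    ((Finset.Icc 1 N ×ˢ Finset.Icc 1 N).filter fun x => x.1 + x.2 ≤ N) (fun x => B x.1 x.2) (by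
      intro x hx
      rw [Finset.mem_filter, Finset.mem_product] at hx
      exact hBp _ hx.1.1 _ hx.1.2 hx.2)
  have hBβ : ∀ i ∈ Finset.Icc 1 N, ∀ j ∈ Finset.Icc 1 N, i + j ≤ N → β ≤ B i j := by
    intro i hi j hj h
    exact hBβ' (i, j) (Finset.mem_filter.2 ⟨Finset.mem_product.2 ⟨hi, hj⟩, h⟩)
  have h1m : 1 ∈ Finset.Icc 1 N := Finset.mem_Icc.2 ⟨le_rfl, hN⟩
  set E := ∑ k ∈ Finset.Icc 1 N, (k:ℝ) * g 0 k with hE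
  have hE0 : 0 < E := Finset.sum_pos (fun k hk => mul_pos
    (by exact_mod_cast (Finset.mem_Icc.1 hk).1) (hinit k hk)) ⟨1, h1m⟩
  obtain ⟨ρ, hρ, hρE⟩ := ex_rho N hN E hE0
  set s : ℕ → ℝ := fun k => 1 / (Real.exp (k * ρ) - 1) with hs
  have hexp : ∀ k ∈ Finset.Icc 1 N, 0 < Real.exp (k * ρ) - 1 := by
    intro k hk
    have : (1:ℝ) ≤ k := by exact_mod_cast (Finset.mem_Icc.1 hk).1
    have := Real.add_one_lt_exp (x := k * ρ) (by positivity)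
    nlinarith
  have hs0 : ∀ k ∈ Finset.Icc 1 N, 0 < s k := fun k hk => one_div_pos.2 (hexp k hk)
  have hsE : ∀ k ∈ Finset.Icc 1 N, s k ≤ E := by
    intro k hk
    rw [← hρE]
    have := Finset.single_le_sum (f := fun k : ℕ => (k:ℝ) * s k)
      (fun k hk => mul_nonneg (by positivity) (hs0 k hk).le) hk
    have h1 : (1:ℝ) ≤ k := by exact_mod_cast (Finset.mem_Icc.1 hk).1
    nlinarith [hs0 k hk]
  have hell : ∀ k ∈ Finset.Icc 1 N, ell (s k) = - (k * ρ) := by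
    intro k hk
    have h := hexp k hk
    unfold ell
    rw [← Real.log_div (hs0 k hk).ne' (by linarith [hs0 k hk])]
    have : s k / (1 + s k) = Real.exp (-(k * ρ)) := by
      rw [Real.exp_neg]
      simp only [hs]
      field_simp
      ring
    rw [this, Real.log_exp]
  have hp := ode_pos N B hBs hBn hB0 g hsol hinit
  have hM := ode_le N B hBs hBn hB0 g hsol hinit
  have hlow : ∀ k, ∃ ε > (0:ℝ), k ∈ Finset.Icc 1 N → ∀ t, 0 ≤ t → ε ≤ g t k := by
    intro k
    by_cases hk : k ∈ Finset.Icc 1 N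
    · obtain ⟨ε, h, h'⟩ := ode_lower N B hBs hBn hB0 g hsol hinit hN β hβ hBβ k
        (Finset.mem_Icc.1 hk).1 (Finset.mem_Icc.1 hk).2
      exact ⟨ε, h, fun _ => h'⟩
    · exact ⟨1, one_pos, fun h => absurd h hk⟩
  choose e he0 he using hlow
  obtain ⟨ε, hε, hεb⟩ := finset_min (Finset.Icc 1 N) (fun k => min (e k) (s k))
    (fun k hk => lt_min (he0 k) (hs0 k hk))
  have hg : ∀ t, 0 ≤ t → ∀ k ∈ Finset.Icc 1 N, ε ≤ g t k := fun t ht k hk =>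
    ((hεb k hk).trans (min_le_left _ _)).trans (he k hk t ht)
  have hse : ∀ k ∈ Finset.Icc 1 N, ε ≤ s k := fun k hk => (hεb k hk).trans (min_le_right _ _)
  set c := 1 / (E * (1 + E)) with hc
  have hc0 : 0 < c := by positivity
  have hN0 : (1:ℝ) ≤ N := by exact_mod_cast hN
  set κ := (N:ℝ) ^ 3 / (c ^ 2 * (ε ^ 3 * β)) with hκ
  have hκ0 : 0 < κ := by positivity
  set V : ℝ → ℝ := fun t => ∑ k ∈ Finset.Icc 1 N, Vd (s k) (g t k) with hV
  set D : ℝ → ℝ := fun t => ∑ i ∈ Finset.Icc 1 N, ∑ j ∈ Finset.Icc 1 N,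
        B i j * Qc (g t) i j * (ell (g t i) + ell (g t j) - ell (g t (i + j))) with hD
  have hVd : ∀ t, 0 ≤ t → HasDerivWithinAt V (-D t) (Set.Ici 0) t := by
    intro t ht
    have := HasDerivWithinAt.fun_sum (u := Finset.Icc 1 N)
      (fun k hk => (Vd_deriv (s k) (g t k) (hp t ht k hk)).comp_hasDerivWithinAt t
        (hsol t ht k hk))
    refine this.congr_deriv ?_
    have e1 : ∑ k ∈ Finset.Icc 1 N, (ell (g t k) - ell (s k)) * rhs N B (g t) k =
        ∑ k ∈ Finset.Icc 1 N, (ell (g t k) + k * ρ) * rhs N B (g t) k := by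
      refine Finset.sum_congr rfl fun k hk => ?_
      rw [hell k hk]; ring
    rw [e1, rhs_weak N B hBs hB0 (g t) (fun k => ell (g t k) + k * ρ)]
    simp only [hD]
    rw [← Finset.sum_neg_distrib]
    refine Finset.sum_congr rfl fun i _ => ?_
    rw [← Finset.sum_neg_distrib]
    refine Finset.sum_congr rfl fun j _ => ?_
    push_cast; ring
  have hst : ∀ t, 0 ≤ t → ∑ k ∈ Finset.Icc 1 N, (g t k - s k) ^ 2 ≤ κ * D t := by
    intro t ht
    refine static_ineq N hN B hBn hB0 β hβ hBβ ε E ρ hε (g t) s (hg t ht) (hM t ht) hse hsE hell ?_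
    simp_rw [mul_sub]
    rw [Finset.sum_sub_distrib, ode_energy N B hBs hB0 g hsol t ht, hρE]
    simp [hE]
  have hVb := fun t ht k hk => Vd_bounds ε E (g t k) (s k) hε (hg t ht k hk) (hse k hk)
    (hM t ht k hk) (hsE k hk)
  have hVup : ∀ t, 0 ≤ t → V t ≤ 1 / ε / 2 * κ * D t := by
    intro t ht
    have : V t ≤ 1 / ε / 2 * ∑ k ∈ Finset.Icc 1 N, (g t k - s k) ^ 2 := by
      rw [Finset.mul_sum]
      exact Finset.sum_le_sum fun k hk => (hVb t ht k hk).2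
    refine this.trans ?_
    rw [mul_assoc]
    exact mul_le_mul_of_nonneg_left (hst t ht) (by positivity)
  have hVlo : ∀ t, 0 ≤ t → ∀ k ∈ Finset.Icc 1 N, c / 2 * (g t k - s k) ^ 2 ≤ V t := by
    intro t ht k hk
    refine (hVb t ht k hk).1.trans ?_
    exact Finset.single_le_sum (f := fun k => Vd (s k) (g t k)) (fun k hk =>
      le_trans (by positivity) (hVb t ht k hk).1) hk
  set A := 1 / ε / 2 * κ with hA
  have hA0 : 0 < A := by positivity
  have hV0 : 0 ≤ V 0 := le_trans (by positivity) (hVlo 0 le_rfl 1 h1m)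
  refine ⟨ρ, hρ, Real.sqrt (2 / c * V 0) + 1, by positivity, 1 / A / 2, by positivity, ?_⟩
  intro t ht k hk
  have h1 := hd_mono (fun t => - V t) (fun t => -(-D t)) (1 / A) 0 t le_rfl ht
    (fun r hr => (hVd r hr).neg) (by
      intro r hr
      have := hVup r hr.1
      have h2 : 1 / A * V r ≤ D r := by
        rw [one_div, inv_mul_le_iff₀ hA0]; exact this
      linarith)
  simp only [mul_zero, Real.exp_zero, mul_one] at h1
  have h2 := hVlo t ht k hk
  set x := Real.exp (1 / A / 2 * t) with hx
  have hx0 : 0 < x := Real.exp_pos _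
  have hxx : Real.exp (1 / A * t) = x ^ 2 := by
    rw [hx, ← Real.exp_nat_mul]; congr 1; push_cast; ring
  have hxi : Real.exp (-(1 / A / 2) * t) = x⁻¹ := by
    rw [hx, ← Real.exp_neg]; congr 1; ring
  rw [hxx] at h1
  rw [hxi]
  have h3 : |(g t k - s k) * x| ≤ Real.sqrt (2 / c * V 0) := by
    apply Real.abs_le_sqrt
    have : c / 2 * (g t k - s k) ^ 2 * x ^ 2 ≤ V 0 := by nlinarith [sq_nonneg x]
    calc ((g t k - s k) * x) ^ 2 = 2 / c * (c / 2 * (g t k - s k) ^ 2 * x ^ 2) := by field_simp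
      _ ≤ _ := by gcongr
  rw [abs_mul, abs_of_pos hx0] at h3
  rw [← div_eq_mul_inv, le_div_iff₀ hx0]
  linarith


/-- real embedding of a lattice point -/
noncomputable def emb (p : Fin 3 → ℤ) : EuclideanSpace ℝ (Fin 3) := WithLp.toLp 2 (fun i => (p i : ℝ))

lemma znorm_eq (p : Fin 3 → ℤ) : znorm p = ‖emb p‖ := by
  rw [EuclideanSpace.norm_eq]
  unfold znorm emb
  congr 1
  refine Finset.sum_congr rfl fun i _ => ?_
  simp

lemma emb_add (p q : Fin 3 → ℤ) : emb (p + q) = emb p + emb q := by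
  ext i; simp [emb]

lemma emb_smul (k : ℕ) (p : Fin 3 → ℤ) : emb ((k:ℤ) • p) = (k:ℝ) • emb p := by
  ext i; simp [emb]

lemma emb_ne (p : Fin 3 → ℤ) (h : p ≠ 0) : emb p ≠ 0 := by
  intro h0
  apply h
  ext i
  have := congrArg (fun x : EuclideanSpace ℝ (Fin 3) => x i) h0
  simpa [emb] using this

lemma znorm_smul (k : ℕ) (p : Fin 3 → ℤ) : znorm ((k:ℤ) • p) = k * znorm p := by
  rw [znorm_eq, znorm_eq, emb_smul, norm_smul]; simp

lemma znorm_pos (p : Fin 3 → ℤ) (h : p ≠ 0) : 0 < znorm p := by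
  rw [znorm_eq]; exact norm_pos_iff.2 (emb_ne p h)

lemma bezout (P : Fin 3 → ℤ)
    (h : Nat.gcd (Nat.gcd (P 0).natAbs (P 1).natAbs) (P 2).natAbs = 1) :
    ∃ a : Fin 3 → ℤ, a 0 * P 0 + a 1 * P 1 + a 2 * P 2 = 1 := by
  have h1 := Int.gcd_eq_gcd_ab (P 0) (P 1)
  have h2 := Int.gcd_eq_gcd_ab (Int.gcd (P 0) (P 1)) (P 2)
  have h3 : Int.gcd (Int.gcd (P 0) (P 1)) (P 2) = 1 := by
    simpa [Int.gcd_def] using h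
  rw [h3] at h2
  generalize Int.gcdA (Int.gcd (P 0) (P 1)) (P 2) = x at h2
  generalize Int.gcdB (Int.gcd (P 0) (P 1)) (P 2) = y at h2
  rw [h1] at h2
  refine ⟨![Int.gcdA (P 0) (P 1) * x, Int.gcdB (P 0) (P 1) * x, y], ?_⟩
  simp only [Matrix.cons_val_zero, Matrix.cons_val_one, Matrix.cons_val]
  push_cast at h2
  linarith

lemma ray_int (P : Fin 3 → ℤ) (hP : P ≠ 0)
    (h : Nat.gcd (Nat.gcd (P 0).natAbs (P 1).natAbs) (P 2).natAbs = 1)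
    (q : Fin 3 → ℤ) (r : ℝ) (hr : 0 ≤ r) (hq : emb q = r • emb P) :
    ∃ n : ℕ, q = (n:ℤ) • P := by
  obtain ⟨a, ha⟩ := bezout P h
  have hc : ∀ i, (q i : ℝ) = r * P i := by
    intro i
    have := congrArg (fun x : EuclideanSpace ℝ (Fin 3) => x i) hq
    simpa [emb] using this
  set z := a 0 * q 0 + a 1 * q 1 + a 2 * q 2 with hz
  have hzr : (z:ℝ) = r := by
    rw [hz]; push_cast
    rw [hc, hc, hc]
    have : (a 0 * P 0 + a 1 * P 1 + a 2 * P 2 : ℝ) = 1 := by exact_mod_cast ha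
    linear_combination r * this
  have hz0 : 0 ≤ z := by
    have : (0:ℝ) ≤ z := by rw [hzr]; exact hr
    exact_mod_cast this
  refine ⟨z.toNat, ?_⟩
  rw [Int.toNat_of_nonneg hz0]
  ext i
  have := hc i
  rw [← hzr] at this
  simp only [Pi.smul_apply, smul_eq_mul]
  exact_mod_cast this

lemma ray2 (P : Fin 3 → ℤ) (hP : P ≠ 0)
    (h : Nat.gcd (Nat.gcd (P 0).natAbs (P 1).natAbs) (P 2).natAbs = 1)
    (k : ℕ) (hk : 1 ≤ k) (q : Fin 3 → ℤ)
    (hn : znorm ((k:ℤ) • P + q) = znorm ((k:ℤ) • P) + znorm q) : ∃ n : ℕ, q = (n:ℤ) • P := by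
  rw [znorm_eq, znorm_eq, znorm_eq, emb_add, emb_smul] at hn
  have hs := sameRay_iff_norm_add.2 hn
  have hk0 : (k:ℝ) ≠ 0 := by positivity
  obtain ⟨r, hr, he⟩ := hs.exists_nonneg_left (smul_ne_zero hk0 (emb_ne P hP))
  exact ray_int P hP h q (r * k) (by positivity) (by rw [← he, smul_smul])

lemma ray1 (P : Fin 3 → ℤ) (hP : P ≠ 0)
    (h : Nat.gcd (Nat.gcd (P 0).natAbs (P 1).natAbs) (P 2).natAbs = 1)
    (k : ℕ) (hk : 1 ≤ k) (p q : Fin 3 → ℤ) (hpq : (k:ℤ) • P = p + q)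
    (hn : znorm (p + q) = znorm p + znorm q) : ∃ n : ℕ, p = (n:ℤ) • P := by
  rw [znorm_eq, znorm_eq, znorm_eq, emb_add] at hn
  have hs := sameRay_iff_norm_add.2 hn
  have hs2 : SameRay ℝ (emb p + emb q) (emb p) := ((SameRay.refl _).add_right hs).symm
  rw [← emb_add, ← hpq, emb_smul] at hs2
  have hk0 : (k:ℝ) ≠ 0 := by positivity
  obtain ⟨r, hr, he⟩ := hs2.exists_nonneg_left (smul_ne_zero hk0 (emb_ne P hP))
  exact ray_int P hP h p (r * k) (by positivity) (by rw [← he, smul_smul])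

lemma smul_inj (P : Fin 3 → ℤ) (hP : P ≠ 0) (i j : ℕ) (h : (i:ℤ) • P = (j:ℤ) • P) : i = j := by
  have := smul_left_injective ℤ hP h
  exact_mod_cast this

lemma finsum_ray (P : Fin 3 → ℤ) (hP : P ≠ 0) (N : ℕ)
    (F : (Fin 3 → ℤ) → (Fin 3 → ℤ) → ℝ)
    (hF : ∀ p q, F p q ≠ 0 → (∃ i ∈ Finset.Icc 1 N, p = (i:ℤ) • P) ∧
      (∃ i ∈ Finset.Icc 1 N, q = (i:ℤ) • P)) :
    (∑ᶠ p, ∑ᶠ q, F p q) =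
      ∑ i ∈ Finset.Icc 1 N, ∑ j ∈ Finset.Icc 1 N, F ((i:ℤ) • P) ((j:ℤ) • P) := by
  classical
  have hinj : Set.InjOn (fun i : ℕ => (i:ℤ) • P) (Finset.Icc 1 N : Finset ℕ) :=
    fun i _ j _ h => smul_inj P hP i j h
  have h1 : ∀ p, (∑ᶠ q, F p q) = ∑ j ∈ Finset.Icc 1 N, F p ((j:ℤ) • P) := by
    intro p
    rw [finsum_eq_sum_of_support_subset _ (s := (Finset.Icc 1 N).image (fun i : ℕ => (i:ℤ) • P))]
    · rw [Finset.sum_image hinj]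
    · intro q hq
      obtain ⟨i, hi, he⟩ := (hF p q hq).2
      simp only [Finset.coe_image, Set.mem_image]
      exact ⟨i, hi, he.symm⟩
  simp_rw [h1]
  rw [finsum_eq_sum_of_support_subset _ (s := (Finset.Icc 1 N).image (fun i : ℕ => (i:ℤ) • P))]
  · rw [Finset.sum_image hinj]
  · intro p hp
    obtain ⟨j, _, hj⟩ := Finset.exists_ne_zero_of_sum_ne_zero hp
    obtain ⟨i, hi, he⟩ := (hF p _ hj).1
    simp only [Finset.coe_image, Set.mem_image]
    exact ⟨i, hi, he.symm⟩

/-- reduced kernel on a ray -/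
noncomputable def Bray (N : ℕ) (K : (Fin 3 → ℤ) → (Fin 3 → ℤ) → (Fin 3 → ℤ) → ℝ)
    (P : Fin 3 → ℤ) (i j : ℕ) : ℝ :=
  if i + j ≤ N then K (((i + j : ℕ) : ℤ) • P) ((i:ℤ) • P) ((j:ℤ) • P) else 0

lemma C12_ray (R : ℝ) (K : (Fin 3 → ℤ) → (Fin 3 → ℤ) → (Fin 3 → ℤ) → ℝ)
    (hKzero : ∀ p₁ p₂ p₃ : Fin 3 → ℤ, (p₁ = 0 ∨ p₂ = 0 ∨ p₃ = 0) → K p₁ p₂ p₃ = 0)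
    (P : Fin 3 → ℤ) (hP : P ≠ 0)
    (h : Nat.gcd (Nat.gcd (P 0).natAbs (P 1).natAbs) (P 2).natAbs = 1)
    (N : ℕ) (hN : ∀ k : ℕ, znorm ((k:ℤ) • P) < R ↔ k ≤ N)
    (f : (Fin 3 → ℤ) → ℝ) (k : ℕ) (hk : k ∈ Finset.Icc 1 N) :
    C12lat R K f ((k:ℤ) • P) = rhs N (Bray N K P) (fun i => f ((i:ℤ) • P)) k := by
  rw [Finset.mem_Icc] at hk
  have hmul : ∀ q : Fin 3 → ℤ, q ≠ 0 → znorm q < R → (∃ n : ℕ, q = (n:ℤ) • P) →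
      ∃ i ∈ Finset.Icc 1 N, q = (i:ℤ) • P := by
    rintro q hq hR ⟨n, rfl⟩
    refine ⟨n, Finset.mem_Icc.2 ⟨?_, (hN n).1 hR⟩, rfl⟩
    rcases Nat.eq_zero_or_pos n with rfl | h
    · simp at hq
    · exact h
  have hadd : ∀ i j : ℕ, (i:ℤ) • P + (j:ℤ) • P = ((i + j : ℕ) : ℤ) • P := by
    intro i j; push_cast; rw [add_smul]
  have hz : ∀ i j : ℕ, znorm (((i + j : ℕ) : ℤ) • P) = znorm ((i:ℤ) • P) + znorm ((j:ℤ) • P) := by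
    intro i j; simp only [znorm_smul]; push_cast; ring
  unfold C12lat rhs
  rw [finsum_ray P hP N, finsum_ray P hP N]
  · congr 1
    · refine Finset.sum_congr rfl fun i hi => Finset.sum_congr rfl fun j hj => ?_
      rw [Finset.mem_Icc] at hi hj
      by_cases he : i + j = k
      · subst he
        rw [if_pos ⟨(hN i).2 hi.2, (hN j).2 hj.2, (hadd i j).symm, hz i j⟩, if_pos rfl]
        simp only [Bray, if_pos hk.2, Qc]
      · rw [if_neg he, if_neg]
        rintro ⟨_, _, h3, _⟩
        rw [hadd] at h3
        exact he (smul_inj P hP _ _ h3).symm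
    · congr 1
      rw [Finset.sum_comm]
      refine Finset.sum_congr rfl fun j hj => ?_
      rw [Finset.mem_Icc] at hj
      by_cases hkj : k + j ≤ N
      · rw [Finset.sum_eq_single (k + j)]
        · rw [if_pos ⟨(hN _).2 hkj, (hN j).2 hj.2, (hadd k j).symm, hz k j⟩]
          simp only [Bray, if_pos hkj, Qc]
        · intro m _ hm
          rw [if_neg]
          rintro ⟨_, _, h3, _⟩
          rw [hadd] at h3
          exact hm (smul_inj P hP _ _ h3)
        · intro hn
          exact absurd (Finset.mem_Icc.2 ⟨by omega, hkj⟩) hn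
      · simp only [Bray, if_neg hkj, zero_mul]
        refine Finset.sum_eq_zero fun m hm => ?_
        rw [if_neg]
        rintro ⟨h1, _, h3, _⟩
        rw [hadd] at h3
        rw [h3] at h1
        exact hkj ((hN _).1 h1)
  · intro p q hne
    simp only [ne_eq, ite_eq_right_iff, Classical.not_imp] at hne
    obtain ⟨⟨h1, h2, h3, h4⟩, h5⟩ := hne
    have hK : K p ((k:ℤ) • P) q ≠ 0 := left_ne_zero_of_mul h5
    have hp0 : p ≠ 0 := fun h0 => hK (hKzero _ _ _ (Or.inl h0))
    have hq0 : q ≠ 0 := fun h0 => hK (hKzero _ _ _ (Or.inr (Or.inr h0)))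
    obtain ⟨n, hn⟩ := ray2 P hP h k hk.1 q (by rw [← h3]; exact h4)
    exact ⟨hmul p hp0 h1 ⟨k + n, by rw [h3, hn, hadd]⟩, hmul q hq0 h2 ⟨n, hn⟩⟩
  · intro p q hne
    simp only [ne_eq, ite_eq_right_iff, Classical.not_imp] at hne
    obtain ⟨⟨h1, h2, h3, h4⟩, h5⟩ := hne
    have hK : K ((k:ℤ) • P) p q ≠ 0 := left_ne_zero_of_mul h5
    have hp0 : p ≠ 0 := fun h0 => hK (hKzero _ _ _ (Or.inr (Or.inl h0)))
    have hq0 : q ≠ 0 := fun h0 => hK (hKzero _ _ _ (Or.inr (Or.inr h0)))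
    rw [h3] at h4
    exact ⟨hmul p hp0 h1 (ray1 P hP h k hk.1 p q h3 h4),
      hmul q hq0 h2 (ray1 P hP h k hk.1 q p (by rw [h3, add_comm]) (by rw [add_comm, h4, add_comm]))⟩

lemma C12_zero (R : ℝ) (K : (Fin 3 → ℤ) → (Fin 3 → ℤ) → (Fin 3 → ℤ) → ℝ)
    (hKzero : ∀ p₁ p₂ p₃ : Fin 3 → ℤ, (p₁ = 0 ∨ p₂ = 0 ∨ p₃ = 0) → K p₁ p₂ p₃ = 0)
    (f : (Fin 3 → ℤ) → ℝ) : C12lat R K f 0 = 0 := by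
  unfold C12lat
  have h1 : ∀ p q, K 0 p q = 0 := fun p q => hKzero _ _ _ (Or.inl rfl)
  have h2 : ∀ p q, K p 0 q = 0 := fun p q => hKzero _ _ _ (Or.inr (Or.inl rfl))
  simp only [h1, h2, zero_mul, ite_self, finsum_zero, mul_zero, sub_zero]

lemma prim_decomp (p : Fin 3 → ℤ) (hp : p ≠ 0) : ∃ k : ℕ, 0 < k ∧ ∃ P : Fin 3 → ℤ, P ≠ 0 ∧
    Nat.gcd (Nat.gcd (P 0).natAbs (P 1).natAbs) (P 2).natAbs = 1 ∧ p = (k:ℤ) • P := by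
  set d := Nat.gcd (Nat.gcd (p 0).natAbs (p 1).natAbs) (p 2).natAbs with hd
  have d0 : 0 < d := by
    rcases Nat.eq_zero_or_pos d with h | h
    · exfalso
      apply hp
      rw [hd, Nat.gcd_eq_zero_iff, Nat.gcd_eq_zero_iff] at h
      ext i
      fin_cases i
      · simpa using h.1.1
      · simpa using h.1.2
      · simpa using h.2
    · exact h
  have hdv : ∀ i, (d:ℤ) ∣ p i := by
    intro i
    rw [Int.natCast_dvd]
    fin_cases i
    · exact (Nat.gcd_dvd_left _ _).trans (Nat.gcd_dvd_left _ _)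
    · exact (Nat.gcd_dvd_left _ _).trans (Nat.gcd_dvd_right _ _)
    · exact Nat.gcd_dvd_right _ _
  choose P hP using hdv
  have he : p = (d:ℤ) • P := by ext i; simp [hP i]
  refine ⟨d, d0, P, ?_, ?_, he⟩
  · rintro rfl
    apply hp; rw [he]; simp
  · have : d = d * Nat.gcd (Nat.gcd (P 0).natAbs (P 1).natAbs) (P 2).natAbs := by
      conv_lhs => rw [hd]
      rw [hP 0, hP 1, hP 2, Int.natAbs_mul, Int.natAbs_mul, Int.natAbs_mul, Int.natAbs_natCast,
        Nat.gcd_mul_left, Nat.gcd_mul_left]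
    exact (Nat.eq_of_mul_eq_mul_left d0 (by rw [mul_one]; exact this)).symm

lemma ball_finite (R : ℝ) : {p : Fin 3 → ℤ | znorm p < R}.Finite := by
  refine (Set.finite_Icc (fun _ : Fin 3 => -⌈R⌉) (fun _ => ⌈R⌉)).subset ?_
  intro p hp
  have hp' : znorm p < R := hp
  have h : ∀ i, |(p i : ℝ)| ≤ R := by
    intro i
    refine le_trans ?_ hp'.le
    unfold znorm
    apply Real.abs_le_sqrt
    exact Finset.single_le_sum (f := fun i => (p i : ℝ) ^ 2) (fun i _ => sq_nonneg _) (Finset.mem_univ i)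
  have hc := Int.le_ceil R
  constructor
  · intro i
    have := (abs_le.1 (h i)).1
    have : ((-⌈R⌉ : ℤ) : ℝ) ≤ p i := by push_cast; linarith
    exact_mod_cast this
  · intro i
    have := (abs_le.1 (h i)).2
    have : (p i : ℝ) ≤ (⌈R⌉ : ℤ) := by linarith
    exact_mod_cast this

theorem C12_lattice_convergence (R : ℝ) (hR : 0 < R)
    (K : (Fin 3 → ℤ) → (Fin 3 → ℤ) → (Fin 3 → ℤ) → ℝ)
    (hKradial : ∀ p₁ p₂ p₃ q₁ q₂ q₃ : Fin 3 → ℤ,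
      znorm p₁ = znorm q₁ → znorm p₂ = znorm q₂ → znorm p₃ = znorm q₃ →
      K p₁ p₂ p₃ = K q₁ q₂ q₃)
    (hKsymm : ∀ p₁ p₂ p₃ : Fin 3 → ℤ, K p₁ p₂ p₃ = K p₂ p₁ p₃ ∧ K p₁ p₂ p₃ = K p₁ p₃ p₂)
    (hKpos : ∀ p₁ p₂ p₃ : Fin 3 → ℤ, p₁ ≠ 0 → p₂ ≠ 0 → p₃ ≠ 0 → 0 < K p₁ p₂ p₃)
    (hKzero : ∀ p₁ p₂ p₃ : Fin 3 → ℤ, (p₁ = 0 ∨ p₂ = 0 ∨ p₃ = 0) → K p₁ p₂ p₃ = 0)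
    (f : ℝ → (Fin 3 → ℤ) → ℝ)
    (hsol : ∀ t ∈ Set.Ici (0 : ℝ), ∀ p₁ : Fin 3 → ℤ, znorm p₁ < R →
      HasDerivWithinAt (fun s => f s p₁) (C12lat R K (f t) p₁) (Set.Ici 0) t)
    (hinit : ∀ p : Fin 3 → ℤ, znorm p < R → p ≠ 0 → 0 < f 0 p)
    (hinit0 : f 0 0 = 0) :
    ∃ fstar : (Fin 3 → ℤ) → ℝ,
      (∀ P₀ : Fin 3 → ℤ, P₀ ≠ 0 →
        Nat.gcd (Nat.gcd (P₀ 0).natAbs (P₀ 1).natAbs) (P₀ 2).natAbs = 1 →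
        znorm P₀ < R →
        ∃ ρ > (0 : ℝ), ∀ k : ℕ, 0 < k → znorm ((k : ℤ) • P₀) < R →
          fstar ((k : ℤ) • P₀) = 1 / (Real.exp ((k : ℝ) * ρ) - 1)) ∧
      ∃ C₁ > (0 : ℝ), ∃ C₂ > (0 : ℝ), ∀ t ∈ Set.Ici (0 : ℝ), ∀ p : Fin 3 → ℤ,
        znorm p < R → |f t p - fstar p| ≤ C₁ * Real.exp (-C₂ * t) := by
  have hKnn : ∀ p q r, 0 ≤ K p q r := by
    intro p q r
    by_cases h : p = 0 ∨ q = 0 ∨ r = 0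
    · rw [hKzero _ _ _ h]
    · push Not at h
      exact (hKpos _ _ _ h.1 h.2.1 h.2.2).le
  have hray : ∀ P : Fin 3 → ℤ, P ≠ 0 →
      Nat.gcd (Nat.gcd (P 0).natAbs (P 1).natAbs) (P 2).natAbs = 1 → znorm P < R →
      ∃ ρ > (0:ℝ), ∃ C₁ > (0:ℝ), ∃ C₂ > (0:ℝ), ∀ t, 0 ≤ t → ∀ k : ℕ, 0 < k →
        znorm ((k:ℤ) • P) < R →
        |f t ((k:ℤ) • P) - 1 / (Real.exp (k * ρ) - 1)| ≤ C₁ * Real.exp (-C₂ * t) := by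
    intro P hP hg hPR
    have hz := znorm_pos P hP
    have hN : ∃ N : ℕ, ∀ k : ℕ, znorm ((k:ℤ) • P) < R ↔ k ≤ N := by
      refine ⟨⌈R / znorm P⌉₊ - 1, fun k => ?_⟩
      have h1 : 0 < ⌈R / znorm P⌉₊ := Nat.ceil_pos.2 (by positivity)
      rw [znorm_smul, ← lt_div_iff₀ hz, ← Nat.lt_ceil]
      omega
    obtain ⟨N, hN⟩ := hN
    have hN1 : 1 ≤ N := (hN 1).1 (by simpa using hPR)
    have hne : ∀ i : ℕ, 1 ≤ i → (i:ℤ) • P ≠ 0 := fun i hi => smul_ne_zero (by positivity) hP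
    obtain ⟨ρ, hρ, C₁, hC₁, C₂, hC₂, hb⟩ := ode_conv N hN1 (Bray N K P)
      (by
        intro i j
        unfold Bray
        rw [add_comm j i, (hKsymm _ _ _).2])
      (by
        intro i j
        unfold Bray
        split_ifs
        · exact hKnn _ _ _
        · exact le_rfl)
      (by
        intro i j hij
        unfold Bray
        rw [if_neg (by omega)])
      (by
        intro i hi j hj hij
        rw [Finset.mem_Icc] at hi hj
        unfold Bray
        rw [if_pos hij]
        exact hKpos _ _ _ (hne _ (by omega)) (hne i hi.1) (hne j hj.1))
      (fun t k => f t ((k:ℤ) • P))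
      (by
        intro t ht k hk
        have := hsol t ht ((k:ℤ) • P) ((hN k).2 (Finset.mem_Icc.1 hk).2)
        rw [C12_ray R K hKzero P hP hg N hN (f t) k hk] at this
        exact this)
      (fun k hk => hinit _ ((hN k).2 (Finset.mem_Icc.1 hk).2) (hne k (Finset.mem_Icc.1 hk).1))
    exact ⟨ρ, hρ, C₁, hC₁, C₂, hC₂, fun t ht k hk hkR =>
      hb t ht k (Finset.mem_Icc.2 ⟨hk, (hN k).1 hkR⟩)⟩
  have hlim : ∀ (u : ℝ → ℝ) (l C₁ C₂ : ℝ), 0 < C₂ →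
      (∀ t, 0 ≤ t → |u t - l| ≤ C₁ * Real.exp (-C₂ * t)) → Filter.limUnder Filter.atTop u = l := by
    intro u l C₁ C₂ hC₂ hb
    apply Filter.Tendsto.limUnder_eq
    rw [tendsto_iff_norm_sub_tendsto_zero]
    have h1 : Filter.Tendsto (fun t : ℝ => C₁ * Real.exp (-C₂ * t)) Filter.atTop (nhds 0) := by
      rw [← mul_zero C₁]
      apply Filter.Tendsto.const_mul
      apply Real.tendsto_exp_atBot.comp
      exact Filter.tendsto_id.const_mul_atTop_of_neg (by linarith)
    refine squeeze_zero' (Filter.Eventually.of_forall fun t => norm_nonneg _) ?_ h1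
    filter_upwards [Filter.eventually_ge_atTop 0] with t ht
    exact hb t ht
  refine ⟨fun p => Filter.limUnder Filter.atTop (fun t => f t p), ?_, ?_⟩
  · intro P hP hg hPR
    obtain ⟨ρ, hρ, C₁, hC₁, C₂, hC₂, hb⟩ := hray P hP hg hPR
    exact ⟨ρ, hρ, fun k hk hkR => hlim _ _ C₁ C₂ hC₂ fun t ht => hb t ht k hk hkR⟩
  · have hpt : ∀ p : Fin 3 → ℤ, ∃ C₁ > (0:ℝ), ∃ C₂ > (0:ℝ), znorm p < R → ∀ t, 0 ≤ t →
        |f t p - Filter.limUnder Filter.atTop (fun t => f t p)| ≤ C₁ * Real.exp (-C₂ * t) := by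
      intro p
      by_cases hpR : znorm p < R
      swap
      · exact ⟨1, one_pos, 1, one_pos, fun h => absurd h hpR⟩
      by_cases hp : p = 0
      · subst hp
        have hz : ∀ t, 0 ≤ t → f t 0 = 0 := by
          intro t ht
          have hd : ∀ s, 0 ≤ s → HasDerivWithinAt (fun s => f s 0) 0 (Set.Ici 0) s := by
            intro s hs
            have := hsol s hs 0 hpR
            rwa [C12_zero R K hKzero] at this
          have h1 := hd_mono _ (fun _ => 0) 0 0 t le_rfl ht hd (by simp)
          have h2 := hd_mono _ (fun _ => -0) 0 0 t le_rfl ht (fun s hs => (hd s hs).neg) (by simp)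
          simp at h1 h2
          linarith
        have hb : ∀ t, 0 ≤ t → |f t 0 - 0| ≤ 1 * Real.exp (-1 * t) := by
          intro t ht
          rw [hz t ht]; simp; positivity
        refine ⟨1, one_pos, 1, one_pos, fun _ t ht => ?_⟩
        rw [hlim (fun t => f t 0) 0 1 1 one_pos hb]
        exact hb t ht
      · obtain ⟨k, hk, P, hP, hg, rfl⟩ := prim_decomp p hp
        have hPR : znorm P < R := by
          refine lt_of_le_of_lt ?_ hpR
          rw [znorm_smul]
          have : (1:ℝ) ≤ k := by exact_mod_cast hk
          nlinarith [znorm_pos P hP]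
        obtain ⟨ρ, hρ, C₁, hC₁, C₂, hC₂, hb⟩ := hray P hP hg hPR
        refine ⟨C₁, hC₁, C₂, hC₂, fun _ t ht => ?_⟩
        rw [hlim (fun t => f t ((k:ℤ) • P)) _ C₁ C₂ hC₂ fun t ht => hb t ht k hk hpR]
        exact hb t ht k hk hpR
    choose A hA0 D hD0 hb using hpt
    set S := (ball_finite R).toFinset with hS
    obtain ⟨c, hc, hcb⟩ := finset_min S D (fun p _ => hD0 p)
    refine ⟨∑ p ∈ S, A p + 1, ?_, c, hc, ?_⟩
    · have : 0 ≤ ∑ p ∈ S, A p := Finset.sum_nonneg fun p _ => (hA0 p).le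
      linarith
    · intro t ht p hp
      have ht' : 0 ≤ t := ht
      have hpS : p ∈ S := (ball_finite R).mem_toFinset.2 hp
      refine (hb p hp t ht).trans ?_
      have h1 : A p ≤ ∑ p ∈ S, A p := Finset.single_le_sum (fun p _ => (hA0 p).le) hpS
      have h2 : Real.exp (-D p * t) ≤ Real.exp (-c * t) := by
        apply Real.exp_le_exp.2
        have := hcb p hpS
        nlinarith
      have h3 := (hA0 p).le
      have h4 := Real.exp_pos (-c * t)
      calc _ ≤ A p * Real.exp (-c * t) := by gcongr
        _ ≤ _ := by gcongr; linarith
end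

section
/- Let F : [0,∞) → (0,∞)^I be a solution of the discrete C₁₂ system. Then there exist a constant ρ > 0 and constants C₁, C₂ > 0 such that Σ_{k=1}^I k/(e^{ρk} − 1) = Σ_{k=1}^I k·F_k(0) and max_{1≤k≤I} |F_k(t) − 1/(e^{ρk} − 1)| ≤ C₁ e^{−C₂ t} for all t ≥ 0. In particular, F(t) converges exponentially fast to the unique equilibrium of the form F*_k = 1/(e^{ρk} − 1) having the same energy Σ_{k=1}^I k·F_k as the initial condition. -/
namespace C12aux

open Finset

/-- single collision term -/
noncomputable def T (K : ℕ → ℕ → ℕ → ℝ) (f : ℕ → ℝ) (a b c : ℕ) : ℝ :=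
  if b + c = a then
      K a b c * ((f a + 1) * f b * f c - f a * (f b + 1) * (f c + 1))
    else 0

theorem T_symm (K : ℕ → ℕ → ℕ → ℝ) (hKsymm : ∀ a b c, K a b c = K b a c ∧ K a b c = K a c b)
    (f : ℕ → ℝ) (a b c : ℕ) : T K f a b c = T K f a c b := by
  unfold T
  rw [add_comm c b, (hKsymm a b c).2]
  split_ifs <;> ring

theorem weak (I : ℕ) (K : ℕ → ℕ → ℕ → ℝ)
    (hKsymm : ∀ a b c, K a b c = K b a c ∧ K a b c = K a c b) (f φ : ℕ → ℝ) :
    ∑ k ∈ Icc 1 I, φ k * C12 I K f k =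
      ∑ a ∈ Icc 1 I, ∑ b ∈ Icc 1 I, ∑ c ∈ Icc 1 I, T K f a b c * (φ a - φ b - φ c) := by
  have h1 : ∀ k, C12 I K f k = ∑ b ∈ Icc 1 I, ∑ c ∈ Icc 1 I, T K f k b c
      - 2 * ∑ b ∈ Icc 1 I, ∑ c ∈ Icc 1 I, T K f b k c := fun k => rfl
  have e1 : ∑ a ∈ Icc 1 I, ∑ b ∈ Icc 1 I, ∑ c ∈ Icc 1 I, T K f a b c * φ b
      = ∑ k ∈ Icc 1 I, φ k * ∑ b ∈ Icc 1 I, ∑ c ∈ Icc 1 I, T K f b k c := by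
    rw [sum_comm]
    refine sum_congr rfl fun k _ => ?_
    simp only [mul_sum]
    refine sum_congr rfl fun b _ => sum_congr rfl fun c _ => mul_comm _ _
  have e2 : ∑ a ∈ Icc 1 I, ∑ b ∈ Icc 1 I, ∑ c ∈ Icc 1 I, T K f a b c * φ c
      = ∑ a ∈ Icc 1 I, ∑ b ∈ Icc 1 I, ∑ c ∈ Icc 1 I, T K f a b c * φ b := by
    refine sum_congr rfl fun a _ => ?_
    rw [sum_comm]
    refine sum_congr rfl fun b _ => sum_congr rfl fun c _ => ?_
    rw [T_symm K hKsymm]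
  have e3 : ∑ a ∈ Icc 1 I, ∑ b ∈ Icc 1 I, ∑ c ∈ Icc 1 I, T K f a b c * φ a
      = ∑ k ∈ Icc 1 I, φ k * ∑ b ∈ Icc 1 I, ∑ c ∈ Icc 1 I, T K f k b c := by
    refine sum_congr rfl fun k _ => ?_
    simp only [mul_sum]
    refine sum_congr rfl fun b _ => sum_congr rfl fun c _ => mul_comm _ _
  simp only [mul_sub, sum_sub_distrib, e1, e2, e3, h1]
  have : ∀ k, φ k * (2 * ∑ b ∈ Icc 1 I, ∑ c ∈ Icc 1 I, T K f b k c)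
      = 2 * (φ k * ∑ b ∈ Icc 1 I, ∑ c ∈ Icc 1 I, T K f b k c) := fun k => by ring
  simp only [this, ← mul_sum]
  ring

theorem log_ineq {a b : ℝ} (ha : 0 < a) (hb : 0 < b) (ha1 : a ≤ 1) (hb1 : b ≤ 1) :
    (a - b) ^ 2 ≤ (a - b) * (Real.log a - Real.log b) := by
  have key : ∀ a b : ℝ, 0 < b → b ≤ a → a ≤ 1 → a - b ≤ Real.log a - Real.log b := by
    intro a b hb hab ha1
    have ha : 0 < a := by linarith
    have := Real.log_le_sub_one_of_pos (div_pos hb ha)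
    rw [Real.log_div hb.ne' ha.ne'] at this
    have h2 : a - b ≤ 1 - b / a := by
      have : 1 - b / a = (a - b) / a := by field_simp
      rw [this, le_div_iff₀ ha]
      nlinarith
    linarith
  rcases le_total b a with h | h
  · have := key a b hb h ha1
    nlinarith
  · have := key b a ha h hb1
    nlinarith

noncomputable def r (a b : ℝ) : ℝ :=
  a * (Real.log a - Real.log b) - (a + 1) * (Real.log (a + 1) - Real.log (b + 1))

theorem r_deriv {a b : ℝ} (ha : 0 < a) :
    HasDerivAt (fun x => r x b)
      ((Real.log a - Real.log (a + 1)) - (Real.log b - Real.log (b + 1))) a := by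
  unfold r
  have h1 := (hasDerivAt_id a).mul ((Real.hasDerivAt_log ha.ne').sub_const (Real.log b))
  have h0 : HasDerivAt (fun x : ℝ => x + 1) 1 a := (hasDerivAt_id a).add_const 1
  have h2 := h0.mul (((h0.log (by positivity))).sub_const (Real.log (b + 1)))
  refine (h1.sub h2).congr_deriv ?_
  simp only [id]
  field_simp
  ring

theorem r_upper {a b : ℝ} (ha : 0 < a) (hb : 0 < b) : r a b ≤ (a - b) ^ 2 / b := by
  have h1 := Real.log_le_sub_one_of_pos (div_pos ha hb)
  rw [Real.log_div ha.ne' hb.ne'] at h1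
  have ha1 : 0 < a + 1 := by linarith
  have hb1 : 0 < b + 1 := by linarith
  have h2 := Real.log_le_sub_one_of_pos (div_pos hb1 ha1)
  rw [Real.log_div hb1.ne' ha1.ne'] at h2
  unfold r
  have h3 := mul_le_mul_of_nonneg_left h1 ha.le
  have h4 := mul_le_mul_of_nonneg_left h2 ha1.le
  have h5 : (a - b) ^ 2 / b = a * (a / b - 1) + (a + 1) * ((b + 1) / (a + 1) - 1) := by
    field_simp
    ring
  rw [h5]
  linarith

theorem r_lower {E a b : ℝ} (ha : 0 < a) (hb : 0 < b) (haE : a ≤ E) (hbE : b ≤ E) :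
    (a - b) ^ 2 / (2 * (E + 1) ^ 2) ≤ r a b := by
  set c : ℝ := 1 / (2 * (E + 1) ^ 2) with hc
  have hE : 0 < E := by linarith
  let ψ : ℝ → ℝ := fun x => r x b - c * (x - b) ^ 2
  have hψ : ∀ x, 0 < x → HasDerivAt ψ (((Real.log x - Real.log (x + 1)) - (Real.log b - Real.log (b + 1))) - c * (2 * (x - b))) x := by
    intro x hx
    have h1 := ((((hasDerivAt_id x).sub_const b).pow 2).const_mul c)
    refine ((r_deriv (b := b) hx).sub h1).congr_deriv ?_
    simp
  have hψb : ψ b = 0 := by simp [ψ, r]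
  have bnd : ∀ x y : ℝ, 0 < y → y ≤ x → x ≤ E → c * (2 * (x - y)) ≤
      (Real.log x - Real.log (x + 1)) - (Real.log y - Real.log (y + 1)) := by
    intro x y hy hyx hxE
    have hx : 0 < x := by linarith
    have := Real.log_le_sub_one_of_pos (x := (y * (x + 1)) / (x * (y + 1))) (by positivity)
    rw [Real.log_div (by positivity) (by positivity), Real.log_mul (by positivity) (by positivity),
      Real.log_mul (by positivity) (by positivity)] at this
    have h2 : c * (2 * (x - y)) ≤ 1 - (y * (x + 1)) / (x * (y + 1)) := by
      have e1 : 1 - (y * (x + 1)) / (x * (y + 1)) = (x - y) / (x * (y + 1)) := by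
        field_simp
        ring
      have e2 : c * (2 * (x - y)) = (x - y) / (E + 1) ^ 2 := by
        rw [hc]; field_simp
      rw [e1, e2]
      apply div_le_div_of_nonneg_left (by linarith) (by positivity)
      nlinarith
    linarith
  have hfin : 0 ≤ ψ a := by
    rcases le_total b a with h | h
    · have hm : MonotoneOn ψ (Set.Icc b a) := by
        apply monotoneOn_of_deriv_nonneg (convex_Icc b a)
        · intro x hx
          exact (hψ x (by linarith [hx.1])).continuousAt.continuousWithinAt
        · intro x hx
          rw [interior_Icc] at hx
          exact (hψ x (by linarith [hx.1])).differentiableAt.differentiableWithinAt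
        · intro x hx
          rw [interior_Icc] at hx
          rw [(hψ x (by linarith [hx.1])).deriv]
          have := bnd x b hb hx.1.le (by linarith [hx.2])
          linarith
      have := hm (Set.left_mem_Icc.2 h) (Set.right_mem_Icc.2 h) h
      linarith
    · have hm : AntitoneOn ψ (Set.Icc a b) := by
        apply antitoneOn_of_deriv_nonpos (convex_Icc a b)
        · intro x hx
          exact (hψ x (by linarith [hx.1])).continuousAt.continuousWithinAt
        · intro x hx
          rw [interior_Icc] at hx
          exact (hψ x (by linarith [hx.1])).differentiableAt.differentiableWithinAt
        · intro x hx
          rw [interior_Icc] at hx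
          rw [(hψ x (by linarith [hx.1])).deriv]
          have := bnd b x (by linarith [hx.1]) hx.2.le hbE
          linarith
      have := hm (Set.left_mem_Icc.2 h) (Set.right_mem_Icc.2 h) h
      linarith
  have e : (a - b) ^ 2 / (2 * (E + 1) ^ 2) = c * (a - b) ^ 2 := by rw [hc]; ring
  rw [e]
  have : ψ a = r a b - c * (a - b) ^ 2 := rfl
  linarith

noncomputable def m (y : ℝ) : ℝ := y / (1 - y)

theorem m_sub {y z : ℝ} (hy : y < 1) (hz : z < 1) :
    m y - m z = (y - z) / ((1 - y) * (1 - z)) := by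
  unfold m
  have : 1 - y ≠ 0 := by linarith
  have : 1 - z ≠ 0 := by linarith
  field_simp
  ring

theorem m_lip {E y z : ℝ} (hE : 0 < E) (hy : y ≤ E / (E + 1)) (hz : z ≤ E / (E + 1)) :
    |m y - m z| ≤ (E + 1) ^ 2 * |y - z| := by
  have hq : E / (E + 1) = 1 - 1 / (E + 1) := by field_simp; ring
  have hp : 0 < 1 / (E + 1) := by positivity
  have hy' : 1 / (E + 1) ≤ 1 - y := by linarith
  have hz' : 1 / (E + 1) ≤ 1 - z := by linarith
  rw [m_sub (by linarith) (by linarith), abs_div, abs_of_pos (a := (1 - y) * (1 - z)) (by nlinarith)]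
  rw [div_le_iff₀ (by nlinarith)]
  have h1 : 1 / (E + 1) * (1 / (E + 1)) ≤ (1 - y) * (1 - z) := by gcongr; linarith
  have h2 : 1 ≤ (E + 1) ^ 2 * ((1 - y) * (1 - z)) := by
    calc (1 : ℝ) = (E + 1) ^ 2 * (1 / (E + 1) * (1 / (E + 1))) := by field_simp
      _ ≤ _ := by gcongr
  nlinarith [abs_nonneg (y - z)]

theorem m_mono {y z : ℝ} (hyz : y ≤ z) (hz : z < 1) : m y ≤ m z := by
  have : 0 ≤ m z - m y := by
    rw [m_sub hz (by linarith)]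
    apply div_nonneg (by linarith)
    apply mul_nonneg <;> linarith
  linarith

theorem m_exp {y z : ℝ} (hy : 0 ≤ y) (hyz : y ≤ z) (hz : z < 1) : z - y ≤ m z - m y := by
  rw [m_sub hz (by linarith), le_div_iff₀ (by nlinarith)]
  have : (1 - z) * (1 - y) ≤ 1 := by nlinarith
  nlinarith

noncomputable def S (I : ℕ) (x : ℝ) : ℝ := ∑ k ∈ Icc 1 I, (k : ℝ) * m (x ^ k)

theorem S_exp (I : ℕ) (hI : 1 ≤ I) {x y : ℝ} (hx : 0 ≤ x) (hxy : x ≤ y) (hy : y < 1) :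
    y - x ≤ S I y - S I x := by
  unfold S
  rw [← sum_sub_distrib]
  have h1 : y - x ≤ ((1 : ℕ) : ℝ) * m (y ^ 1) - ((1 : ℕ) : ℝ) * m (x ^ 1) := by
    simpa using m_exp hx hxy hy
  refine h1.trans (single_le_sum (f := fun k : ℕ => (k : ℝ) * m (y ^ k) - (k : ℝ) * m (x ^ k)) ?_ (mem_Icc.2 ⟨le_rfl, hI⟩))
  intro k hk
  have hk1 := (mem_Icc.1 hk).1
  have := m_mono (pow_le_pow_left₀ hx hxy k) (pow_lt_one₀ (hx.trans hxy) hy (by omega))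
  have hk0 : (0 : ℝ) ≤ k := by positivity
  nlinarith

theorem pow_diff {x y : ℝ} (hx : 0 ≤ x) (hx1 : x ≤ 1) (hy : 0 ≤ y) (hy1 : y ≤ 1) (k : ℕ) :
    |x ^ k - y ^ k| ≤ k * |x - y| := by
  induction k with
  | zero => simp
  | succ k ih =>
    have : x ^ (k + 1) - y ^ (k + 1) = x * (x ^ k - y ^ k) + (x - y) * y ^ k := by ring
    rw [this]
    refine (abs_add_le _ _).trans ?_
    rw [abs_mul, abs_mul, abs_of_nonneg hx, abs_of_nonneg (pow_nonneg hy k)]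
    have h1 : y ^ k ≤ 1 := pow_le_one₀ hy hy1
    push_cast
    nlinarith [abs_nonneg (x - y), abs_nonneg (x ^ k - y ^ k)]

theorem coercive (I : ℕ) (hI : 1 ≤ I) (E xs : ℝ) (hE : 0 < E) (hxs : 0 < xs)
    (hxsq : xs ≤ E / (E + 1)) (hS : S I xs = E) :
    ∃ C > 0, ∀ f : ℕ → ℝ, (∀ k ∈ Icc 1 I, 0 < f k) → (∑ k ∈ Icc 1 I, (k : ℝ) * f k = E) →
      ∀ δ : ℝ, 0 ≤ δ → (∀ k, 1 ≤ k → k + 1 ≤ I →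
        |f (k + 1) / (f (k + 1) + 1) - f 1 / (f 1 + 1) * (f k / (f k + 1))| ≤ δ) →
      ∀ k ∈ Icc 1 I, |f k - m (xs ^ k)| ≤ C * δ := by
  have hq1 : E / (E + 1) < 1 := by rw [div_lt_one (by linarith)]; linarith
  set A : ℝ := I * (I * ((E + 1) ^ 2 * I)) with hA
  have hI0 : (1 : ℝ) ≤ I := by exact_mod_cast hI
  refine ⟨(E + 1) ^ 2 * I + (E + 1) ^ 2 * (I * A), by positivity, ?_⟩
  intro f hf hfE δ hδ hd
  have hfle : ∀ k ∈ Icc 1 I, f k ≤ E := by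
    intro k hk
    have hk1 : (1 : ℝ) ≤ k := by exact_mod_cast (mem_Icc.1 hk).1
    have := single_le_sum (f := fun k : ℕ => (k : ℝ) * f k)
      (fun i hi => mul_nonneg (by positivity) (hf i hi).le) hk
    simp only [hfE] at this
    nlinarith [hf k hk]
  let g : ℕ → ℝ := fun k => f k / (f k + 1)
  have hg0 : ∀ k ∈ Icc 1 I, 0 < g k := fun k hk => by
    have := hf k hk
    simp only [g]; positivity
  have hgq : ∀ k ∈ Icc 1 I, g k ≤ E / (E + 1) := fun k hk => by
    have h1 := hf k hk
    have h2 := hfle k hk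
    simp only [g]
    rw [div_le_div_iff₀ (by linarith) (by linarith)]
    nlinarith
  have hmg : ∀ k ∈ Icc 1 I, m (g k) = f k := fun k hk => by
    have h1 := hf k hk
    simp only [g, m]
    have : f k + 1 ≠ 0 := by linarith
    have e : 1 - f k / (f k + 1) = 1 / (f k + 1) := by field_simp; ring
    rw [e]; field_simp
  have h1I : 1 ∈ Icc 1 I := mem_Icc.2 ⟨le_rfl, hI⟩
  set x := g 1 with hx
  have hx0 : 0 < x := hg0 1 h1I
  have hxq : x ≤ E / (E + 1) := hgq 1 h1I
  have hpow : ∀ k, 1 ≤ k → k ≤ I → |g k - x ^ k| ≤ k * δ := by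
    intro k hk1
    induction k, hk1 using Nat.le_induction with
    | base => intro _; simp [hx, hδ]
    | succ k hk1 ih =>
      intro hkI
      have h1 := ih (by omega)
      have h2 : |g (k + 1) - x * g k| ≤ δ := hd k hk1 hkI
      have e : g (k + 1) - x ^ (k + 1) = (g (k + 1) - x * g k) + x * (g k - x ^ k) := by ring
      rw [e]
      refine (abs_add_le _ _).trans ?_
      rw [abs_mul, abs_of_pos hx0]
      push_cast
      nlinarith [abs_nonneg (g k - x ^ k)]
  have powq : ∀ y : ℝ, 0 ≤ y → y ≤ E / (E + 1) → ∀ k, 1 ≤ k → y ^ k ≤ E / (E + 1) := by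
    intro y hy hyq k hk
    exact (pow_le_of_le_one hy (by linarith) (by omega)).trans hyq
  have hfm : ∀ k ∈ Icc 1 I, |f k - m (x ^ k)| ≤ (E + 1) ^ 2 * I * δ := by
    intro k hk
    obtain ⟨hk1, hkI⟩ := mem_Icc.1 hk
    rw [← hmg k hk]
    refine (m_lip hE (hgq k hk) (powq x hx0.le hxq k hk1)).trans ?_
    rw [mul_assoc]
    refine mul_le_mul_of_nonneg_left ((hpow k hk1 hkI).trans ?_) (by positivity)
    have : (k : ℝ) ≤ I := by exact_mod_cast hkI
    gcongr
  have hSx : |S I x - S I xs| ≤ A * δ := by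
    rw [hS, ← hfE, S, ← sum_sub_distrib]
    refine (abs_sum_le_sum_abs _ _).trans ?_
    have : ∀ k ∈ Icc 1 I, |(k : ℝ) * m (x ^ k) - k * f k| ≤ I * ((E + 1) ^ 2 * I * δ) := by
      intro k hk
      rw [← mul_sub, abs_mul, abs_sub_comm, Nat.abs_cast]
      have h2 : (k : ℝ) ≤ I := by exact_mod_cast (mem_Icc.1 hk).2
      have := hfm k hk
      gcongr
    refine (sum_le_sum this).trans ?_
    rw [sum_const, Nat.card_Icc, nsmul_eq_mul, hA]
    simp only [Nat.add_sub_cancel]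
    apply le_of_eq; ring
  have hxx : |x - xs| ≤ A * δ := by
    refine le_trans ?_ hSx
    rcases le_total x xs with h | h
    · have := S_exp I hI hx0.le h (by linarith)
      rw [abs_sub_comm, abs_of_nonneg (by linarith), abs_sub_comm]
      exact this.trans (le_abs_self _)
    · have := S_exp I hI hxs.le h (by linarith)
      rw [abs_of_nonneg (by linarith)]
      exact this.trans (le_abs_self _)
  intro k hk
  obtain ⟨hk1, hkI⟩ := mem_Icc.1 hk
  have hkI' : (k : ℝ) ≤ I := by exact_mod_cast hkI
  have e : f k - m (xs ^ k) = (f k - m (x ^ k)) + (m (x ^ k) - m (xs ^ k)) := by ring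
  rw [e]
  refine (abs_add_le _ _).trans ?_
  rw [add_mul]
  refine add_le_add (hfm k hk) ?_
  refine (m_lip hE (powq x hx0.le hxq k hk1) (powq xs hxs.le hxsq k hk1)).trans ?_
  rw [mul_assoc]
  refine mul_le_mul_of_nonneg_left ?_ (by positivity)
  refine (pow_diff hx0.le (by linarith) hxs.le (by linarith) k).trans ?_
  rw [mul_assoc]
  gcongr

theorem exists_xs (I : ℕ) (hI : 1 ≤ I) (E : ℝ) (hE : 0 < E) :
    ∃ xs, 0 < xs ∧ xs ≤ E / (E + 1) ∧ S I xs = E := by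
  have hq0 : 0 < E / (E + 1) := by positivity
  have hq1 : E / (E + 1) < 1 := by rw [div_lt_one (by linarith)]; linarith
  have hS0 : S I 0 = 0 := by
    unfold S
    apply sum_eq_zero
    intro k hk
    have := (mem_Icc.1 hk).1
    rw [zero_pow (by omega)]; simp [m]
  have hSq : E ≤ S I (E / (E + 1)) := by
    unfold S
    have h1 : E = ((1 : ℕ) : ℝ) * m ((E / (E + 1)) ^ 1) := by
      have e : 1 - E / (E + 1) = 1 / (E + 1) := by field_simp; ring
      simp only [m, pow_one, e]; field_simp; simp
    conv_lhs => rw [h1]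
    refine single_le_sum (f := fun k : ℕ => (k : ℝ) * m ((E / (E + 1)) ^ k)) ?_ (mem_Icc.2 ⟨le_rfl, hI⟩)
    intro k hk
    have hk1 := (mem_Icc.1 hk).1
    have := pow_lt_one₀ hq0.le hq1 (n := k) (by omega)
    have h3 : 0 ≤ m ((E / (E + 1)) ^ k) := div_nonneg (by positivity) (by linarith)
    positivity
  have hc : ContinuousOn (S I) (Set.Icc 0 (E / (E + 1))) := by
    unfold S m
    apply continuousOn_finsetSum
    intro k hk
    have hk1 := (mem_Icc.1 hk).1
    apply ContinuousOn.mul continuousOn_const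
    apply ContinuousOn.div (by fun_prop) (by fun_prop)
    intro x hx
    have := pow_lt_one₀ hx.1 (lt_of_le_of_lt hx.2 hq1) (n := k) (by omega)
    linarith
  obtain ⟨x, hx, hxE⟩ := intermediate_value_Icc hq0.le hc ⟨by rw [hS0]; exact hE.le, hSq⟩
  refine ⟨x, lt_of_le_of_ne hx.1 ?_, hx.2, hxE⟩
  rintro rfl
  rw [hS0] at hxE
  linarith

/-- each dissipation term -/
theorem diss_term {f : ℕ → ℝ} {K0 : ℝ} (hK : 0 < K0) (a b c : ℕ)
    (ha : 0 < f a) (hb : 0 < f b) (hc : 0 < f c) :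
    K0 * (f a / (f a + 1) - f b / (f b + 1) * (f c / (f c + 1))) ^ 2 ≤
    - (K0 * ((f a + 1) * f b * f c - f a * (f b + 1) * (f c + 1)) *
      ((Real.log (f a) - Real.log (f a + 1)) - (Real.log (f b) - Real.log (f b + 1))
        - (Real.log (f c) - Real.log (f c + 1)))) := by
  set u := f a / (f a + 1) with hu
  set v := f b / (f b + 1) * (f c / (f c + 1)) with hv
  have hu0 : 0 < u := by positivity
  have hv0 : 0 < v := by positivity
  have l : ∀ x : ℝ, 0 < x → x / (x + 1) ≤ 1 := fun x hx => by
    rw [div_le_one (by linarith)]; linarith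
  have hu1 : u ≤ 1 := l _ ha
  have hv1 : v ≤ 1 := mul_le_one₀ (l _ hb) (by positivity) (l _ hc)
  have hlog := log_ineq hu0 hv0 hu1 hv1
  have e1 : Real.log u = Real.log (f a) - Real.log (f a + 1) :=
    Real.log_div ha.ne' (by positivity)
  have e2 : Real.log v = (Real.log (f b) - Real.log (f b + 1)) + (Real.log (f c) - Real.log (f c + 1)) := by
    rw [hv, Real.log_mul (by positivity) (by positivity), Real.log_div hb.ne' (by positivity),
      Real.log_div hc.ne' (by positivity)]
  have e3 : (f a + 1) * f b * f c - f a * (f b + 1) * (f c + 1)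
      = - ((f a + 1) * (f b + 1) * (f c + 1) * (u - v)) := by
    rw [hu, hv]; field_simp; ring
  have e4 : (Real.log (f a) - Real.log (f a + 1)) - (Real.log (f b) - Real.log (f b + 1))
        - (Real.log (f c) - Real.log (f c + 1)) = Real.log u - Real.log v := by
    rw [e1, e2]; ring
  rw [e3, e4]
  have hP : 1 ≤ (f a + 1) * (f b + 1) * (f c + 1) := by
    have : 1 ≤ (f a + 1) * (f b + 1) := by nlinarith
    nlinarith
  have : -(K0 * -((f a + 1) * (f b + 1) * (f c + 1) * (u - v)) * (Real.log u - Real.log v))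
     = K0 * (((f a + 1) * (f b + 1) * (f c + 1)) * ((u - v) * (Real.log u - Real.log v))) := by ring
  rw [this]
  apply mul_le_mul_of_nonneg_left _ hK.le
  nlinarith [sq_nonneg (u - v)]

/-- lower bound for the dissipation -/
theorem diss (I : ℕ) (hI : 1 ≤ I) (K : ℕ → ℕ → ℕ → ℝ) (hKpos : ∀ a b c, 0 < K a b c)
    (hKsymm : ∀ a b c, K a b c = K b a c ∧ K a b c = K a c b) (L : ℝ) :
    ∃ c > 0, ∀ f : ℕ → ℝ, (∀ k ∈ Icc 1 I, 0 < f k) →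
      ∀ D : ℝ, D = - ∑ k ∈ Icc 1 I, ((Real.log (f k) - Real.log (f k + 1)) - k * L) * C12 I K f k →
      0 ≤ D ∧ ∀ k, 1 ≤ k → k + 1 ≤ I →
        c * (f (k + 1) / (f (k + 1) + 1) - f 1 / (f 1 + 1) * (f k / (f k + 1))) ^ 2 ≤ D := by
  obtain ⟨k0, _, hk0⟩ := exists_min_image (Icc 1 I) (fun k => K (k + 1) 1 k) ⟨1, mem_Icc.2 ⟨le_rfl, hI⟩⟩
  refine ⟨K (k0 + 1) 1 k0, hKpos _ _ _, ?_⟩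
  intro f hf D hD
  rw [weak I K hKsymm f] at hD
  simp only [← sum_neg_distrib] at hD
  set q : ℕ → ℕ → ℕ → ℝ := fun a b c => -(T K f a b c *
    (((Real.log (f a) - Real.log (f a + 1)) - a * L) - ((Real.log (f b) - Real.log (f b + 1)) - b * L)
      - ((Real.log (f c) - Real.log (f c + 1)) - c * L))) with hq
  have hqb : ∀ a ∈ Icc 1 I, ∀ b ∈ Icc 1 I, ∀ c ∈ Icc 1 I, b + c = a →
      K a b c * (f a / (f a + 1) - f b / (f b + 1) * (f c / (f c + 1))) ^ 2 ≤ q a b c := by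
    intro a ha b hb c hc h
    have := diss_term (hKpos a b c) a b c (hf a ha) (hf b hb) (hf c hc)
    refine this.trans (le_of_eq ?_)
    simp only [hq, T, if_pos h]
    subst h
    push_cast
    ring
  have hq0 : ∀ a ∈ Icc 1 I, ∀ b ∈ Icc 1 I, ∀ c ∈ Icc 1 I, 0 ≤ q a b c := by
    intro a ha b hb c hc
    by_cases h : b + c = a
    · exact le_trans (mul_nonneg (hKpos a b c).le (sq_nonneg _)) (hqb a ha b hb c hc h)
    · simp [hq, T, h]
  have hD' : D = ∑ a ∈ Icc 1 I, ∑ b ∈ Icc 1 I, ∑ c ∈ Icc 1 I, q a b c := hD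
  refine ⟨?_, ?_⟩
  · rw [hD']
    exact sum_nonneg fun a ha => sum_nonneg fun b hb => sum_nonneg fun c hc => hq0 a ha b hb c hc
  · intro k hk1 hkI
    have h1 : 1 ∈ Icc 1 I := mem_Icc.2 ⟨le_rfl, hI⟩
    have hk : k ∈ Icc 1 I := mem_Icc.2 ⟨hk1, by omega⟩
    have hk' : k + 1 ∈ Icc 1 I := mem_Icc.2 ⟨by omega, hkI⟩
    have s1 : q (k + 1) 1 k ≤ ∑ c ∈ Icc 1 I, q (k + 1) 1 c :=
      single_le_sum (fun c hc => hq0 _ hk' _ h1 c hc) hk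
    have s2 : ∑ c ∈ Icc 1 I, q (k + 1) 1 c ≤ ∑ b ∈ Icc 1 I, ∑ c ∈ Icc 1 I, q (k + 1) b c :=
      single_le_sum (f := fun b => ∑ c ∈ Icc 1 I, q (k + 1) b c)
        (fun b hb => sum_nonneg fun c hc => hq0 _ hk' _ hb c hc) h1
    have s3 : ∑ b ∈ Icc 1 I, ∑ c ∈ Icc 1 I, q (k + 1) b c ≤ D := by
      rw [hD']
      exact single_le_sum (f := fun a => ∑ b ∈ Icc 1 I, ∑ c ∈ Icc 1 I, q a b c)
        (fun a ha => sum_nonneg fun b hb => sum_nonneg fun c hc => hq0 _ ha _ hb c hc) hk'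
    have s0 := hqb (k + 1) hk' 1 h1 k hk (by omega)
    have s4 := mul_le_mul_of_nonneg_right (hk0 k hk)
      (sq_nonneg (f (k + 1) / (f (k + 1) + 1) - f 1 / (f 1 + 1) * (f k / (f k + 1))))
    linarith

theorem energy_zero (I : ℕ) (K : ℕ → ℕ → ℕ → ℝ)
    (hKsymm : ∀ a b c, K a b c = K b a c ∧ K a b c = K a c b) (f : ℕ → ℝ) :
    ∑ k ∈ Icc 1 I, (k : ℝ) * C12 I K f k = 0 := by
  rw [weak I K hKsymm f (fun k => (k : ℝ))]
  refine sum_eq_zero fun a _ => sum_eq_zero fun b _ => sum_eq_zero fun c _ => ?_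
  by_cases h : b + c = a
  · subst h; push_cast; ring
  · simp [T, h]

theorem antitone_aux {Φ Φ' : ℝ → ℝ}
    (h : ∀ t ∈ Set.Ici (0 : ℝ), HasDerivWithinAt Φ (Φ' t) (Set.Ici 0) t)
    (hle : ∀ t ∈ Set.Ici (0 : ℝ), Φ' t ≤ 0) : AntitoneOn Φ (Set.Ici 0) := by
  have hd : ∀ t ∈ interior (Set.Ici (0 : ℝ)), HasDerivAt Φ (Φ' t) t := by
    intro t ht
    have ht' : t ∈ Set.Ici (0 : ℝ) := interior_subset ht
    exact (h t ht').hasDerivAt (mem_interior_iff_mem_nhds.1 ht)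
  apply antitoneOn_of_deriv_nonpos (convex_Ici 0)
  · exact fun t ht => (h t ht).continuousWithinAt
  · exact fun t ht => (hd t ht).differentiableAt.differentiableWithinAt
  · intro t ht
    rw [(hd t ht).deriv]
    exact hle t (interior_subset ht)

theorem gronwall_aux {Φ Φ' : ℝ → ℝ} {c : ℝ}
    (h : ∀ t ∈ Set.Ici (0 : ℝ), HasDerivWithinAt Φ (Φ' t) (Set.Ici 0) t)
    (hle : ∀ t ∈ Set.Ici (0 : ℝ), Φ' t ≤ - c * Φ t) :
    ∀ t ∈ Set.Ici (0 : ℝ), Φ t ≤ Φ 0 * Real.exp (- c * t) := by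
  intro t ht
  have hexp : ∀ s : ℝ, HasDerivAt (fun s => Real.exp (c * s)) (Real.exp (c * s) * c) s := by
    intro s
    have := ((hasDerivAt_id s).const_mul c).exp
    simpa using this
  have := antitone_aux (Φ := fun s => Real.exp (c * s) * Φ s)
    (fun s hs => ((hexp s).hasDerivWithinAt.mul (h s hs)))
    (fun s hs => by
      have := hle s hs
      nlinarith [Real.exp_pos (c * s)])
  have h2 := this (Set.mem_Ici.2 le_rfl) ht ht
  simp only [mul_zero, Real.exp_zero, one_mul] at h2
  have e : - c * t = -(c * t) := by ring
  rw [e, Real.exp_neg, ← div_eq_mul_inv, le_div_iff₀ (Real.exp_pos _)]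
  linarith

end C12aux

open C12aux

/-- Exponential convergence to the Bose–Einstein equilibrium for the
discrete `C₁₂` system. -/
theorem C12_convergence_to_equilibrium (I : ℕ) (hI : 2 ≤ I) (K : ℕ → ℕ → ℕ → ℝ)
    (hKpos : ∀ a b c, 0 < K a b c)
    (hKsymm : ∀ a b c, K a b c = K b a c ∧ K a b c = K a c b)
    (F : ℝ → ℕ → ℝ)
    (hFpos : ∀ t ∈ Set.Ici (0 : ℝ), ∀ k ∈ Finset.Icc 1 I, 0 < F t k)
    (hF : ∀ t ∈ Set.Ici (0 : ℝ), ∀ k₁ ∈ Finset.Icc 1 I,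
      HasDerivWithinAt (fun s => F s k₁) (C12 I K (F t) k₁) (Set.Ici 0) t) :
    ∃ ρ > (0 : ℝ), ∃ C₁ > (0 : ℝ), ∃ C₂ > (0 : ℝ),
      (∑ k ∈ Finset.Icc 1 I, (k : ℝ) / (Real.exp (ρ * k) - 1)
        = ∑ k ∈ Finset.Icc 1 I, (k : ℝ) * F 0 k) ∧
      ∀ t ∈ Set.Ici (0 : ℝ), ∀ k ∈ Finset.Icc 1 I,
        |F t k - 1 / (Real.exp (ρ * k) - 1)| ≤ C₁ * Real.exp (-C₂ * t) := by
  have hI1 : 1 ≤ I := by omega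
  have h1I : 1 ∈ Finset.Icc 1 I := Finset.mem_Icc.2 ⟨le_rfl, hI1⟩
  have h00 : (0 : ℝ) ∈ Set.Ici (0 : ℝ) := Set.mem_Ici.2 le_rfl
  set E : ℝ := ∑ k ∈ Finset.Icc 1 I, (k : ℝ) * F 0 k with hEdef
  have hE : 0 < E := by
    apply Finset.sum_pos _ ⟨1, h1I⟩
    intro k hk
    have hk1 : (1 : ℝ) ≤ k := by exact_mod_cast (Finset.mem_Icc.1 hk).1
    have := hFpos 0 h00 k hk
    positivity
  -- energy conservation
  have hEd : ∀ t ∈ Set.Ici (0 : ℝ), HasDerivWithinAt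
      (fun s => ∑ k ∈ Finset.Icc 1 I, (k : ℝ) * F s k) 0 (Set.Ici 0) t := by
    intro t ht
    have := HasDerivWithinAt.fun_sum (u := Finset.Icc 1 I)
      (fun k hk => (hF t ht k hk).const_mul (k : ℝ))
    rwa [energy_zero I K hKsymm] at this
  have hEn : ∀ t ∈ Set.Ici (0 : ℝ), ∑ k ∈ Finset.Icc 1 I, (k : ℝ) * F t k = E := by
    intro t ht
    have a1 := antitone_aux hEd (fun _ _ => le_rfl) h00 ht ht
    have a2 := antitone_aux (fun s hs => (hEd s hs).neg) (fun _ _ => by simp) h00 ht ht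
    simp only [Pi.neg_apply] at a2
    exact le_antisymm a1 (by linarith)
  obtain ⟨xs, hxs0, hxsq, hxsE⟩ := exists_xs I hI1 E hE
  have hq1 : E / (E + 1) < 1 := by rw [div_lt_one (by linarith)]; linarith
  have hxs1 : xs < 1 := by linarith
  have hpow1 : ∀ k ∈ Finset.Icc 1 I, xs ^ k < 1 := fun k hk =>
    pow_lt_one₀ hxs0.le hxs1 (by have := (Finset.mem_Icc.1 hk).1; omega)
  obtain ⟨C, hC, hcoer⟩ := coercive I hI1 E xs hE hxs0 hxsq hxsE
  obtain ⟨c, hc, hdiss⟩ := diss I hI1 K hKpos hKsymm (Real.log xs)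
  set b : ℕ → ℝ := fun k => m (xs ^ k) with hb
  have hb0 : ∀ k ∈ Finset.Icc 1 I, 0 < b k := fun k hk => by
    have := hpow1 k hk
    exact div_pos (by positivity) (by linarith)
  have leE : ∀ f : ℕ → ℝ, (∀ k ∈ Finset.Icc 1 I, 0 < f k) →
      (∑ k ∈ Finset.Icc 1 I, (k : ℝ) * f k = E) → ∀ k ∈ Finset.Icc 1 I, f k ≤ E := by
    intro f hf hfE k hk
    have hk1 : (1 : ℝ) ≤ k := by exact_mod_cast (Finset.mem_Icc.1 hk).1
    have := Finset.single_le_sum (f := fun k : ℕ => (k : ℝ) * f k)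
      (fun i hi => mul_nonneg (by positivity) (hf i hi).le) hk
    simp only [hfE] at this
    nlinarith [hf k hk]
  have hbE : ∀ k ∈ Finset.Icc 1 I, b k ≤ E := leE b hb0 hxsE
  have hblog : ∀ k ∈ Finset.Icc 1 I, Real.log (b k) - Real.log (b k + 1) = k * Real.log xs := by
    intro k hk
    have h1 := hpow1 k hk
    have h2 := hb0 k hk
    rw [← Real.log_div h2.ne' (by linarith), ← Real.log_pow]
    congr 1
    simp only [hb, m]
    have : 1 - xs ^ k ≠ 0 := by linarith
    have e : xs ^ k / (1 - xs ^ k) + 1 = 1 / (1 - xs ^ k) := by field_simp; ring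
    rw [e]; field_simp
  set D : ℝ → ℝ := fun t => - ∑ k ∈ Finset.Icc 1 I,
    ((Real.log (F t k) - Real.log (F t k + 1)) - k * Real.log xs) * C12 I K (F t) k with hD
  set Φ : ℝ → ℝ := fun t => ∑ k ∈ Finset.Icc 1 I, r (F t k) (b k) with hΦ
  have hΦd : ∀ t ∈ Set.Ici (0 : ℝ), HasDerivWithinAt Φ (- D t) (Set.Ici 0) t := by
    intro t ht
    have := HasDerivWithinAt.fun_sum (u := Finset.Icc 1 I)
      (fun k hk => (r_deriv (b := b k) (hFpos t ht k hk)).comp_hasDerivWithinAt t (hF t ht k hk))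
    refine HasDerivWithinAt.congr_deriv this ?_
    simp only [hD, neg_neg]
    refine Finset.sum_congr rfl fun k hk => ?_
    rw [hblog k hk]
  have hdist : ∀ t ∈ Set.Ici (0 : ℝ), ∀ k ∈ Finset.Icc 1 I,
      (F t k - b k) ^ 2 ≤ C ^ 2 / c * D t := by
    intro t ht k hk
    obtain ⟨hD0, hDk⟩ := hdiss (F t) (hFpos t ht) (D t) rfl
    have hDc : 0 ≤ D t / c := div_nonneg hD0 hc.le
    have := hcoer (F t) (hFpos t ht) (hEn t ht) (Real.sqrt (D t / c)) (Real.sqrt_nonneg _) (by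
      intro j hj hjI
      apply Real.abs_le_sqrt
      rw [le_div_iff₀ hc, mul_comm]
      exact hDk j hj hjI) k hk
    have h2 := pow_le_pow_left₀ (abs_nonneg _) this 2
    rw [sq_abs, mul_pow, Real.sq_sqrt hDc] at h2
    calc _ ≤ _ := h2
      _ = _ := by ring
  set B : ℝ := ∑ k ∈ Finset.Icc 1 I, C ^ 2 / c / b k with hB
  have hBpos : 0 < B := by
    apply Finset.sum_pos _ ⟨1, h1I⟩
    intro k hk
    have := hb0 k hk
    positivity
  have hΦD : ∀ t ∈ Set.Ici (0 : ℝ), Φ t ≤ B * D t := by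
    intro t ht
    simp only [hΦ, hB, Finset.sum_mul]
    refine Finset.sum_le_sum fun k hk => ?_
    refine (r_upper (hFpos t ht k hk) (hb0 k hk)).trans ?_
    rw [div_le_iff₀ (hb0 k hk)]
    have h2 := (hb0 k hk).ne'
    have : C ^ 2 / c / b k * D t * b k = C ^ 2 / c * D t := by field_simp
    rw [this]
    exact hdist t ht k hk
  have hdecay := gronwall_aux (c := 1 / B) hΦd (fun t ht => by
    have := hΦD t ht
    have h2 : 1 / B * Φ t ≤ D t := by
      rw [one_div, inv_mul_le_iff₀ hBpos]; exact this
    linarith)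
  set M : ℝ := 2 * (E + 1) ^ 2 with hM
  have hMpos : 0 < M := by positivity
  have hsq : ∀ t ∈ Set.Ici (0 : ℝ), ∀ k ∈ Finset.Icc 1 I, (F t k - b k) ^ 2 ≤ M * Φ t := by
    intro t ht k hk
    have lo : ∀ j ∈ Finset.Icc 1 I, (F t j - b j) ^ 2 / M ≤ r (F t j) (b j) := fun j hj =>
      r_lower (hFpos t ht j hj) (hb0 j hj) (leE (F t) (hFpos t ht) (hEn t ht) j hj) (hbE j hj)
    have : r (F t k) (b k) ≤ Φ t := Finset.single_le_sum (f := fun j => r (F t j) (b j))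
      (fun j hj => le_trans (by positivity) (lo j hj)) hk
    have h3 := (lo k hk).trans this
    rw [div_le_iff₀ hMpos] at h3
    linarith
  have hΦ0 : 0 ≤ Φ 0 := by
    have := hsq 0 h00 1 h1I
    nlinarith [sq_nonneg (F 0 1 - b 1)]
  have hexpb : ∀ k ∈ Finset.Icc 1 I, 1 / (Real.exp (-Real.log xs * k) - 1) = b k := by
    intro k hk
    have e : Real.exp (-Real.log xs * k) = (xs ^ k)⁻¹ := by
      rw [neg_mul, Real.exp_neg, mul_comm, Real.exp_nat_mul, Real.exp_log hxs0]
    have h1 := hpow1 k hk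
    have h2 : 0 < xs ^ k := by positivity
    have h3 : 1 - xs ^ k ≠ 0 := by linarith
    have e2 : (xs ^ k)⁻¹ - 1 = (1 - xs ^ k) / xs ^ k := by field_simp
    rw [e, e2, one_div_div]
    rfl
  refine ⟨-Real.log xs, by have := Real.log_neg hxs0 hxs1; linarith, Real.sqrt (M * Φ 0) + 1,
    by positivity, 1 / B / 2, by positivity, ?_, ?_⟩
  · rw [← hxsE, S]
    refine Finset.sum_congr rfl fun k hk => ?_
    have := hexpb k hk
    rw [div_eq_mul_one_div, this]
  · intro t ht k hk
    rw [hexpb k hk]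
    have h1 := hsq t ht k hk
    have h2 := mul_le_mul_of_nonneg_left (hdecay t ht) hMpos.le
    have h3 := Real.abs_le_sqrt (h1.trans h2)
    have e : M * (Φ 0 * Real.exp (-(1 / B) * t))
        = (M * Φ 0) * (Real.exp (-(1 / B / 2) * t)) ^ 2 := by
      rw [← Real.exp_nat_mul, ← mul_assoc]
      congr 2
      push_cast; ring
    rw [e, Real.sqrt_mul (by positivity), Real.sqrt_sq (Real.exp_pos _).le] at h3
    nlinarith [Real.exp_pos (-(1 / B / 2) * t)]
end

section
/- Let I ≥ 2 and let 𝒦 : 𝕀×𝕀×𝕀 → ℝ be strictly positive and symmetric under permutations of its arguments. A point F ∈ (0,∞)^I is an equilibrium of the discrete C₁₂ system (i.e. the right-hand side of the system vanishes at F) if and only if there exists ρ > 0 such that F_k = 1/(e^{ρk} − 1) for all k ∈ 𝕀. Equivalently, setting G_k = F_k/(F_k + 1) ∈ (0,1), F is an equilibrium if and only if G_{k₁} = G_{k₂}·G_{k₃} for all k₁, k₂, k₃ ∈ 𝕀 with k₂ + k₃ = k₁, which holds if and only if G_k = e^{−ρk} for some ρ > 0. -/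
noncomputable def auxT (K : ℕ → ℕ → ℕ → ℝ) (F : ℕ → ℝ) (a b c : ℕ) : ℝ :=
  if b + c = a then
      K a b c * ((F a + 1) * F b * F c - F a * (F b + 1) * (F c + 1))
    else 0

theorem aux_C12 (I : ℕ) (K : ℕ → ℕ → ℕ → ℝ) (F : ℕ → ℝ) (k : ℕ) :
    C12 I K F k = (∑ b ∈ Finset.Icc 1 I, ∑ c ∈ Finset.Icc 1 I, auxT K F k b c)
      - 2 * ∑ a ∈ Finset.Icc 1 I, ∑ c ∈ Finset.Icc 1 I, auxT K F a k c := rfl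

theorem aux_symm (K : ℕ → ℕ → ℕ → ℝ) (F : ℕ → ℝ)
    (hKsymm : ∀ a b c, K a b c = K b a c ∧ K a b c = K a c b) (a b c : ℕ) :
    auxT K F a b c = auxT K F a c b := by
  unfold auxT
  rw [(hKsymm a b c).2, add_comm b c]
  split_ifs
  · ring
  · rfl

theorem aux_weak (S : Finset ℕ) (T : ℕ → ℕ → ℕ → ℝ) (hT : ∀ a b c, T a b c = T a c b)
    (p : ℕ → ℝ) :
    ∑ k ∈ S, p k * ((∑ b ∈ S, ∑ c ∈ S, T k b c) - 2 * ∑ a ∈ S, ∑ c ∈ S, T a k c)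
      = ∑ a ∈ S, ∑ b ∈ S, ∑ c ∈ S, T a b c * (p a - p b - p c) := by
  have h1 : ∑ k ∈ S, p k * ∑ a ∈ S, ∑ c ∈ S, T a k c
      = ∑ a ∈ S, ∑ b ∈ S, ∑ c ∈ S, T a b c * p b := by
    rw [Finset.sum_comm]
    refine Finset.sum_congr rfl fun k _ => ?_
    rw [Finset.mul_sum]
    refine Finset.sum_congr rfl fun a _ => ?_
    rw [Finset.mul_sum]
    exact Finset.sum_congr rfl fun c _ => mul_comm _ _
  have h2 : ∑ a ∈ S, ∑ b ∈ S, ∑ c ∈ S, T a b c * p c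
      = ∑ a ∈ S, ∑ b ∈ S, ∑ c ∈ S, T a b c * p b := by
    refine Finset.sum_congr rfl fun a _ => ?_
    rw [Finset.sum_comm]
    refine Finset.sum_congr rfl fun b _ => Finset.sum_congr rfl fun c _ => ?_
    rw [hT]
  have h3 : ∑ k ∈ S, p k * ∑ b ∈ S, ∑ c ∈ S, T k b c
      = ∑ a ∈ S, ∑ b ∈ S, ∑ c ∈ S, T a b c * p a := by
    refine Finset.sum_congr rfl fun k _ => ?_
    rw [Finset.mul_sum]
    refine Finset.sum_congr rfl fun a _ => ?_
    rw [Finset.mul_sum]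
    exact Finset.sum_congr rfl fun c _ => mul_comm _ _
  have h4 : ∀ k, p k * ((∑ b ∈ S, ∑ c ∈ S, T k b c) - 2 * ∑ a ∈ S, ∑ c ∈ S, T a k c)
      = p k * (∑ b ∈ S, ∑ c ∈ S, T k b c) - 2 * (p k * ∑ a ∈ S, ∑ c ∈ S, T a k c) := by
    intro k; ring
  simp only [h4, mul_sub, Finset.sum_sub_distrib, ← Finset.mul_sum]
  rw [h1, h2, h3]
  ring

theorem aux_log (x y : ℝ) (hx : 0 < x) (hy : 0 < y) :
    (x - y) * (Real.log y - Real.log x) ≤ 0 ∧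
    ((x - y) * (Real.log y - Real.log x) = 0 → x = y) := by
  rcases lt_trichotomy x y with h | h | h
  · have := Real.log_lt_log hx h
    have h2 : (x - y) * (Real.log y - Real.log x) < 0 :=
      mul_neg_of_neg_of_pos (by linarith) (by linarith)
    exact ⟨h2.le, fun h3 => absurd h3 h2.ne⟩
  · subst h; simp
  · have := Real.log_lt_log hy h
    have h2 : (x - y) * (Real.log y - Real.log x) < 0 :=
      mul_neg_of_pos_of_neg (by linarith) (by linarith)
    exact ⟨h2.le, fun h3 => absurd h3 h2.ne⟩

theorem aux_alg (k x y z : ℝ) (hx : 0 < x) (hy : 0 < y) (hz : 0 < z) :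
    k * ((x + 1) * y * z - x * (y + 1) * (z + 1))
      = (k * (x + 1) * (y + 1) * (z + 1)) * (y / (y + 1) * (z / (z + 1)) - x / (x + 1)) := by
  have : x + 1 ≠ 0 := by positivity
  have : y + 1 ≠ 0 := by positivity
  have : z + 1 ≠ 0 := by positivity
  field_simp

theorem aux_DB (I : ℕ) (K : ℕ → ℕ → ℕ → ℝ)
    (hKpos : ∀ a b c, 0 < K a b c)
    (hKsymm : ∀ a b c, K a b c = K b a c ∧ K a b c = K a c b)
    (F : ℕ → ℝ)
    (hFpos : ∀ k ∈ Finset.Icc 1 I, 0 < F k) :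
    (∀ k₁ ∈ Finset.Icc 1 I, C12 I K F k₁ = 0) ↔
      ∀ k₁ ∈ Finset.Icc 1 I, ∀ k₂ ∈ Finset.Icc 1 I, ∀ k₃ ∈ Finset.Icc 1 I,
        k₂ + k₃ = k₁ →
          F k₁ / (F k₁ + 1) = (F k₂ / (F k₂ + 1)) * (F k₃ / (F k₃ + 1)) := by
  constructor
  · intro h
    have hw := aux_weak (Finset.Icc 1 I) (auxT K F) (aux_symm K F hKsymm)
      (fun k => Real.log (F k / (F k + 1)))
    rw [Finset.sum_eq_zero (fun k hk => by rw [← aux_C12, h k hk, mul_zero])] at hw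
    have key : ∀ a ∈ Finset.Icc 1 I, ∀ b ∈ Finset.Icc 1 I, ∀ c ∈ Finset.Icc 1 I,
        auxT K F a b c * (Real.log (F a / (F a + 1)) - Real.log (F b / (F b + 1))
          - Real.log (F c / (F c + 1))) ≤ 0 ∧
        (auxT K F a b c * (Real.log (F a / (F a + 1)) - Real.log (F b / (F b + 1))
          - Real.log (F c / (F c + 1))) = 0 → b + c = a →
          F a / (F a + 1) = (F b / (F b + 1)) * (F c / (F c + 1))) := by
      intro a ha b hb c hc
      have ha := hFpos a ha
      have hb := hFpos b hb
      have hc := hFpos c hc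
      have hk := hKpos a b c
      unfold auxT
      split_ifs with hs
      · rw [aux_alg _ _ _ _ ha hb hc, sub_sub, ← Real.log_mul (by positivity) (by positivity),
          mul_assoc]
        have hl := aux_log (F b / (F b + 1) * (F c / (F c + 1))) (F a / (F a + 1))
          (by positivity) (by positivity)
        have hP : 0 < K a b c * (F a + 1) * (F b + 1) * (F c + 1) := by positivity
        refine ⟨mul_nonpos_of_nonneg_of_nonpos hP.le hl.1, fun h0 _ => ?_⟩
        exact (hl.2 ((mul_eq_zero.1 h0).resolve_left hP.ne')).symm
      · exact ⟨by simp, fun _ h => absurd h hs⟩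
    intro a ha b hb c hc
    have e1 := (Finset.sum_eq_zero_iff_of_nonpos (fun a ha => Finset.sum_nonpos fun b hb =>
      Finset.sum_nonpos fun c hc => (key a ha b hb c hc).1)).1 hw.symm a ha
    have e2 := (Finset.sum_eq_zero_iff_of_nonpos (fun b hb =>
      Finset.sum_nonpos fun c hc => (key a ha b hb c hc).1)).1 e1 b hb
    have e3 := (Finset.sum_eq_zero_iff_of_nonpos (fun c hc => (key a ha b hb c hc).1)).1 e2 c hc
    exact (key a ha b hb c hc).2 e3
  · intro h
    have hT : ∀ a ∈ Finset.Icc 1 I, ∀ b ∈ Finset.Icc 1 I, ∀ c ∈ Finset.Icc 1 I,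
        auxT K F a b c = 0 := by
      intro a ha b hb c hc
      unfold auxT
      split_ifs with hs
      · rw [aux_alg _ _ _ _ (hFpos a ha) (hFpos b hb) (hFpos c hc), h a ha b hb c hc hs]
        simp
      · rfl
    intro k hk
    rw [aux_C12, Finset.sum_eq_zero fun b hb => Finset.sum_eq_zero fun c hc => hT k hk b hb c hc,
      Finset.sum_eq_zero fun a ha => Finset.sum_eq_zero fun c hc => hT a ha k hk c hc]
    simp

theorem aux_exp (I : ℕ) (hI : 2 ≤ I) (G : ℕ → ℝ)
    (hG : ∀ k ∈ Finset.Icc 1 I, 0 < G k ∧ G k < 1) :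
    (∀ k₁ ∈ Finset.Icc 1 I, ∀ k₂ ∈ Finset.Icc 1 I, ∀ k₃ ∈ Finset.Icc 1 I,
        k₂ + k₃ = k₁ → G k₁ = G k₂ * G k₃) ↔
      ∃ ρ > (0 : ℝ), ∀ k ∈ Finset.Icc 1 I, G k = Real.exp (-(ρ * k)) := by
  have m1 : 1 ∈ Finset.Icc 1 I := Finset.mem_Icc.2 ⟨le_rfl, by omega⟩
  constructor
  · intro h
    obtain ⟨h0, h1⟩ := hG 1 m1
    refine ⟨-Real.log (G 1), by have := Real.log_neg h0 h1; linarith, ?_⟩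
    intro k hk
    obtain ⟨hk1, hk2⟩ := Finset.mem_Icc.1 hk
    clear hk
    induction k, hk1 using Nat.le_induction with
    | base => simp [Real.exp_log h0]
    | succ n hn ih =>
      rw [h (n+1) (Finset.mem_Icc.2 ⟨by omega, hk2⟩) n (Finset.mem_Icc.2 ⟨hn, by omega⟩) 1 m1 rfl,
        ih (by omega)]
      nth_rewrite 2 [← Real.exp_log h0]
      rw [← Real.exp_add]
      congr 1
      push_cast
      ring
  · rintro ⟨ρ, _, h⟩ a ha b hb c hc rfl
    rw [h _ ha, h _ hb, h _ hc, ← Real.exp_add]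
    congr 1
    push_cast
    ring

theorem aux_FG (f x : ℝ) (hf : 0 < f) (hx : 0 < x) :
    f = 1 / (Real.exp x - 1) ↔ f / (f + 1) = Real.exp (-x) := by
  have h1 : 0 < Real.exp x - 1 := by have := Real.add_one_lt_exp hx.ne'; linarith
  have h2 := Real.exp_pos x
  rw [Real.exp_neg, inv_eq_one_div, eq_div_iff h1.ne', div_eq_div_iff (by positivity) h2.ne']
  constructor <;> intro h <;> linarith

/-- Characterization of the positive equilibria of the discrete `C₁₂` system:
they are exactly the Bose–Einstein distributions `F_k = 1/(e^{ρk} − 1)`;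
equivalently, in the variables `G_k = F_k/(F_k+1)`, the detailed-balance
relations `G_{k₁} = G_{k₂} G_{k₃}` (for `k₂ + k₃ = k₁`) hold, which in turn hold
iff `G_k = e^{−ρk}` for some `ρ > 0`. -/
theorem C12_equilibrium_characterization (I : ℕ) (hI : 2 ≤ I) (K : ℕ → ℕ → ℕ → ℝ)
    (hKpos : ∀ a b c, 0 < K a b c)
    (hKsymm : ∀ a b c, K a b c = K b a c ∧ K a b c = K a c b)
    (F : ℕ → ℝ)
    (hFpos : ∀ k ∈ Finset.Icc 1 I, 0 < F k) :
    ((∀ k₁ ∈ Finset.Icc 1 I, C12 I K F k₁ = 0) ↔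
      ∃ ρ > (0 : ℝ), ∀ k ∈ Finset.Icc 1 I, F k = 1 / (Real.exp (ρ * k) - 1)) ∧
    ((∀ k₁ ∈ Finset.Icc 1 I, C12 I K F k₁ = 0) ↔
      ∀ k₁ ∈ Finset.Icc 1 I, ∀ k₂ ∈ Finset.Icc 1 I, ∀ k₃ ∈ Finset.Icc 1 I,
        k₂ + k₃ = k₁ →
          F k₁ / (F k₁ + 1) = (F k₂ / (F k₂ + 1)) * (F k₃ / (F k₃ + 1))) ∧
    ((∀ k₁ ∈ Finset.Icc 1 I, ∀ k₂ ∈ Finset.Icc 1 I, ∀ k₃ ∈ Finset.Icc 1 I,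
        k₂ + k₃ = k₁ →
          F k₁ / (F k₁ + 1) = (F k₂ / (F k₂ + 1)) * (F k₃ / (F k₃ + 1))) ↔
      ∃ ρ > (0 : ℝ), ∀ k ∈ Finset.Icc 1 I, F k / (F k + 1) = Real.exp (-(ρ * k))) := by
  have hDB := aux_DB I K hKpos hKsymm F hFpos
  have hE := aux_exp I hI (fun k => F k / (F k + 1)) (fun k hk => by
    have := hFpos k hk
    exact ⟨by positivity, by rw [div_lt_one (by positivity)]; linarith⟩)
  refine ⟨(hDB.trans hE).trans ?_, hDB, hE⟩
  refine exists_congr fun ρ => and_congr_right fun hρ => forall₂_congr fun k hk => ?_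
  have hk' : (0 : ℝ) < k := by exact_mod_cast (Finset.mem_Icc.1 hk).1
  exact (aux_FG (F k) (ρ * k) (hFpos k hk) (mul_pos hρ hk')).symm
end

section
/- Fix ρ > 0 and set G*_k = e^{−ρk} for k ∈ 𝕀. Let F : [0,∞) → (0,∞)^I be a solution of the discrete C₁₂ system and set G_k(t) = F_k(t)/(F_k(t) + 1) ∈ (0,1). Then the function t ↦ L(G(t)) is non-increasing on [0,∞), where L(G) = Σ_{k=1}^I [log(1 − G_k) + G_k·log(G_k)/(1 − G_k) − log(G*_k)/(1 − G_k)]. Moreover, (d/dt) L(G(t)) = 0 at a time t if and only if G_{k₁}(t) = G_{k₂}(t)·G_{k₃}(t) for all k₁, k₂, k₃ ∈ 𝕀 with k₂ + k₃ = k₁. -/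
/-- The Lyapunov functional `L(G)` relative to the equilibrium `G*_k = e^{−ρk}`. -/
noncomputable def LyapG (I : ℕ) (ρ : ℝ) (G : ℕ → ℝ) : ℝ :=
  ∑ k ∈ Finset.Icc 1 I,
    (Real.log (1 - G k) + G k * Real.log (G k) / (1 - G k)
      - Real.log (Real.exp (-(ρ * k))) / (1 - G k))

lemma C12aux_deriv (c x : ℝ) (hx : 0 < x) :
    HasDerivAt (fun f : ℝ => Real.log (1 - f / (f + 1)) + f / (f + 1) * Real.log (f / (f + 1)) / (1 - f / (f + 1))
      - Real.log (Real.exp (-c)) / (1 - f / (f + 1))) (Real.log (x / (x + 1)) + c) x := by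
  have h1 : HasDerivAt (fun f : ℝ => f + 1) 1 x := (hasDerivAt_id x).add_const 1
  have h2 : HasDerivAt (fun f : ℝ => Real.log (f + 1)) (1 / (x + 1)) x := h1.log (by positivity)
  have h3 : HasDerivAt (fun f : ℝ => Real.log f) (x⁻¹) x := Real.hasDerivAt_log hx.ne'
  have h4 : HasDerivAt (fun f : ℝ => -Real.log (f + 1) + f * (Real.log f - Real.log (f + 1)) + c * (f + 1))
      (-(1 / (x + 1)) + (1 * (Real.log x - Real.log (x + 1)) + x * (x⁻¹ - 1 / (x + 1))) + c * 1) x :=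
    (h2.neg.add ((hasDerivAt_id x).mul (h3.sub h2))).add (h1.const_mul c)
  have h5 : -(1 / (x + 1)) + (1 * (Real.log x - Real.log (x + 1)) + x * (x⁻¹ - 1 / (x + 1))) + c * 1
      = Real.log (x / (x + 1)) + c := by
    rw [Real.log_div hx.ne' (by positivity)]
    field_simp
    ring
  rw [h5] at h4
  refine h4.congr_of_eventuallyEq ?_
  filter_upwards [lt_mem_nhds hx] with f hf
  have e : 1 - f / (f + 1) = (f + 1)⁻¹ := by field_simp; ring
  rw [e, Real.log_inv, Real.log_exp, Real.log_div hf.ne' (by positivity)]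
  field_simp
  ring

lemma C12aux_sum (S : Finset ℕ) (φ : ℕ → ℝ) (T : ℕ → ℕ → ℕ → ℝ)
    (hT : ∀ a b c, T a b c = T a c b) :
    ∑ k ∈ S, φ k * ((∑ b ∈ S, ∑ c ∈ S, if b + c = k then T k b c else 0)
      - 2 * (∑ b ∈ S, ∑ c ∈ S, if k + c = b then T b k c else 0))
    = ∑ a ∈ S, ∑ b ∈ S, ∑ c ∈ S, if b + c = a then T a b c * (φ a - φ b - φ c) else 0 := by
  have e1 : ∑ k ∈ S, φ k * (∑ b ∈ S, ∑ c ∈ S, if k + c = b then T b k c else 0)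
      = ∑ a ∈ S, ∑ b ∈ S, ∑ c ∈ S, if b + c = a then T a b c * φ b else 0 := by
    rw [Finset.sum_comm]
    refine Finset.sum_congr rfl fun k _ => ?_
    rw [Finset.mul_sum]
    refine Finset.sum_congr rfl fun a _ => ?_
    rw [Finset.mul_sum]
    refine Finset.sum_congr rfl fun c _ => ?_
    split_ifs <;> ring
  have e2 : ∑ a ∈ S, ∑ b ∈ S, ∑ c ∈ S, (if b + c = a then T a b c * φ b else 0)
      = ∑ a ∈ S, ∑ b ∈ S, ∑ c ∈ S, if b + c = a then T a b c * φ c else 0 := by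
    refine Finset.sum_congr rfl fun a _ => ?_
    rw [Finset.sum_comm]
    refine Finset.sum_congr rfl fun b _ => Finset.sum_congr rfl fun c _ => ?_
    rw [add_comm c b, hT a c b]
  have e3 : ∑ k ∈ S, φ k * (∑ b ∈ S, ∑ c ∈ S, if b + c = k then T k b c else 0)
      = ∑ a ∈ S, ∑ b ∈ S, ∑ c ∈ S, if b + c = a then T a b c * φ a else 0 := by
    refine Finset.sum_congr rfl fun k _ => ?_
    rw [Finset.mul_sum]
    refine Finset.sum_congr rfl fun a _ => ?_
    rw [Finset.mul_sum]
    refine Finset.sum_congr rfl fun c _ => ?_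
    split_ifs <;> ring
  have e4 : ∑ a ∈ S, ∑ b ∈ S, ∑ c ∈ S, (if b + c = a then T a b c * (φ a - φ b - φ c) else 0)
      = ∑ a ∈ S, ∑ b ∈ S, ∑ c ∈ S, (if b + c = a then T a b c * φ a else 0)
       - ∑ a ∈ S, ∑ b ∈ S, ∑ c ∈ S, (if b + c = a then T a b c * φ b else 0)
       - ∑ a ∈ S, ∑ b ∈ S, ∑ c ∈ S, (if b + c = a then T a b c * φ c else 0) := by
    simp only [← Finset.sum_sub_distrib]
    refine Finset.sum_congr rfl fun a _ => Finset.sum_congr rfl fun b _ =>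
      Finset.sum_congr rfl fun c _ => ?_
    split_ifs <;> ring
  rw [e4, ← e3, ← e2, ← e1, ← Finset.sum_sub_distrib, ← Finset.sum_sub_distrib]
  refine Finset.sum_congr rfl fun a _ => ?_
  ring

lemma C12aux_term (k x y z ρ : ℝ) (hk : 0 < k) (hx : 0 < x) (hy : 0 < y) (hz : 0 < z) (a b c : ℝ)
    (h : b + c = a) :
    k * ((x + 1) * y * z - x * (y + 1) * (z + 1)) *
      ((Real.log (x / (x + 1)) + ρ * a) - (Real.log (y / (y + 1)) + ρ * b)
        - (Real.log (z / (z + 1)) + ρ * c)) ≤ 0 ∧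
    (k * ((x + 1) * y * z - x * (y + 1) * (z + 1)) *
      ((Real.log (x / (x + 1)) + ρ * a) - (Real.log (y / (y + 1)) + ρ * b)
        - (Real.log (z / (z + 1)) + ρ * c)) = 0 ↔ x / (x + 1) = y / (y + 1) * (z / (z + 1))) := by
  have hp : 0 < x / (x + 1) := by positivity
  have hy' : 0 < y / (y + 1) := by positivity
  have hz' : 0 < z / (z + 1) := by positivity
  have hq : 0 < y / (y + 1) * (z / (z + 1)) := by positivity
  have e1 : (Real.log (x / (x + 1)) + ρ * a) - (Real.log (y / (y + 1)) + ρ * b)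
        - (Real.log (z / (z + 1)) + ρ * c)
      = Real.log (x / (x + 1)) - Real.log (y / (y + 1) * (z / (z + 1))) := by
    rw [Real.log_mul hy'.ne' hz'.ne', ← h]; ring
  have e2 : k * ((x + 1) * y * z - x * (y + 1) * (z + 1))
      = (k * (x + 1) * (y + 1) * (z + 1)) * (y / (y + 1) * (z / (z + 1)) - x / (x + 1)) := by
    field_simp
  have hM : 0 < k * (x + 1) * (y + 1) * (z + 1) := by positivity
  rw [e1, e2]
  generalize k * (x + 1) * (y + 1) * (z + 1) = M at *
  generalize y / (y + 1) * (z / (z + 1)) = q at *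
  generalize x / (x + 1) = p at *
  rcases lt_trichotomy p q with hlt | heq | hgt
  · have := Real.log_lt_log hp hlt
    have h3 : M * (q - p) * (Real.log p - Real.log q) < 0 :=
      mul_neg_of_pos_of_neg (mul_pos hM (by linarith)) (by linarith)
    exact ⟨h3.le, fun h => absurd h h3.ne, fun h => absurd h hlt.ne⟩
  · subst heq; simp
  · have := Real.log_lt_log hq hgt
    have h3 : M * (q - p) * (Real.log p - Real.log q) < 0 :=
      mul_neg_of_neg_of_pos (mul_neg_of_pos_of_neg hM (by linarith)) (by linarith)
    exact ⟨h3.le, fun h => absurd h h3.ne, fun h => absurd h hgt.ne'⟩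

/-- Along solutions of the discrete `C₁₂` system, `t ↦ L(G(t))` is non-increasing,
and its derivative vanishes at time `t` iff the detailed-balance relations
`G_{k₁}(t) = G_{k₂}(t) G_{k₃}(t)` hold for all `k₂ + k₃ = k₁`. -/
theorem C12_lyapunov_monotone (I : ℕ) (hI : 2 ≤ I) (K : ℕ → ℕ → ℕ → ℝ)
    (hKpos : ∀ a b c, 0 < K a b c)
    (hKsymm : ∀ a b c, K a b c = K b a c ∧ K a b c = K a c b)
    (ρ : ℝ) (hρ : 0 < ρ)
    (F : ℝ → ℕ → ℝ)
    (hFpos : ∀ t ∈ Set.Ici (0 : ℝ), ∀ k ∈ Finset.Icc 1 I, 0 < F t k)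
    (hF : ∀ t ∈ Set.Ici (0 : ℝ), ∀ k₁ ∈ Finset.Icc 1 I,
      HasDerivWithinAt (fun s => F s k₁) (C12 I K (F t) k₁) (Set.Ici 0) t)
    (G : ℝ → ℕ → ℝ)
    (hG : ∀ t k, G t k = F t k / (F t k + 1)) :
    AntitoneOn (fun t => LyapG I ρ (G t)) (Set.Ici 0) ∧
    ∀ t ∈ Set.Ici (0 : ℝ), ∀ d : ℝ,
      HasDerivWithinAt (fun s => LyapG I ρ (G s)) d (Set.Ici 0) t →
      (d = 0 ↔ ∀ k₁ ∈ Finset.Icc 1 I, ∀ k₂ ∈ Finset.Icc 1 I, ∀ k₃ ∈ Finset.Icc 1 I,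
        k₂ + k₃ = k₁ → G t k₁ = G t k₂ * G t k₃) := by
  obtain rfl : G = fun t k => F t k / (F t k + 1) := by
    funext t k; exact hG t k
  let D : ℝ → ℕ → ℕ → ℕ → ℝ := fun t a b c =>
    if b + c = a then
      K a b c * ((F t a + 1) * F t b * F t c - F t a * (F t b + 1) * (F t c + 1)) *
        ((Real.log (F t a / (F t a + 1)) + ρ * a) - (Real.log (F t b / (F t b + 1)) + ρ * b)
        - (Real.log (F t c / (F t c + 1)) + ρ * c)) else 0
  have hD : ∀ t ∈ Set.Ici (0 : ℝ), HasDerivWithinAt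
      (fun s => LyapG I ρ (fun k => F s k / (F s k + 1)))
      (∑ a ∈ Finset.Icc 1 I, ∑ b ∈ Finset.Icc 1 I, ∑ c ∈ Finset.Icc 1 I, D t a b c)
      (Set.Ici 0) t := by
    intro t ht
    have := C12aux_sum (Finset.Icc 1 I) (fun k => Real.log (F t k / (F t k + 1)) + ρ * k)
      (fun a b c => K a b c * ((F t a + 1) * F t b * F t c - F t a * (F t b + 1) * (F t c + 1)))
      (by intro a b c; rw [(hKsymm a b c).2]; ring)
    simp only [D]
    rw [← this]
    unfold LyapG
    refine HasDerivWithinAt.fun_sum fun k hk => ?_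
    exact (C12aux_deriv (ρ * k) (F t k) (hFpos t ht k hk)).comp_hasDerivWithinAt t (hF t ht k hk)
  have hDt : ∀ t ∈ Set.Ici (0 : ℝ), ∀ a ∈ Finset.Icc 1 I, ∀ b ∈ Finset.Icc 1 I,
      ∀ c ∈ Finset.Icc 1 I, D t a b c ≤ 0 ∧ (D t a b c = 0 ↔ (b + c = a →
        F t a / (F t a + 1) = F t b / (F t b + 1) * (F t c / (F t c + 1)))) := by
    intro t ht a ha b hb c hc
    by_cases h : b + c = a
    · have := C12aux_term (K a b c) (F t a) (F t b) (F t c) ρ (hKpos a b c) (hFpos t ht a ha)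
        (hFpos t ht b hb) (hFpos t ht c hc) a b c (by exact_mod_cast h)
      simp only [D, if_pos h]
      exact ⟨this.1, this.2.trans ⟨fun h' _ => h', fun h' => h' h⟩⟩
    · simp [D, h]
  have h0 : ∀ t ∈ Set.Ici (0 : ℝ), ∀ a ∈ Finset.Icc 1 I, ∀ b ∈ Finset.Icc 1 I,
      ∑ c ∈ Finset.Icc 1 I, D t a b c ≤ 0 := fun t ht a ha b hb =>
    Finset.sum_nonpos fun c hc => (hDt t ht a ha b hb c hc).1
  have h1 : ∀ t ∈ Set.Ici (0 : ℝ), ∀ a ∈ Finset.Icc 1 I,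
      ∑ b ∈ Finset.Icc 1 I, ∑ c ∈ Finset.Icc 1 I, D t a b c ≤ 0 := fun t ht a ha =>
    Finset.sum_nonpos fun b hb => h0 t ht a ha b hb
  refine ⟨?_, ?_⟩
  · refine antitoneOn_of_hasDerivWithinAt_nonpos (convex_Ici 0)
      (fun t ht => (hD t ht).continuousWithinAt)
      (fun t ht => (hD t (interior_subset ht)).mono interior_subset)
      (fun t ht => Finset.sum_nonpos fun a ha => h1 t (interior_subset ht) a ha)
  · intro t ht d hd
    rw [(uniqueDiffOn_Ici (0 : ℝ) t ht).eq_deriv _ hd (hD t ht),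
      Finset.sum_eq_zero_iff_of_nonpos (h1 t ht)]
    refine forall₂_congr fun a ha => ?_
    rw [Finset.sum_eq_zero_iff_of_nonpos (h0 t ht a ha)]
    refine forall₂_congr fun b hb => ?_
    rw [Finset.sum_eq_zero_iff_of_nonpos fun c hc => (hDt t ht a ha b hb c hc).1]
    exact forall₂_congr fun c hc => (hDt t ht a ha b hb c hc).2
end

section
/- Fix an integer I ≥ 2, ρ > 0, and set G*_k = e^{−ρk} for k ∈ {1,…,I}. Define L(G) = Σ_{k=1}^I [log(1 − G_k) + G_k·log(G_k)/(1 − G_k) − log(G*_k)/(1 − G_k)] and E(G) = Σ_{k=1}^I k·G_k/(1 − G_k) on (0,1)^I. Then G* is the unique critical point of L restricted to the invariant set 𝔖_c = {G ∈ (0,1)^I : E(G) = E(G*)}; that is, if G ∈ (0,1)^I satisfies E(G) = E(G*) and there exists ϱ ∈ ℝ with ∇L(G) = ϱ·∇E(G), then G = G*. -/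
/-- `G* = (e^{−ρk})_k` is the unique critical point of the Lyapunov function `L`
restricted to the invariant set `𝔖_c = {G ∈ (0,1)^I : E(G) = E(G*)}`, where
`E(G) = Σ k G_k/(1 − G_k)`: if `∇L(G) = ϱ·∇E(G)` for some `ϱ ∈ ℝ` and `G` has the
same energy as `G*`, then `G = G*`. -/
theorem C12_unique_critical_point (I : ℕ) (hI : 2 ≤ I) (ρ : ℝ) (hρ : 0 < ρ)
    (G : ℕ → ℝ)
    (hG : ∀ k ∈ Finset.Icc 1 I, 0 < G k ∧ G k < 1)
    (hE : ∑ k ∈ Finset.Icc 1 I, (k : ℝ) * G k / (1 - G k)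
        = ∑ k ∈ Finset.Icc 1 I, (k : ℝ) * Real.exp (-(ρ * k)) / (1 - Real.exp (-(ρ * k))))
    (hcrit : ∃ ϱ : ℝ, ∀ k ∈ Finset.Icc 1 I,
      (1 / (1 - G k) ^ 2) * Real.log (G k / Real.exp (-(ρ * k)))
        = ϱ * ((k : ℝ) / (1 - G k) ^ 2)) :
    ∀ k ∈ Finset.Icc 1 I, G k = Real.exp (-(ρ * k)) := by
  obtain ⟨r, hr⟩ := hcrit
  have hlog : ∀ k ∈ Finset.Icc 1 I, G k = Real.exp (-(ρ * k) + r * k) := by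
    intro k hk
    obtain ⟨h0, h1⟩ := hG k hk
    have h := hr k hk
    have hne : (1 - G k) ^ 2 ≠ 0 := pow_ne_zero _ (sub_pos.mpr h1).ne'
    have h2 : Real.log (G k / Real.exp (-(ρ * k))) = r * k := by
      rw [one_div_mul_eq_div, ← mul_div_assoc] at h
      exact (div_left_inj' hne).mp h
    rw [Real.log_div h0.ne' (Real.exp_pos _).ne', Real.log_exp] at h2
    rw [show -(ρ * (k : ℝ)) + r * k = Real.log (G k) by linarith, Real.exp_log h0]
  have hmono : ∀ (k a b : ℝ), 0 < k → a < b → b < 1 →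
      k * a / (1 - a) < k * b / (1 - b) := by
    intro k a b hk hab hb
    rw [div_lt_div_iff₀ (by linarith) (by linarith)]
    nlinarith [mul_lt_mul_of_pos_left hab hk]
  have hkpos : ∀ k ∈ Finset.Icc 1 I, (0 : ℝ) < k := by
    intro k hk
    exact_mod_cast (Finset.mem_Icc.mp hk).1
  have hne : (Finset.Icc 1 I).Nonempty := ⟨1, Finset.mem_Icc.mpr ⟨le_refl _, by omega⟩⟩
  rcases lt_trichotomy r 0 with h | h | h
  · exfalso
    refine (Finset.sum_lt_sum_of_nonempty hne ?_).ne hE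
    intro k hk
    have hp := hkpos k hk
    refine hmono k _ _ hp ?_ ?_
    · rw [hlog k hk, Real.exp_lt_exp]
      nlinarith
    · rw [Real.exp_lt_one_iff]
      nlinarith
  · intro k hk
    rw [hlog k hk, h]
    simp
  · exfalso
    refine (Finset.sum_lt_sum_of_nonempty hne ?_).ne hE.symm
    intro k hk
    have hp := hkpos k hk
    refine hmono k _ _ hp ?_ (hG k hk).2
    rw [hlog k hk, Real.exp_lt_exp]
    nlinarith
end

section
/- Let F : [0,∞) → (0,∞)^I be a solution of the discrete C₁₂ system. Then the system is persistent: for each k ∈ 𝕀, liminf_{t→∞} F_k(t) > 0; in fact inf_{t≥0} min_{1≤k≤I} F_k(t) > 0. -/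
lemma C12_barrier (f f' : ℝ → ℝ) (a C : ℝ) (hC : 0 < C)
    (hf : ∀ t ∈ Set.Ici (0 : ℝ), HasDerivWithinAt f (f' t) (Set.Ici 0) t)
    (h : ∀ t ∈ Set.Ici (0 : ℝ), a - C * f t ≤ f' t) :
    ∀ t ∈ Set.Ici (0 : ℝ), min (f 0) (a / C) ≤ f t := by
  intro t ht
  have hg : ∀ t ∈ Set.Ici (0 : ℝ), HasDerivWithinAt (fun s => (f s - a / C) * Real.exp (C * s))
      (f' t * Real.exp (C * t) + (f t - a / C) * (Real.exp (C * t) * (C * 1))) (Set.Ici 0) t := by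
    intro t ht
    exact ((hf t ht).sub_const _).mul
      ((((hasDerivAt_id t).const_mul C).exp).hasDerivWithinAt)
  have hmono : MonotoneOn (fun s => (f s - a / C) * Real.exp (C * s)) (Set.Ici (0 : ℝ)) := by
    apply monotoneOn_of_hasDerivWithinAt_nonneg (convex_Ici 0)
      (f' := fun t => f' t * Real.exp (C * t) + (f t - a / C) * (Real.exp (C * t) * (C * 1)))
    · intro t ht
      exact (hg t ht).continuousWithinAt
    · intro t ht
      exact (hg t (interior_subset ht)).mono interior_subset
    · intro t ht
      have h1 := h t (interior_subset ht)
      have h2 : f' t * Real.exp (C * t) + (f t - a / C) * (Real.exp (C * t) * (C * 1))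
          = (f' t - (a - C * f t)) * Real.exp (C * t) := by
        field_simp
        ring
      simp only [h2]
      exact mul_nonneg (by linarith) (Real.exp_pos _).le
  have h1 := hmono (Set.self_mem_Ici) ht ht
  simp only [mul_zero, Real.exp_zero, mul_one] at h1
  have ht' : (0 : ℝ) ≤ t := ht
  have he : 1 ≤ Real.exp (C * t) := Real.one_le_exp (by positivity)
  by_contra hlt
  push Not at hlt
  have h3 : f t < f 0 := lt_of_lt_of_le hlt (min_le_left _ _)
  have h4 : f t < a / C := lt_of_lt_of_le hlt (min_le_right _ _)
  nlinarith

lemma C12_conserve (I : ℕ) (K : ℕ → ℕ → ℕ → ℝ)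
    (hKsymm : ∀ a b c, K a b c = K b a c ∧ K a b c = K a c b) (F : ℕ → ℝ) :
    ∑ k ∈ Finset.Icc 1 I, (k : ℝ) * C12 I K F k = 0 := by
  let T : ℕ → ℕ → ℕ → ℝ := fun a b c => if b + c = a then
      K a b c * ((F a + 1) * F b * F c - F a * (F b + 1) * (F c + 1)) else 0
  have hT : ∀ a b c, T a b c = T a c b := by
    intro a b c
    simp only [T, add_comm c b, (hKsymm a b c).2]
    split_ifs <;> ring
  have e : ∀ k, C12 I K F k = (∑ b ∈ Finset.Icc 1 I, ∑ c ∈ Finset.Icc 1 I, T k b c)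
      - 2 * ∑ a ∈ Finset.Icc 1 I, ∑ c ∈ Finset.Icc 1 I, T a k c := fun k => rfl
  have hk : ∀ a b c : ℕ, (a : ℝ) * T a b c = b * T a b c + c * T a b c := by
    intro a b c
    simp only [T]
    split_ifs with h
    · rw [← h]; push_cast; ring
    · simp
  have h1 : ∑ a ∈ Finset.Icc 1 I, ∑ b ∈ Finset.Icc 1 I, ∑ c ∈ Finset.Icc 1 I, (a : ℝ) * T a b c
      = 2 * ∑ a ∈ Finset.Icc 1 I, ∑ b ∈ Finset.Icc 1 I, ∑ c ∈ Finset.Icc 1 I, (b : ℝ) * T a b c := by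
    simp only [hk, Finset.sum_add_distrib]
    have : ∀ a, ∑ b ∈ Finset.Icc 1 I, ∑ c ∈ Finset.Icc 1 I, (c : ℝ) * T a b c =
        ∑ b ∈ Finset.Icc 1 I, ∑ c ∈ Finset.Icc 1 I, (b : ℝ) * T a b c := by
      intro a
      rw [Finset.sum_comm]
      refine Finset.sum_congr rfl fun b _ => Finset.sum_congr rfl fun c _ => ?_
      rw [hT]
    simp only [this]
    ring
  have h2 : ∑ b ∈ Finset.Icc 1 I, ∑ a ∈ Finset.Icc 1 I, ∑ c ∈ Finset.Icc 1 I, (b : ℝ) * T a b c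
      = ∑ a ∈ Finset.Icc 1 I, ∑ b ∈ Finset.Icc 1 I, ∑ c ∈ Finset.Icc 1 I, (b : ℝ) * T a b c :=
    Finset.sum_comm
  simp only [e, mul_sub, Finset.sum_sub_distrib, mul_left_comm _ (2 : ℝ)]
  simp only [← Finset.mul_sum] at h1 h2 ⊢
  simp only [← Finset.mul_sum, h1, h2, sub_self]

/-- lower bounds for the vector field -/
lemma C12_lower (I : ℕ) (hI : 2 ≤ I) (K : ℕ → ℕ → ℕ → ℝ) (B m M : ℝ) (hm : 0 < m)
    (hB : ∀ a ∈ Finset.Icc 1 I, ∀ b ∈ Finset.Icc 1 I, ∀ c ∈ Finset.Icc 1 I,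
      m ≤ K a b c ∧ K a b c ≤ B)
    (F : ℕ → ℝ) (hF : ∀ k ∈ Finset.Icc 1 I, 0 < F k ∧ F k ≤ M)
    (k : ℕ) (hk : k ∈ Finset.Icc 1 I) :
    (∑ b ∈ Finset.Icc 1 I, ∑ c ∈ Finset.Icc 1 I, if b + c = k then m * (F b * F c) else 0)
    + 2 * (∑ a ∈ Finset.Icc 1 I, ∑ c ∈ Finset.Icc 1 I, if k + c = a then m * F a else 0)
    - (I * I * (B * (1 + 2 * M)) + 2 * (I * I * (B * M))) * F k ≤ C12 I K F k := by
  obtain ⟨hk0, hkM⟩ := hF k hk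
  have hM : 0 < M := by linarith
  have hB0 : 0 < B := by
    have := hB k hk k hk k hk
    linarith
  have hcard : ∀ x : ℝ, ∑ b ∈ Finset.Icc 1 I, ∑ c ∈ Finset.Icc 1 I, x = I * I * x := by
    intro x
    simp [mul_assoc]
  have h1 : (∑ b ∈ Finset.Icc 1 I, ∑ c ∈ Finset.Icc 1 I, if b + c = k then m * (F b * F c) else 0)
      - I * I * (B * (1 + 2 * M) * F k) ≤ ∑ k₂ ∈ Finset.Icc 1 I, ∑ k₃ ∈ Finset.Icc 1 I,
    if k₂ + k₃ = k then
      K k k₂ k₃ * ((F k + 1) * F k₂ * F k₃ - F k * (F k₂ + 1) * (F k₃ + 1))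
    else 0 := by
    rw [← hcard]
    simp only [← Finset.sum_sub_distrib]
    refine Finset.sum_le_sum fun b hb => Finset.sum_le_sum fun c hc => ?_
    obtain ⟨hb0, hbM⟩ := hF b hb
    obtain ⟨hc0, hcM⟩ := hF c hc
    obtain ⟨hmK, hKB⟩ := hB k hk b hb c hc
    split_ifs
    · have e1 : m * (F b * F c) ≤ K k b c * (F b * F c) := by gcongr
      have e2 : K k b c * (1 + F b + F c) * F k ≤ B * (1 + 2 * M) * F k := by
        have e3 : 1 + F b + F c ≤ 1 + 2 * M := by linarith
        exact mul_le_mul_of_nonneg_right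
          (mul_le_mul hKB e3 (by positivity) hB0.le) hk0.le
      linarith
    · have : 0 < B * (1 + 2 * M) * F k := by positivity
      linarith
  have h2 : (∑ k₂ ∈ Finset.Icc 1 I, ∑ k₃ ∈ Finset.Icc 1 I,
    if k + k₃ = k₂ then
      K k₂ k k₃ * ((F k₂ + 1) * F k * F k₃ - F k₂ * (F k + 1) * (F k₃ + 1))
    else 0) ≤ I * I * (B * M * F k) - 
      (∑ a ∈ Finset.Icc 1 I, ∑ c ∈ Finset.Icc 1 I, if k + c = a then m * F a else 0) := by
    rw [← hcard]
    simp only [← Finset.sum_sub_distrib]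
    refine Finset.sum_le_sum fun a ha => Finset.sum_le_sum fun c hc => ?_
    obtain ⟨ha0, haM⟩ := hF a ha
    obtain ⟨hc0, hcM⟩ := hF c hc
    obtain ⟨hmK, hKB⟩ := hB a ha k hk c hc
    split_ifs
    · have e1 : m * F a ≤ K a k c * F a := by gcongr
      have e2 : K a k c * F c * F k ≤ B * M * F k := by gcongr
      have e3 : 0 ≤ K a k c * F a * (F k + F c) := by
        have : 0 < K a k c := by linarith
        positivity
      linarith
    · have : 0 < B * M * F k := by positivity
      linarith
  unfold C12
  linarith

/-- Persistence of the discrete `C₁₂` system: every positive solution stays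
uniformly bounded away from zero; in particular each `liminf_{t→∞} F_k(t) > 0`. -/
theorem C12_persistence (I : ℕ) (hI : 2 ≤ I) (K : ℕ → ℕ → ℕ → ℝ)
    (hKpos : ∀ a b c, 0 < K a b c)
    (hKsymm : ∀ a b c, K a b c = K b a c ∧ K a b c = K a c b)
    (F : ℝ → ℕ → ℝ)
    (hFpos : ∀ t ∈ Set.Ici (0 : ℝ), ∀ k ∈ Finset.Icc 1 I, 0 < F t k)
    (hF : ∀ t ∈ Set.Ici (0 : ℝ), ∀ k₁ ∈ Finset.Icc 1 I,
      HasDerivWithinAt (fun s => F s k₁) (C12 I K (F t) k₁) (Set.Ici 0) t) :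
    (∀ k ∈ Finset.Icc 1 I, 0 < Filter.liminf (fun t : ℝ => F t k) Filter.atTop) ∧
    ∃ ε > (0 : ℝ), ∀ t ∈ Set.Ici (0 : ℝ), ∀ k ∈ Finset.Icc 1 I, ε ≤ F t k := by
  have h1I : 1 ∈ Finset.Icc 1 I := Finset.mem_Icc.2 ⟨le_rfl, by omega⟩
  -- bounds on K
  obtain ⟨B, m, hm, hB⟩ : ∃ B m : ℝ, 0 < m ∧ ∀ a ∈ Finset.Icc 1 I, ∀ b ∈ Finset.Icc 1 I,
      ∀ c ∈ Finset.Icc 1 I, m ≤ K a b c ∧ K a b c ≤ B := by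
    let S := Finset.Icc 1 I ×ˢ Finset.Icc 1 I ×ˢ Finset.Icc 1 I
    have hS : S.Nonempty := ⟨(1, 1, 1), by simp only [S, Finset.mem_product]; exact ⟨h1I, h1I, h1I⟩⟩
    obtain ⟨x, -, hx⟩ := S.exists_min_image (fun p => K p.1 p.2.1 p.2.2) hS
    obtain ⟨y, -, hy⟩ := S.exists_max_image (fun p => K p.1 p.2.1 p.2.2) hS
    refine ⟨K y.1 y.2.1 y.2.2, K x.1 x.2.1 x.2.2, hKpos _ _ _, fun a ha b hb c hc => ?_⟩
    have : (a, b, c) ∈ S := by simp only [S, Finset.mem_product]; exact ⟨ha, hb, hc⟩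
    exact ⟨hx _ this, hy _ this⟩
  -- conservation
  obtain ⟨M, hMdef⟩ : ∃ M, M = ∑ k ∈ Finset.Icc 1 I, (k : ℝ) * F 0 k := ⟨_, rfl⟩
  have hcons : ∀ t ∈ Set.Ici (0 : ℝ), ∑ k ∈ Finset.Icc 1 I, (k : ℝ) * F t k = M := by
    have hd : ∀ t ∈ Set.Ici (0 : ℝ), HasDerivWithinAt
        (fun s => ∑ k ∈ Finset.Icc 1 I, (k : ℝ) * F s k) 0 (Set.Ici 0) t := by
      intro t ht
      have h := C12_conserve I K hKsymm (F t)
      refine HasDerivWithinAt.congr_deriv ?_ h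
      exact HasDerivWithinAt.fun_sum fun k hk => (hF t ht k hk).const_mul _
    intro t ht
    rw [hMdef]
    have := (convex_Ici (0:ℝ)).norm_image_sub_le_of_norm_hasDerivWithin_le (C := 0)
      hd (fun x _ => by simp) (Set.self_mem_Ici) ht
    simp only [zero_mul] at this
    exact sub_eq_zero.1 (norm_le_zero_iff.1 this)
  have hbd : ∀ t ∈ Set.Ici (0 : ℝ), ∀ k ∈ Finset.Icc 1 I, 0 < F t k ∧ F t k ≤ M := by
    intro t ht k hk
    refine ⟨hFpos t ht k hk, ?_⟩
    rw [← hcons t ht]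
    have h1 : (k : ℝ) * F t k ≤ ∑ k ∈ Finset.Icc 1 I, (k : ℝ) * F t k :=
      Finset.single_le_sum (f := fun k : ℕ => (k : ℝ) * F t k)
        (fun i hi => mul_nonneg (Nat.cast_nonneg _) (hFpos t ht i hi).le) hk
    have h2 : (1 : ℝ) ≤ k := by exact_mod_cast (Finset.mem_Icc.1 hk).1
    nlinarith [hFpos t ht k hk]
  have h00 : (0 : ℝ) ∈ Set.Ici (0 : ℝ) := Set.self_mem_Ici
  have hM : 0 < M := (hbd 0 h00 1 h1I).1.trans_le (hbd 0 h00 1 h1I).2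
  have hB0 : 0 < B := by
    have := hB 1 h1I 1 h1I 1 h1I
    linarith
  have hIpos : (0 : ℝ) < I := by exact_mod_cast (by omega : 0 < I)
  obtain ⟨C, hCdef⟩ : ∃ C : ℝ, C = I * I * (B * (1 + 2 * M)) + 2 * (I * I * (B * M)) := ⟨_, rfl⟩
  have hC : 0 < C := by rw [hCdef]; positivity
  have hlow := fun t (ht : t ∈ Set.Ici (0 : ℝ)) k hk =>
    C12_lower I hI K B m M hm hB (F t) (hbd t ht) k hk
  rw [← hCdef] at hlow
  -- step 1
  have hone : ∃ ε > (0 : ℝ), ∀ t ∈ Set.Ici (0 : ℝ), ε ≤ F t 1 := by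
    refine ⟨min (F 0 1) ((2 * m * M / I) / (C + 2 * m / I)), lt_min (hFpos 0 h00 1 h1I)
      (by positivity), ?_⟩
    refine C12_barrier (fun t => F t 1) (fun t => C12 I K (F t) 1) _ _ (by positivity)
      (fun t ht => hF t ht 1 h1I) ?_
    intro t ht
    refine le_trans ?_ (hlow t ht 1 h1I)
    have p1 : 0 ≤ ∑ b ∈ Finset.Icc 1 I, ∑ c ∈ Finset.Icc 1 I,
        if b + c = 1 then m * (F t b * F t c) else 0 := by
      refine Finset.sum_nonneg fun b hb => Finset.sum_nonneg fun c hc => ?_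
      have := hFpos t ht b hb
      have := hFpos t ht c hc
      split_ifs <;> positivity
    have p2 : m / I * (M - F t 1) ≤
        ∑ a ∈ Finset.Icc 1 I, ∑ c ∈ Finset.Icc 1 I, if 1 + c = a then m * F t a else 0 := by
      rw [← hcons t ht, ← Finset.add_sum_erase _ _ h1I]
      have : (((1 : ℕ) : ℝ) * F t 1 + ∑ x ∈ (Finset.Icc 1 I).erase 1, (x : ℝ) * F t x - F t 1)
        = ∑ x ∈ (Finset.Icc 1 I).erase 1, (x : ℝ) * F t x := by push_cast; ring
      rw [this, Finset.mul_sum]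
      refine le_trans ?_ (Finset.sum_le_sum_of_subset_of_nonneg (Finset.erase_subset 1 _) ?_)
      · refine Finset.sum_le_sum fun a ha => ?_
        obtain ⟨ha1, ha⟩ := Finset.mem_erase.1 ha
        have ha' := Finset.mem_Icc.1 ha
        have hpos := hFpos t ht a ha
        have q : m / I * ((a : ℝ) * F t a) ≤ m * F t a := by
          have : (a : ℝ) ≤ I := by exact_mod_cast ha'.2
          calc m / I * ((a : ℝ) * F t a) ≤ m / I * ((I : ℝ) * F t a) := by gcongr
            _ = m * F t a := by field_simp
        refine q.trans ?_
        have hmem : a - 1 ∈ Finset.Icc 1 I := Finset.mem_Icc.2 ⟨by omega, by omega⟩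
        have := Finset.single_le_sum (f := fun c => if 1 + c = a then m * F t a else 0)
          (fun i _ => by split_ifs <;> positivity) hmem
        simpa [show 1 + (a - 1) = a by omega] using this
      · intro a ha _
        have := hFpos t ht a ha
        refine Finset.sum_nonneg fun c hc => ?_
        split_ifs <;> positivity
    have e : 2 * m * M / I - (C + 2 * m / I) * F t 1 = 2 * (m / I * (M - F t 1)) - C * F t 1 := by
      ring
    rw [e]
    linarith
  obtain ⟨ε₁, hε₁, hone⟩ := hone
  -- induction
  have hall : ∀ k, 1 ≤ k → k ≤ I → ∃ ε > (0 : ℝ), ∀ t ∈ Set.Ici (0 : ℝ), ε ≤ F t k := by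
    intro k hk1
    induction k, hk1 using Nat.le_induction with
    | base => exact fun _ => ⟨ε₁, hε₁, hone⟩
    | succ k hk1 ih =>
      intro hkI
      obtain ⟨ε, hε, ih⟩ := ih (by omega)
      have hk : k ∈ Finset.Icc 1 I := Finset.mem_Icc.2 ⟨hk1, by omega⟩
      have hk' : k + 1 ∈ Finset.Icc 1 I := Finset.mem_Icc.2 ⟨by omega, hkI⟩
      refine ⟨min (F 0 (k + 1)) ((m * (ε * ε₁)) / C), lt_min (hFpos 0 h00 _ hk')
        (by positivity), ?_⟩
      refine C12_barrier (fun t => F t (k + 1)) (fun t => C12 I K (F t) (k + 1)) _ _ hC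
        (fun t ht => hF t ht _ hk') ?_
      intro t ht
      refine le_trans ?_ (hlow t ht _ hk')
      have p2 : 0 ≤ ∑ a ∈ Finset.Icc 1 I, ∑ c ∈ Finset.Icc 1 I,
          if k + 1 + c = a then m * F t a else 0 := by
        refine Finset.sum_nonneg fun b hb => Finset.sum_nonneg fun c hc => ?_
        have := hFpos t ht b hb
        split_ifs <;> positivity
      have hnn : ∀ b ∈ Finset.Icc 1 I, ∀ c ∈ Finset.Icc 1 I,
          0 ≤ if b + c = k + 1 then m * (F t b * F t c) else 0 := by
        intro b hb c hc
        have := hFpos t ht b hb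
        have := hFpos t ht c hc
        split_ifs <;> positivity
      have p1 := Finset.single_le_sum (f := fun b => ∑ c ∈ Finset.Icc 1 I,
        if b + c = k + 1 then m * (F t b * F t c) else 0)
        (fun b hb => Finset.sum_nonneg (hnn b hb)) hk
      have p3 := Finset.single_le_sum (f := fun c =>
        if k + c = k + 1 then m * (F t k * F t c) else 0) (hnn k hk) h1I
      simp only [if_true] at p3
      have p4 : m * (ε * ε₁) ≤ m * (F t k * F t 1) := by
        have := ih t ht
        have := hone t ht
        have := hFpos t ht k hk
        gcongr
      linarith
  choose! e he0 he using hall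
  refine ⟨fun k hk => ?_, ?_⟩
  · obtain ⟨hk1, hk2⟩ := Finset.mem_Icc.1 hk
    refine (he0 k hk1 hk2).trans_le (Filter.le_liminf_of_le ?_ ?_)
    · refine Filter.IsBoundedUnder.isCoboundedUnder_ge ⟨M, ?_⟩
      rw [Filter.eventually_map]
      filter_upwards [Filter.eventually_ge_atTop 0] with t ht
      exact (hbd t ht k hk).2
    · filter_upwards [Filter.eventually_ge_atTop 0] with t ht
      exact he k hk1 hk2 t ht
  · obtain ⟨x, hx, hmin⟩ := (Finset.Icc 1 I).exists_min_image e ⟨1, h1I⟩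
    obtain ⟨hx1, hx2⟩ := Finset.mem_Icc.1 hx
    refine ⟨e x, he0 x hx1 hx2, fun t ht k hk => ?_⟩
    obtain ⟨hk1, hk2⟩ := Finset.mem_Icc.1 hk
    exact (hmin k hk).trans (he k hk1 hk2 t ht)
end

section
/- Fix ρ > 0 and let G* ∈ (0,1)^I be given by G*_k = e^{−ρk}. Let J denote the Jacobian matrix of S at G*, and let V ⊂ ℝ^I be the linear span of the vectors {e_{k₁} − e_{k₂} − e_{k₃} : k₁, k₂, k₃ ∈ 𝕀, k₂ + k₃ = k₁}, where e_k is the k-th standard basis vector. Then for every nonzero δ ∈ V, Σ_{k=1}^I (Jδ)_k · δ_k / G*_k < 0; that is, J is negative definite on V with respect to the inner product ⟨u, v⟩ = Σ_{k=1}^I u_k v_k / G*_k. -/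
/-- The vector field `S` of the discrete `C₁₂` system in the variables
`G ∈ (0,1)^I`, with indices `i : Fin I` representing `k = i + 1`. -/
noncomputable def SfieldC12 (I : ℕ) (K : ℕ → ℕ → ℕ → ℝ) (G : Fin I → ℝ) (i₁ : Fin I) : ℝ :=
  2 * (∑ i₂ : Fin I, ∑ i₃ : Fin I,
    if (i₁ : ℕ) + 1 + ((i₂ : ℕ) + 1) = (i₃ : ℕ) + 1 then
      K ((i₁ : ℕ) + 1) ((i₂ : ℕ) + 1) ((i₃ : ℕ) + 1) * (G i₃ - G i₁ * G i₂) /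
        ((1 - G i₁) * (1 - G i₂) * (1 - G i₃))
    else 0)
  + ∑ i₂ : Fin I, ∑ i₃ : Fin I,
    if (i₂ : ℕ) + 1 + ((i₃ : ℕ) + 1) = (i₁ : ℕ) + 1 then
      K ((i₁ : ℕ) + 1) ((i₂ : ℕ) + 1) ((i₃ : ℕ) + 1) * (G i₂ * G i₃ - G i₁) /
        ((1 - G i₁) * (1 - G i₂) * (1 - G i₃))
    else 0

lemma C12aux_hasFDeriv {I : ℕ} (k : ℝ) (G : Fin I → ℝ) (a b c : Fin I)
    (ha : G a ≠ 1) (hb : G b ≠ 1) (hc : G c ≠ 1) (h : G c = G a * G b) :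
    ∃ L : (Fin I → ℝ) →L[ℝ] ℝ,
      HasFDerivAt (fun G : Fin I → ℝ => k * (G c - G a * G b) /
        ((1 - G a) * (1 - G b) * (1 - G c))) L G ∧
      ∀ δ, L δ = k / ((1 - G a) * (1 - G b) * (1 - G c)) * (δ c - G a * δ b - G b * δ a) := by
  have pa : ∀ i : Fin I, HasFDerivAt (fun G : Fin I → ℝ => G i)
      (ContinuousLinearMap.proj (R := ℝ) (φ := fun _ : Fin I => ℝ) i) G := fun i =>
    (ContinuousLinearMap.proj (R := ℝ) (φ := fun _ : Fin I => ℝ) i).hasFDerivAt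
  have ha' : 1 - G a ≠ 0 := sub_ne_zero.mpr ha.symm
  have hb' : 1 - G b ≠ 0 := sub_ne_zero.mpr hb.symm
  have hc' : 1 - G c ≠ 0 := sub_ne_zero.mpr hc.symm
  have hN := ((pa c).sub ((pa a).mul (pa b))).const_mul k
  have hD : DifferentiableAt ℝ (fun G : Fin I → ℝ => ((1 - G a) * (1 - G b) * (1 - G c))⁻¹) G := by
    apply DifferentiableAt.inv
    · fun_prop
    · exact mul_ne_zero (mul_ne_zero ha' hb') hc'
  have hT := hN.mul hD.hasFDerivAt
  simp only [div_eq_mul_inv]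
  refine ⟨_, hT, ?_⟩
  intro δ
  simp [h]
  ring

lemma C12aux_sum_s9 {I : ℕ} (Q : Fin I → Fin I → Fin I → ℝ) (x : Fin I → ℝ)
    (hQ : ∀ a b c, Q a b c = Q b a c) :
    ∑ i, (2 * (∑ j, ∑ k, Q i j k) - ∑ j, ∑ k, Q j k i) * x i
      = ∑ a, ∑ b, ∑ c, Q a b c * (x a + x b - x c) := by
  have e1 : ∑ a, ∑ b, ∑ c, Q a b c * x b = ∑ a, ∑ b, ∑ c, Q a b c * x a := by
    rw [Finset.sum_comm]
    refine Finset.sum_congr rfl fun a _ => Finset.sum_congr rfl fun b _ =>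
      Finset.sum_congr rfl fun c _ => by rw [hQ]
  have e2 : ∑ a, ∑ b, ∑ c, Q a b c * x c = ∑ c, ∑ a, ∑ b, Q a b c * x c := by
    calc _ = ∑ a, ∑ c, ∑ b, Q a b c * x c :=
          Finset.sum_congr rfl fun a _ => Finset.sum_comm
      _ = _ := Finset.sum_comm
  simp only [mul_sub, mul_add, Finset.sum_sub_distrib, Finset.sum_add_distrib, e1, e2, sub_mul]
  simp only [Finset.mul_sum, Finset.sum_mul]
  rw [← Finset.sum_add_distrib]
  congr 1
  refine Finset.sum_congr rfl fun a _ => ?_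
  simp only [← Finset.sum_add_distrib]
  refine Finset.sum_congr rfl fun b _ => Finset.sum_congr rfl fun c _ => by ring

noncomputable def C12auxQ (I : ℕ) (K : ℕ → ℕ → ℕ → ℝ) (G δ : Fin I → ℝ) (a b c : Fin I) : ℝ :=
  if (a : ℕ) + 1 + ((b : ℕ) + 1) = (c : ℕ) + 1 then
    K ((a : ℕ) + 1) ((b : ℕ) + 1) ((c : ℕ) + 1) / ((1 - G a) * (1 - G b) * (1 - G c)) *
      (δ c - G a * δ b - G b * δ a) else 0

lemma C12aux_fderiv {I : ℕ} (K : ℕ → ℕ → ℕ → ℝ)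
    (hKsymm : ∀ a b c, K a b c = K b a c ∧ K a b c = K a c b) (G : Fin I → ℝ)
    (h1 : ∀ i, G i ≠ 1)
    (hG : ∀ a b c : Fin I, (a : ℕ) + 1 + ((b : ℕ) + 1) = (c : ℕ) + 1 → G c = G a * G b)
    (δ : Fin I → ℝ) (i : Fin I) :
    (fderiv ℝ (SfieldC12 I K) G δ) i =
      2 * (∑ j, ∑ k, C12auxQ I K G δ i j k) - ∑ j, ∑ k, C12auxQ I K G δ j k i := by
  have key : ∀ a b c : Fin I, ∃ L : (Fin I → ℝ) →L[ℝ] ℝ,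
      HasFDerivAt (fun G : Fin I → ℝ => if (a : ℕ) + 1 + ((b : ℕ) + 1) = (c : ℕ) + 1 then
      K ((a : ℕ) + 1) ((b : ℕ) + 1) ((c : ℕ) + 1) * (G c - G a * G b) /
        ((1 - G a) * (1 - G b) * (1 - G c)) else 0) L G ∧ ∀ δ, L δ = C12auxQ I K G δ a b c := by
    intro a b c
    unfold C12auxQ
    split_ifs with h
    · exact C12aux_hasFDeriv _ G a b c (h1 a) (h1 b) (h1 c) (hG a b c h)
    · exact ⟨0, hasFDerivAt_const _ _, fun _ => rfl⟩
  choose L hL hLv using key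
  have hS : HasFDerivAt (SfieldC12 I K) (ContinuousLinearMap.pi fun i =>
      (2 : ℝ) • (∑ j, ∑ k, L i j k) - ∑ j, ∑ k, L j k i) G := by
    rw [hasFDerivAt_pi]
    intro i
    have hA := (HasFDerivAt.fun_sum (u := Finset.univ) fun j _ =>
      HasFDerivAt.fun_sum (u := Finset.univ) fun k _ => hL i j k).const_mul 2
    have hB := (HasFDerivAt.fun_sum (u := Finset.univ) fun j _ =>
      HasFDerivAt.fun_sum (u := Finset.univ) fun k _ => hL j k i)
    have hC := hA.sub hB
    refine hC.congr_of_eventuallyEq (Filter.Eventually.of_forall fun x => ?_)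
    simp only [SfieldC12, Pi.sub_apply]
    refine Eq.trans ?_ (sub_eq_add_neg _ _).symm
    rw [← Finset.sum_neg_distrib]
    congr 1
    refine Finset.sum_congr rfl fun j _ => ?_
    rw [← Finset.sum_neg_distrib]
    refine Finset.sum_congr rfl fun k _ => ?_
    split_ifs with h
    · rw [(hKsymm ((i : ℕ) + 1) ((j : ℕ) + 1) ((k : ℕ) + 1)).1,
        (hKsymm ((j : ℕ) + 1) ((i : ℕ) + 1) ((k : ℕ) + 1)).2,
        show (1 - x i) * (1 - x j) * (1 - x k) = (1 - x j) * (1 - x k) * (1 - x i) by ring]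
      ring
    · simp
  rw [hS.fderiv]
  simp [hLv]

/-- The Jacobian of `S` at the equilibrium `G*_k = e^{−ρk}` is negative definite
on the span of the reaction vectors, with respect to the inner product
`⟨u, v⟩ = Σ_k u_k v_k / G*_k`. -/
theorem C12_jacobian_negative_definite (I : ℕ) (hI : 2 ≤ I) (K : ℕ → ℕ → ℕ → ℝ)
    (hKpos : ∀ a b c, 0 < K a b c)
    (hKsymm : ∀ a b c, K a b c = K b a c ∧ K a b c = K a c b)
    (ρ : ℝ) (hρ : 0 < ρ)
    (Gstar : Fin I → ℝ)
    (hGstar : ∀ i : Fin I, Gstar i = Real.exp (-(ρ * ((i : ℕ) + 1)))) :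
    ∀ δ : Fin I → ℝ,
      δ ∈ Submodule.span ℝ {v : Fin I → ℝ | ∃ i₁ i₂ i₃ : Fin I,
        (i₂ : ℕ) + 1 + ((i₃ : ℕ) + 1) = (i₁ : ℕ) + 1 ∧
        v = Pi.single i₁ 1 - Pi.single i₂ 1 - Pi.single i₃ 1} →
      δ ≠ 0 →
      ∑ i : Fin I, (fderiv ℝ (SfieldC12 I K) Gstar δ) i * δ i / Gstar i < 0 := by
  intro δ hδ hne
  have hpos : ∀ i, 0 < Gstar i := fun i => by rw [hGstar]; exact Real.exp_pos _
  have hlt : ∀ i, Gstar i < 1 := fun i => by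
    rw [hGstar, Real.exp_lt_one_iff]
    have : 0 < ρ * ((i : ℕ) + 1 : ℝ) := by positivity
    linarith
  have hG : ∀ a b c : Fin I, (a : ℕ) + 1 + ((b : ℕ) + 1) = (c : ℕ) + 1 →
      Gstar c = Gstar a * Gstar b := by
    intro a b c h
    rw [hGstar, hGstar, hGstar, ← Real.exp_add]
    have h' : ((a : ℕ) : ℝ) + 1 + ((b : ℕ) + 1) = (c : ℕ) + 1 := by exact_mod_cast h
    rw [← h']
    congr 1
    ring
  obtain ⟨x, hx⟩ : ∃ x : Fin I → ℝ, ∀ i, δ i = Gstar i * x i :=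
    ⟨fun i => δ i / Gstar i, fun i => by field_simp [(hpos i).ne']⟩
  have hw : ∀ a b c : Fin I, 0 < K ((a : ℕ) + 1) ((b : ℕ) + 1) ((c : ℕ) + 1) /
      ((1 - Gstar a) * (1 - Gstar b) * (1 - Gstar c)) * Gstar c := by
    intro a b c
    have := hKpos ((a : ℕ) + 1) ((b : ℕ) + 1) ((c : ℕ) + 1)
    have ha := sub_pos.mpr (hlt a)
    have hb := sub_pos.mpr (hlt b)
    have hc := sub_pos.mpr (hlt c)
    have := hpos c
    positivity
  have hterm : ∀ a b c : Fin I, C12auxQ I K Gstar δ a b c * (x a + x b - x c) =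
      if (a : ℕ) + 1 + ((b : ℕ) + 1) = (c : ℕ) + 1 then
      -(K ((a : ℕ) + 1) ((b : ℕ) + 1) ((c : ℕ) + 1) /
      ((1 - Gstar a) * (1 - Gstar b) * (1 - Gstar c)) * Gstar c * (x a + x b - x c) ^ 2) else 0 := by
    intro a b c
    unfold C12auxQ
    split_ifs with h
    · rw [hx a, hx b, hx c]
      generalize K ((a : ℕ) + 1) ((b : ℕ) + 1) ((c : ℕ) + 1) /
        ((1 - Gstar a) * (1 - Gstar b) * (1 - Gstar c)) = w
      rw [hG a b c h]
      ring
    · simp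
  have hQ : ∀ a b c, C12auxQ I K Gstar δ a b c = C12auxQ I K Gstar δ b a c := by
    intro a b c
    unfold C12auxQ
    rw [(hKsymm ((a : ℕ) + 1) ((b : ℕ) + 1) ((c : ℕ) + 1)).1,
      add_comm ((a : ℕ) + 1) ((b : ℕ) + 1), mul_comm (1 - Gstar a) (1 - Gstar b)]
    congr 2
    ring
  have hsum : ∑ i : Fin I, (fderiv ℝ (SfieldC12 I K) Gstar δ) i * δ i / Gstar i =
      ∑ a, ∑ b, ∑ c, C12auxQ I K Gstar δ a b c * (x a + x b - x c) := by
    rw [← C12aux_sum_s9 _ x hQ]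
    refine Finset.sum_congr rfl fun i _ => ?_
    rw [C12aux_fderiv K hKsymm Gstar (fun i => (hlt i).ne) hG, hx i]
    have := (hpos i).ne'
    field_simp
  rw [hsum]
  have hle : ∀ a b c : Fin I, C12auxQ I K Gstar δ a b c * (x a + x b - x c) ≤ 0 := by
    intro a b c
    rw [hterm]
    split_ifs
    · have := mul_nonneg (hw a b c).le (sq_nonneg (x a + x b - x c))
      linarith
    · exact le_rfl
  have hle1 : ∀ a b : Fin I, ∑ c, C12auxQ I K Gstar δ a b c * (x a + x b - x c) ≤ 0 :=
    fun a b => Finset.sum_nonpos fun c _ => hle a b c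
  have hle2 : ∀ a : Fin I, ∑ b, ∑ c, C12auxQ I K Gstar δ a b c * (x a + x b - x c) ≤ 0 :=
    fun a => Finset.sum_nonpos fun b _ => hle1 a b
  refine lt_of_le_of_ne (Finset.sum_nonpos fun a _ => hle2 a) fun h0 => hne ?_
  have hadd : ∀ a b c : Fin I, (a : ℕ) + 1 + ((b : ℕ) + 1) = (c : ℕ) + 1 →
      x c = x a + x b := by
    intro a b c h
    have z1 := (Finset.sum_eq_zero_iff_of_nonpos fun a _ => hle2 a).mp h0 a (Finset.mem_univ _)
    have z2 := (Finset.sum_eq_zero_iff_of_nonpos fun b _ => hle1 a b).mp z1 b (Finset.mem_univ _)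
    have z3 := (Finset.sum_eq_zero_iff_of_nonpos fun c _ => hle a b c).mp z2 c (Finset.mem_univ _)
    rw [hterm, if_pos h, neg_eq_zero] at z3
    have := (mul_eq_zero.mp z3).resolve_left (hw a b c).ne'
    have := pow_eq_zero_iff (two_ne_zero) |>.mp this
    linarith
  have hlin : ∀ n : ℕ, ∀ h : n < I, x ⟨n, h⟩ = ((n : ℝ) + 1) * x ⟨0, by omega⟩ := by
    intro n
    induction n with
    | zero => intro h; simp
    | succ n ih =>
      intro h
      rw [hadd ⟨n, by omega⟩ ⟨0, by omega⟩ ⟨n + 1, h⟩ (by simp), ih (by omega)]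
      push_cast
      ring
  have hcons : ∑ i : Fin I, ((i : ℕ) + 1 : ℝ) * δ i = 0 := by
    clear hsum hterm hQ hle hle1 hle2 h0 hne hx
    induction hδ using Submodule.span_induction with
    | mem v hv =>
      obtain ⟨a, b, c, h, rfl⟩ := hv
      have h' : ((b : ℕ) : ℝ) + 1 + ((c : ℕ) + 1) = (a : ℕ) + 1 := by exact_mod_cast h
      simp only [Pi.sub_apply, mul_sub, Finset.sum_sub_distrib, Pi.single_apply, mul_ite, mul_one,
        mul_zero, Finset.sum_ite_eq', Finset.sum_ite_eq, Finset.mem_univ, if_true]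
      linarith
    | zero => simp
    | add u v _ _ hu hv =>
      simp only [Pi.add_apply, mul_add, Finset.sum_add_distrib] at *
      linarith
    | smul r v _ hv =>
      have : ∑ i : Fin I, ((i : ℕ) + 1 : ℝ) * (r • v) i = r * ∑ i : Fin I, ((i : ℕ) + 1 : ℝ) * v i := by
        rw [Finset.mul_sum]
        refine Finset.sum_congr rfl fun i _ => ?_
        simp only [Pi.smul_apply, smul_eq_mul]
        ring
      rw [this, hv, mul_zero]
  have hδ' : ∀ i : Fin I, δ i = Gstar i * (((i : ℕ) + 1 : ℝ) * x ⟨0, by omega⟩) := fun i => by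
    rw [hx i, hlin i i.2]
  have hfac : (∑ i : Fin I, ((i : ℕ) + 1 : ℝ) ^ 2 * Gstar i) * x ⟨0, by omega⟩ = 0 := by
    rw [← hcons, Finset.sum_mul]
    refine Finset.sum_congr rfl fun i _ => ?_
    rw [hδ' i]
    ring
  have hS : 0 < ∑ i : Fin I, ((i : ℕ) + 1 : ℝ) ^ 2 * Gstar i := by
    apply Finset.sum_pos
    · intro i _
      have := hpos i
      positivity
    · exact ⟨⟨0, by omega⟩, Finset.mem_univ _⟩
  have hx0 := (mul_eq_zero.mp hfac).resolve_left hS.ne'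
  funext i
  rw [hδ' i, hx0]
  simp
end

section
/- Every differentiable solution F : [0,∞) → ℝ^I of the discrete C₁₃ system satisfies conservation of energy: Σ_{k=1}^I k·F_k(t) = Σ_{k=1}^I k·F_k(0) for all t ≥ 0; equivalently, Σ_{k=1}^I k·(dF_k/dt)(t) = 0 for all t ≥ 0. -/
/-- The right-hand side of the discrete `C₁₃` system for `k₁ ∈ {1,…,I}`. -/
noncomputable def C13 (I : ℕ) (K : ℕ → ℕ → ℕ → ℕ → ℝ) (F : ℕ → ℝ) (k₁ : ℕ) : ℝ :=
  (∑ k₂ ∈ Finset.Icc 1 I, ∑ k₃ ∈ Finset.Icc 1 I, ∑ k₄ ∈ Finset.Icc 1 I,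
    if k₂ + k₃ + k₄ = k₁ then
      K k₁ k₂ k₃ k₄ * ((F k₁ + 1) * F k₂ * F k₃ * F k₄
        - F k₁ * (F k₂ + 1) * (F k₃ + 1) * (F k₄ + 1))
    else 0)
  - 3 * (∑ k₂ ∈ Finset.Icc 1 I, ∑ k₃ ∈ Finset.Icc 1 I, ∑ k₄ ∈ Finset.Icc 1 I,
    if k₁ + k₃ + k₄ = k₂ then
      K k₂ k₁ k₃ k₄ * ((F k₂ + 1) * F k₁ * F k₃ * F k₄
        - F k₂ * (F k₁ + 1) * (F k₃ + 1) * (F k₄ + 1))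
    else 0)

theorem C13_aux (s : Finset ℕ) (G : ℕ → ℕ → ℕ → ℕ → ℝ)
    (h1 : ∀ a b c d, G a b c d = G a c b d) (h2 : ∀ a b c d, G a b c d = G a b d c)
    (h0 : ∀ a b c d : ℕ, (a : ℝ) * G a b c d = b * G a b c d + c * G a b c d + d * G a b c d) :
    ∑ k ∈ s, (k : ℝ) * ((∑ b ∈ s, ∑ c ∈ s, ∑ d ∈ s, G k b c d)
      - 3 * (∑ b ∈ s, ∑ c ∈ s, ∑ d ∈ s, G b k c d)) = 0 := by
  have e2 : ∑ k ∈ s, ∑ b ∈ s, ∑ c ∈ s, ∑ d ∈ s, (k : ℝ) * G b k c d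
      = ∑ a ∈ s, ∑ b ∈ s, ∑ c ∈ s, ∑ d ∈ s, (b : ℝ) * G a b c d := Finset.sum_comm
  have e3 : ∑ a ∈ s, ∑ b ∈ s, ∑ c ∈ s, ∑ d ∈ s, (c : ℝ) * G a b c d
      = ∑ a ∈ s, ∑ b ∈ s, ∑ c ∈ s, ∑ d ∈ s, (b : ℝ) * G a b c d := by
    refine Finset.sum_congr rfl fun a _ => ?_
    rw [Finset.sum_comm]
    refine Finset.sum_congr rfl fun b _ => Finset.sum_congr rfl fun c _ =>
      Finset.sum_congr rfl fun d _ => ?_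
    rw [h1]
  have e4 : ∑ a ∈ s, ∑ b ∈ s, ∑ c ∈ s, ∑ d ∈ s, (d : ℝ) * G a b c d
      = ∑ a ∈ s, ∑ b ∈ s, ∑ c ∈ s, ∑ d ∈ s, (c : ℝ) * G a b c d := by
    refine Finset.sum_congr rfl fun a _ => Finset.sum_congr rfl fun b _ => ?_
    rw [Finset.sum_comm]
    refine Finset.sum_congr rfl fun c _ => Finset.sum_congr rfl fun d _ => ?_
    rw [h2]
  have e1 : ∑ a ∈ s, ∑ b ∈ s, ∑ c ∈ s, ∑ d ∈ s, (a : ℝ) * G a b c d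
      = ∑ a ∈ s, ∑ b ∈ s, ∑ c ∈ s, ∑ d ∈ s, (b : ℝ) * G a b c d
      + ∑ a ∈ s, ∑ b ∈ s, ∑ c ∈ s, ∑ d ∈ s, (c : ℝ) * G a b c d
      + ∑ a ∈ s, ∑ b ∈ s, ∑ c ∈ s, ∑ d ∈ s, (d : ℝ) * G a b c d := by
    simp only [← Finset.sum_add_distrib, h0]
  have e : ∑ k ∈ s, (k : ℝ) * ((∑ b ∈ s, ∑ c ∈ s, ∑ d ∈ s, G k b c d)
      - 3 * (∑ b ∈ s, ∑ c ∈ s, ∑ d ∈ s, G b k c d))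
      = ∑ a ∈ s, ∑ b ∈ s, ∑ c ∈ s, ∑ d ∈ s, (a : ℝ) * G a b c d
      - 3 * ∑ k ∈ s, ∑ b ∈ s, ∑ c ∈ s, ∑ d ∈ s, (k : ℝ) * G b k c d := by
    rw [Finset.mul_sum, ← Finset.sum_sub_distrib]
    refine Finset.sum_congr rfl fun a _ => ?_
    simp only [← Finset.mul_sum]
    ring
  rw [e]
  linarith

/-- Conservation of energy for the discrete `C₁₃` system. -/
theorem C13_energy_conservation (I : ℕ) (hI : 4 ≤ I) (K : ℕ → ℕ → ℕ → ℕ → ℝ)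
    (hKpos : ∀ a b c d, 0 < K a b c d)
    (hKsymm : ∀ a b c d, K a b c d = K b a c d ∧ K a b c d = K a c b d ∧
      K a b c d = K a b d c)
    (F : ℝ → ℕ → ℝ)
    (hF : ∀ t ∈ Set.Ici (0 : ℝ), ∀ k₁ ∈ Finset.Icc 1 I,
      HasDerivWithinAt (fun s => F s k₁) (C13 I K (F t) k₁) (Set.Ici 0) t) :
    (∀ t ∈ Set.Ici (0 : ℝ),
      ∑ k ∈ Finset.Icc 1 I, (k : ℝ) * F t k = ∑ k ∈ Finset.Icc 1 I, (k : ℝ) * F 0 k) ∧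
    (∀ t ∈ Set.Ici (0 : ℝ),
      HasDerivWithinAt (fun s => ∑ k ∈ Finset.Icc 1 I, (k : ℝ) * F s k) 0 (Set.Ici 0) t) := by
  have hz : ∀ t, ∑ k ∈ Finset.Icc 1 I, (k : ℝ) * C13 I K (F t) k = 0 := by
    intro t
    refine C13_aux (Finset.Icc 1 I) (fun k₁ k₂ k₃ k₄ => if k₂ + k₃ + k₄ = k₁ then
      K k₁ k₂ k₃ k₄ * ((F t k₁ + 1) * F t k₂ * F t k₃ * F t k₄
        - F t k₁ * (F t k₂ + 1) * (F t k₃ + 1) * (F t k₄ + 1))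
      else 0) ?_ ?_ ?_
    · intro a b c d
      simp only [(hKsymm a b c d).2.1, add_comm b c]
      split_ifs
      · ring
      · rfl
    · intro a b c d
      simp only [(hKsymm a b c d).2.2, add_right_comm b c d]
      split_ifs
      · ring
      · rfl
    · intro a b c d
      by_cases h : b + c + d = a
      · subst h
        push_cast
        ring
      · simp [h]
  have hd : ∀ t ∈ Set.Ici (0 : ℝ),
      HasDerivWithinAt (fun s => ∑ k ∈ Finset.Icc 1 I, (k : ℝ) * F s k) 0 (Set.Ici 0) t := by
    intro t ht
    have h := HasDerivWithinAt.fun_sum (u := Finset.Icc 1 I)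
      fun k hk => (hF t ht k hk).const_mul (k : ℝ)
    rwa [hz t] at h
  refine ⟨fun t ht => ?_, hd⟩
  have := (convex_Ici (0 : ℝ)).norm_image_sub_le_of_norm_hasDerivWithin_le (C := 0)
    (f := fun s => ∑ k ∈ Finset.Icc 1 I, (k : ℝ) * F s k) (f' := fun _ => 0)
    hd (by simp) (Set.self_mem_Ici) ht
  rw [zero_mul] at this
  exact sub_eq_zero.mp (norm_le_zero_iff.mp this)
end

section
/- Let I ≥ 5 and let G ∈ (0,1)^I satisfy G_{k₁} = G_{k₂}·G_{k₃}·G_{k₄} for all k₁, k₂, k₃, k₄ ∈ {1,…,I} with k₂ + k₃ + k₄ = k₁. Then there exists ρ > 0 such that G_k = e^{−ρk} for all k ∈ {1,…,I}. -/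
/-- The detailed-balance relations of the discrete `C₁₃` operator force a
Bose–Einstein form: if `G ∈ (0,1)^I` (with `I ≥ 5`) satisfies
`G_{k₁} = G_{k₂} G_{k₃} G_{k₄}` whenever `k₂ + k₃ + k₄ = k₁`, then
`G_k = e^{−ρk}` for some `ρ > 0`. -/
theorem C13_detailed_balance_form (I : ℕ) (hI : 5 ≤ I) (G : ℕ → ℝ)
    (hG : ∀ k ∈ Finset.Icc 1 I, 0 < G k ∧ G k < 1)
    (hrel : ∀ k₁ ∈ Finset.Icc 1 I, ∀ k₂ ∈ Finset.Icc 1 I, ∀ k₃ ∈ Finset.Icc 1 I,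
      ∀ k₄ ∈ Finset.Icc 1 I, k₂ + k₃ + k₄ = k₁ → G k₁ = G k₂ * G k₃ * G k₄) :
    ∃ ρ > (0 : ℝ), ∀ k ∈ Finset.Icc 1 I, G k = Real.exp (-(ρ * k)) := by
  have h1 := hG 1 (by simp; omega)
  have h2 := hG 2 (by simp; omega)
  have rel : ∀ a b c : ℕ, 1 ≤ a → 1 ≤ b → 1 ≤ c → a + b + c ≤ I →
      G (a + b + c) = G a * G b * G c := by
    intro a b c ha hb hc h
    exact hrel _ (by simp; omega) _ (by simp; omega) _ (by simp; omega) _ (by simp; omega) rfl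
  have e3 : G 3 = G 1 * G 1 * G 1 := rel 1 1 1 (by omega) (by omega) (by omega) (by omega)
  have e5 : G 5 = G 1 * G 1 * G 3 := rel 1 1 3 (by omega) (by omega) (by omega) (by omega)
  have e5' : G 5 = G 1 * G 2 * G 2 := rel 1 2 2 (by omega) (by omega) (by omega) (by omega)
  have e2 : G 2 = G 1 ^ 2 := by
    have h : G 1 * (G 2 ^ 2) = G 1 * ((G 1 ^ 2) ^ 2) := by
      rw [e5, e3] at e5'
      linarith [e5']
    have h' := mul_left_cancel₀ h1.1.ne' h
    exact (pow_left_inj₀ h2.1.le (by positivity) two_ne_zero).1 h'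
  have key : ∀ k : ℕ, 1 ≤ k → k ≤ I → G k = G 1 ^ k := by
    intro k
    induction k using Nat.strong_induction_on with
    | _ k ih =>
      intro hk hkI
      rcases Nat.lt_or_ge k 3 with h | h
      · interval_cases k
        · simp
        · exact e2
      · obtain ⟨m, rfl⟩ : ∃ m, k = 1 + 1 + m := ⟨k - 2, by omega⟩
        rw [rel 1 1 m le_rfl le_rfl (by omega) hkI, ih m (by omega) (by omega) (by omega)]
        ring
  refine ⟨-Real.log (G 1), neg_pos.2 (Real.log_neg h1.1 h1.2), fun k hk => ?_⟩
  rw [Finset.mem_Icc] at hk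
  rw [key k hk.1 hk.2, neg_mul, neg_neg, mul_comm, Real.exp_nat_mul, Real.exp_log h1.1]
end
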